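/- Assume the Riemann hypothesis: every nontrivial zero of the Riemann zeta function ζ(s) has real part 1/2. Assume moreover that all nontrivial zeros of ζ are simple and that there exists θ with 1 ≤ θ < 3 − √3 such that J_{−1}(T) := ∑_{0<γ≤T} |ζ′(1/2+iγ)|^{−2} ≪ T^θ. Then lim_{Y→∞} (1/Y)∫_0^Y (M(e^y)/e^{y/2})² dy = ∑_{γ>0, ζ(1/2+iγ)=0} 2/|ρ ζ′(ρ)|², where M(x) = ∑_{n≤x} μ(n) and the sum runs over the nontrivial zeros ρ = 1/2 + iγ of ζ with γ > 0. -/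

import Mathlib

open MeasureTheory Filter Topology

/-- `M(x) = ∑_{n ≤ x} μ(n)`, the summatory function of the Möbius function. -/
noncomputable def Mfun (x : ℝ) : ℝ :=
  ∑ n ∈ Finset.Icc 1 ⌊x⌋₊, (ArithmeticFunction.moebius n : ℝ)

namespace MobiusMean

open Complex

/-- Riemann's entire function `ξ(s) = s (s - 1) Λ(s)`. -/
noncomputable def xi (s : ℂ) : ℂ := s * (s - 1) * completedRiemannZeta₀ s + 1

lemma differentiable_xi : Differentiable ℂ xi := by
  unfold xi
  have := differentiable_completedZeta₀
  fun_prop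

lemma xi_one_sub (s : ℂ) : xi (1 - s) = xi s := by
  unfold xi
  rw [completedRiemannZeta₀_one_sub]; ring

lemma xi_eq {s : ℂ} (h0 : s ≠ 0) (h1 : s ≠ 1) : xi s = s * (s - 1) * completedRiemannZeta s := by
  unfold xi
  rw [completedRiemannZeta_eq]
  have : (1 - s) ≠ 0 := sub_ne_zero.mpr h1.symm
  field_simp
  ring

lemma xi_zero : xi 0 = 1 := by simp [xi]
lemma xi_one : xi 1 = 1 := by simp [xi]

lemma xi_eq_zeta {s : ℂ} (h0 : s ≠ 0) (h1 : s ≠ 1) (hG : Gammaℝ s ≠ 0) :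
    xi s = s * (s - 1) * Gammaℝ s * riemannZeta s := by
  rw [xi_eq h0 h1, riemannZeta_def_of_ne_zero h0]
  field_simp

lemma zeta_conj (s : ℂ) (hs : s ≠ 1) :
    riemannZeta ((starRingEnd ℂ) s) = (starRingEnd ℂ) (riemannZeta s) := by
  have hopen : IsOpen ({1}ᶜ : Set ℂ) := isOpen_compl_singleton
  have h1 : AnalyticOnNhd ℂ riemannZeta ({1}ᶜ : Set ℂ) := by
    apply DifferentiableOn.analyticOnNhd _ hopen
    intro z hz
    exact (differentiableAt_riemannZeta hz).differentiableWithinAt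
  have h2 : AnalyticOnNhd ℂ (fun z => (starRingEnd ℂ) (riemannZeta ((starRingEnd ℂ) z)))
      ({1}ᶜ : Set ℂ) := by
    apply DifferentiableOn.analyticOnNhd _ hopen
    intro z hz
    have hz' : (starRingEnd ℂ) z ≠ 1 := by
      intro h
      apply hz
      have := congrArg (starRingEnd ℂ) h
      simpa using this
    exact (differentiableAt_conj_conj_iff.mpr (differentiableAt_riemannZeta hz')).differentiableWithinAt
  have hconn : IsPreconnected ({1}ᶜ : Set ℂ) :=
    (isConnected_compl_singleton_of_one_lt_rank (by simp [Complex.rank_real_complex]) 1).isPreconnected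
  have key := h1.eqOn_of_preconnected_of_eventuallyEq h2 hconn (z₀ := 2) (by simp) (by
    have : ∀ᶠ z : ℂ in 𝓝 2, 1 < z.re := by
      apply (isOpen_lt continuous_const continuous_re).mem_nhds
      simp
    filter_upwards [this] with z hz
    rw [zeta_eq_tsum_one_div_nat_cpow hz, zeta_eq_tsum_one_div_nat_cpow (by simpa using hz),
      conj_tsum]
    congr 1
    ext n
    rw [map_div₀, map_one]
    congr 1
    rw [cpow_conj _ _ (by rw [natCast_arg]; exact Real.pi_ne_zero.symm)]
    simp)
  have := key (show s ∈ ({1}ᶜ : Set ℂ) from hs)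
  simp only at this
  rw [this]
  simp

lemma zeros_of_xi {s : ℂ} (h : xi s = 0) : 0 < s.re ∧ s.re < 1 ∧ riemannZeta s = 0 := by
  have h0 : s ≠ 0 := by rintro rfl; simp [xi_zero] at h
  have h1 : s ≠ 1 := by rintro rfl; simp [xi_one] at h
  have key : ∀ z : ℂ, z ≠ 0 → z ≠ 1 → 1 ≤ z.re → xi z ≠ 0 := by
    intro z hz0 hz1 hz
    have hG : Gammaℝ z ≠ 0 := Gammaℝ_ne_zero_of_re_pos (by linarith)
    rw [xi_eq_zeta hz0 hz1 hG]
    have := riemannZeta_ne_zero_of_one_le_re hz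
    have : z - 1 ≠ 0 := sub_ne_zero.mpr hz1
    simp_all
  have hre1 : s.re < 1 := by
    by_contra hc
    exact key s h0 h1 (by linarith) h
  have hre0 : 0 < s.re := by
    by_contra hc
    refine key (1 - s) (sub_ne_zero.mpr h1.symm) ?_ ?_ (by rw [xi_one_sub]; exact h)
    · intro h'
      apply h0
      linear_combination -h'
    · simp; linarith
  have hG : Gammaℝ s ≠ 0 := Gammaℝ_ne_zero_of_re_pos hre0
  rw [xi_eq_zeta h0 h1 hG] at h
  refine ⟨hre0, hre1, ?_⟩
  have : s - 1 ≠ 0 := sub_ne_zero.mpr h1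
  simp_all

lemma xi_zero_of_zeta {s : ℂ} (h0 : 0 < s.re) (h : riemannZeta s = 0) : xi s = 0 := by
  have hs0 : s ≠ 0 := by rintro rfl; simp at h0
  have h1 : s ≠ 1 := by
    rintro rfl
    exact riemannZeta_ne_zero_of_one_le_re (by simp) h
  rw [xi_eq_zeta hs0 h1 (Gammaℝ_ne_zero_of_re_pos h0), h, mul_zero]

lemma completedZeta₀_bounded (a b : ℝ) :
    ∃ C, ∀ s : ℂ, a ≤ s.re → s.re ≤ b → ‖completedRiemannZeta₀ s‖ ≤ C := by
  set P := HurwitzZeta.hurwitzEvenFEPair 0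
  have hconv : ∀ s : ℂ, MellinConvergent P.f_modif s :=
    fun s => (P.isStrongFEPair_toStrongFEPair.hasMellin s).1
  set F : ℝ → ℝ := fun t => ‖((t : ℂ) ^ (((a / 2 : ℝ) : ℂ) - 1)) • P.f_modif t‖ +
    ‖((t : ℂ) ^ (((b / 2 : ℝ) : ℂ) - 1)) • P.f_modif t‖ with hF
  have hFi : IntegrableOn F (Set.Ioi 0) := (hconv _).norm.add (hconv _).norm
  refine ⟨(∫ t in Set.Ioi 0, F t) / 2, fun s hsa hsb => ?_⟩
  have : completedRiemannZeta₀ s = mellin P.f_modif (s / 2) / 2 := rfl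
  rw [this, norm_div, Complex.norm_ofNat]
  apply div_le_div_of_nonneg_right _ (by norm_num)
  unfold mellin
  apply norm_integral_le_of_norm_le hFi
  filter_upwards [ae_restrict_mem measurableSet_Ioi] with t ht
  have ht : 0 < t := ht
  rw [hF]
  simp only [norm_smul]
  rw [norm_cpow_eq_rpow_re_of_pos ht, norm_cpow_eq_rpow_re_of_pos ht,
    norm_cpow_eq_rpow_re_of_pos ht, ← add_mul]
  apply mul_le_mul_of_nonneg_right _ (norm_nonneg _)
  have e : (s / 2 - 1 : ℂ).re = s.re / 2 - 1 := by simp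
  have e1 : (((a / 2 : ℝ) : ℂ) - 1).re = a / 2 - 1 := by simp
  have e2 : (((b / 2 : ℝ) : ℂ) - 1).re = b / 2 - 1 := by simp
  rw [e, e1, e2]
  rcases le_total 1 t with h | h
  · have := Real.rpow_le_rpow_of_exponent_le h (show s.re / 2 - 1 ≤ b / 2 - 1 by linarith)
    have := Real.rpow_nonneg ht.le (a / 2 - 1)
    linarith
  · have := Real.rpow_le_rpow_of_exponent_ge ht h (show a / 2 - 1 ≤ s.re / 2 - 1 by linarith)
    have := Real.rpow_nonneg ht.le (b / 2 - 1)
    linarith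

lemma inv_zeta_bounded {b : ℝ} (hb : 1 < b) :
    ∃ C, ∀ s : ℂ, b ≤ s.re → ‖(riemannZeta s)⁻¹‖ ≤ C ∧ ‖riemannZeta s‖ ≤ C := by
  have hsum : Summable (fun n : ℕ => 1 / (n : ℝ) ^ b) :=
    Real.summable_one_div_nat_rpow.mpr hb
  have gen : ∀ (f : ℕ → ℂ), (∀ n, ‖f n‖ ≤ 1) → ∀ s : ℂ, b ≤ s.re →
      ‖LSeries f s‖ ≤ ∑' n : ℕ, 1 / (n : ℝ) ^ b := by
    intro f hf s hs
    unfold LSeries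
    apply tsum_of_norm_bounded hsum.hasSum
    intro n
    rcases Nat.eq_zero_or_pos n with rfl | hn
    · simp; positivity
    · rw [LSeries.term_of_ne_zero hn.ne', norm_div, norm_natCast_cpow_of_pos hn]
      have h1 : (1:ℝ) ≤ n := by exact_mod_cast hn
      have := Real.rpow_le_rpow_of_exponent_le h1 hs
      have hp : 0 < (n:ℝ) ^ b := by positivity
      exact div_le_div₀ zero_le_one (hf n) hp this
  refine ⟨∑' n : ℕ, 1 / (n : ℝ) ^ b, fun s hs => ?_⟩
  have hs1 : 1 < s.re := by linarith
  have hz : LSeries (fun n => ((ArithmeticFunction.zeta n : ℕ) : ℂ)) s = riemannZeta s := by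
    exact ArithmeticFunction.LSeries_zeta_eq_riemannZeta hs1
  constructor
  · have hm := ArithmeticFunction.LSeries_zeta_mul_Lseries_moebius hs1
    rw [hz] at hm
    rw [inv_eq_of_mul_eq_one_right hm]
    apply gen _ _ s hs
    intro n
    have := ArithmeticFunction.abs_moebius_le_one (n := n)
    rw [norm_intCast]
    exact_mod_cast this
  · rw [← hz]
    apply gen _ _ s hs
    intro n
    by_cases h : n = 0 <;> simp [h, ArithmeticFunction.zeta_apply]

lemma norm_Gamma_le {s : ℂ} (hs : 0 < s.re) : ‖Gamma s‖ ≤ Real.Gamma s.re := by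
  rw [Gamma_eq_integral hs, Real.Gamma_eq_integral hs]
  unfold GammaIntegral
  apply norm_integral_le_of_norm_le (Real.GammaIntegral_convergent hs)
  filter_upwards [ae_restrict_mem measurableSet_Ioi] with t ht
  have ht : 0 < t := ht
  rw [norm_mul, norm_cpow_eq_rpow_re_of_pos ht, norm_real, Real.norm_of_nonneg (Real.exp_pos _).le]
  simp

lemma norm_Gamma_one_add_sq {y : ℝ} (hy : y ≠ 0) :
    ‖Gamma (1 + y * I)‖ ^ 2 = Real.pi * y / Real.sinh (Real.pi * y) := by
  have hyI : (y * I : ℂ) ≠ 0 := by simp [hy]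
  have h1 : Gamma (1 + y * I) = (y * I) * Gamma (y * I) := by
    rw [add_comm, Gamma_add_one _ hyI]
  have h2 : (starRingEnd ℂ) (Gamma (1 + y * I)) = Gamma (1 - y * I) := by
    rw [← Gamma_conj]; simp [sub_eq_add_neg]
  have h3 : ((‖Gamma (1 + y * I)‖ ^ 2 : ℝ) : ℂ) = Gamma (1 + y * I) * Gamma (1 - y * I) := by
    rw [← h2, mul_conj, normSq_eq_norm_sq]
  have h4 : Gamma (1 + y * I) * Gamma (1 - y * I) =
      ((Real.pi * y / Real.sinh (Real.pi * y) : ℝ) : ℂ) := by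
    rw [h1, mul_assoc, Gamma_mul_Gamma_one_sub, ← mul_assoc, sin_mul_I]
    push_cast
    field_simp
  exact_mod_cast h3.trans h4

lemma norm_Gamma_half_add_sq (y : ℝ) :
    ‖Gamma (1 / 2 + y * I)‖ ^ 2 = Real.pi / Real.cosh (Real.pi * y) := by
  have h2 : (starRingEnd ℂ) (Gamma (1 / 2 + y * I)) = Gamma (1 - (1 / 2 + y * I)) := by
    rw [← Gamma_conj]
    congr 1
    simp [map_ofNat]
    ring
  have h3 : ((‖Gamma (1 / 2 + y * I)‖ ^ 2 : ℝ) : ℂ) =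
      Gamma (1 / 2 + y * I) * Gamma (1 - (1 / 2 + y * I)) := by
    rw [← h2, mul_conj, normSq_eq_norm_sq]
  have h4 : Gamma (1 / 2 + y * I) * Gamma (1 - (1 / 2 + y * I)) =
      ((Real.pi / Real.cosh (Real.pi * y) : ℝ) : ℂ) := by
    rw [Gamma_mul_Gamma_one_sub]
    have : (Real.pi : ℂ) * (1 / 2 + y * I) = (Real.pi * y) * I + Real.pi / 2 := by ring
    rw [this, sin_add_pi_div_two, cos_mul_I]
    push_cast
    rfl
  exact_mod_cast h3.trans h4

lemma norm_Gamma_one_add_bounds (y : ℝ) :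
    Real.exp (-(Real.pi * |y|)) ≤ ‖Gamma (1 + y * I)‖ ^ 2 ∧
    ‖Gamma (1 + y * I)‖ ^ 2 ≤ (1 + 2 * Real.pi * |y|) * Real.exp (-(Real.pi * |y|)) := by
  rcases eq_or_ne y 0 with rfl | hy
  · simp
  · rw [norm_Gamma_one_add_sq hy]
    have habs : Real.pi * y / Real.sinh (Real.pi * y) =
        Real.pi * |y| / Real.sinh (Real.pi * |y|) := by
      rcases abs_cases y with ⟨h, -⟩ | ⟨h, -⟩ <;> rw [h]
      rw [mul_neg, Real.sinh_neg, neg_div_neg_eq]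
    rw [habs]
    have hpos : 0 < Real.pi * |y| := by positivity
    have e2 : 1 + 2 * Real.pi * |y| = 1 + 2 * (Real.pi * |y|) := by ring
    rw [e2]
    generalize Real.pi * |y| = x at hpos
    have hs : 0 < Real.sinh x := Real.sinh_pos_iff.mpr hpos
    have e1 : Real.sinh x = Real.exp x * (1 - Real.exp (-(2 * x))) / 2 := by
      rw [Real.sinh_eq, mul_sub, ← Real.exp_add]; ring_nf
    have b1 : 1 - 2 * x ≤ Real.exp (-(2 * x)) := by
      have := Real.add_one_le_exp (-(2 * x)); linarith
    have b2 : Real.exp (-(2 * x)) * (1 + 2 * x) ≤ 1 := by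
      have := Real.add_one_le_exp (2 * x)
      rw [Real.exp_neg, inv_mul_le_one₀ (Real.exp_pos _)]
      linarith
    have e3 : Real.exp x * Real.exp (-x) = 1 := by rw [← Real.exp_add]; simp
    constructor
    · rw [le_div_iff₀ hs, e1]
      have : Real.exp (-x) * (Real.exp x * (1 - Real.exp (-(2 * x))) / 2) =
        (1 - Real.exp (-(2 * x))) / 2 := by linear_combination e3 * (1 - Real.exp (-(2 * x))) / 2
      rw [this]; linarith
    · rw [div_le_iff₀ hs, e1]
      have : (1 + 2 * x) * Real.exp (-x) * (Real.exp x * (1 - Real.exp (-(2 * x))) / 2) =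
        (1 + 2 * x) * (1 - Real.exp (-(2 * x))) / 2 := by
        linear_combination e3 * (1 + 2 * x) * (1 - Real.exp (-(2 * x))) / 2
      rw [this]; nlinarith

lemma norm_Gamma_half_add_bound (y : ℝ) :
    ‖Gamma (1 / 2 + y * I)‖ ^ 2 ≤ 2 * Real.pi * Real.exp (-(Real.pi * |y|)) := by
  rw [norm_Gamma_half_add_sq, ← Real.cosh_abs, abs_mul, abs_of_pos Real.pi_pos]
  generalize Real.pi * |y| = x
  rw [div_le_iff₀ (Real.cosh_pos x), Real.cosh_eq]
  have e3 : Real.exp (-x) * Real.exp x = 1 := by rw [← Real.exp_add]; simp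
  have : 2 * Real.pi * Real.exp (-x) * ((Real.exp x + Real.exp (-x)) / 2) =
    Real.pi + Real.pi * (Real.exp (-x)) ^ 2 := by linear_combination e3 * Real.pi
  rw [this]
  have := Real.pi_pos
  nlinarith [mul_nonneg this.le (sq_nonneg (Real.exp (-x)))]

/-- `ξ` normalised by an exponential so that it has polynomial size in the upper half plane. -/
noncomputable def fxi (s : ℂ) : ℂ := xi s * exp (-(Real.pi / 4 * I * s))

lemma differentiable_fxi : Differentiable ℂ fxi := by
  unfold fxi
  have := differentiable_xi
  fun_prop

lemma norm_fxi (s : ℂ) : ‖fxi s‖ = ‖xi s‖ * Real.exp (Real.pi / 4 * s.im) := by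
  unfold fxi
  rw [norm_mul, norm_exp]
  congr 2
  have : (Real.pi / 4 * I * s : ℂ) = ((Real.pi / 4 : ℝ) : ℂ) * (I * s) := by push_cast; ring
  rw [this, neg_re, re_ofReal_mul]
  simp

lemma fxi_eq_zero {s : ℂ} : fxi s = 0 ↔ xi s = 0 := by
  unfold fxi; simp [exp_ne_zero]

lemma xi_bound_eight : ∃ C, 0 ≤ C ∧ ∀ s : ℂ, s.re = 8 →
    ‖xi s‖ ≤ C * ‖s + 9‖ ^ 6 * Real.exp (-(Real.pi / 4 * |s.im|)) := by
  obtain ⟨C, hC⟩ := inv_zeta_bounded (b := 8) (by norm_num)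
  have hC0 : 0 ≤ C := (norm_nonneg _).trans (hC 8 (by simp)).1
  refine ⟨8 * C, by positivity, fun s hs => ?_⟩
  have h0 : s ≠ 0 := by rintro rfl; simp at hs
  have h1 : s ≠ 1 := by rintro rfl; simp at hs
  rw [xi_eq_zeta h0 h1 (Gammaℝ_ne_zero_of_re_pos (by linarith)), norm_mul, norm_mul, norm_mul,
    Gammaℝ_def, norm_mul]
  have hz := (hC s hs.ge).2
  set t := s.im with ht
  set y := t / 2 with hy
  have hse : s / 2 = (1 + y * I) + 1 + 1 + 1 := by
    apply Complex.ext
    · simp [hs]; norm_num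
    · simp [hy, ht]
  have ne : ∀ a : ℝ, 0 < a → (a + y * I : ℂ) ≠ 0 := by
    intro a ha h
    have := congrArg re h
    simp at this
    exact ha.ne' this
  have hG : Gamma (s / 2) = (3 + y * I) * ((2 + y * I) * ((1 + y * I) * Gamma (1 + y * I))) := by
    have n1 := ne 1 one_pos
    have n2 := ne 2 two_pos
    have n3 := ne 3 three_pos
    push_cast at n1 n2 n3
    have e2 : (1 + y * I + 1 : ℂ) = 2 + y * I := by ring
    have e3 : (2 + y * I + 1 : ℂ) = 3 + y * I := by ring
    rw [hse, e2, e3, Gamma_add_one _ n3, ← e3, Gamma_add_one _ n2, ← e2, Gamma_add_one _ n1]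
  have hre : (s + 9).re = 17 := by simp [hs]; norm_num
  have him : (s + 9).im = t := by simp [ht]
  have hn17 : 17 ≤ ‖s + 9‖ := by rw [← hre]; exact re_le_norm _
  have hnt : |t| ≤ ‖s + 9‖ := by rw [← him]; exact abs_im_le_norm _
  have cmp : ∀ z : ℂ, |z.re| ≤ 17 → |z.im| ≤ |t| → ‖z‖ ≤ ‖s + 9‖ := by
    intro z h1 h2
    rw [← sq_le_sq₀ (norm_nonneg _) (norm_nonneg _), ← normSq_eq_norm_sq, ← normSq_eq_norm_sq,
      normSq_apply, normSq_apply, hre, him]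
    have := abs_le.mp h1
    have := sq_le_sq.mpr h2
    nlinarith
  have hy2 : |y| ≤ |t| := by
    rw [hy, abs_div, abs_two]; linarith [abs_nonneg t]
  have c1 : ‖s‖ ≤ ‖s + 9‖ := cmp _ (by rw [hs]; norm_num) (by rw [ht])
  have c2 : ‖s - 1‖ ≤ ‖s + 9‖ := cmp _ (by simp [hs]; norm_num) (by simp [ht])
  have c3 : ‖(1 + y * I : ℂ)‖ ≤ ‖s + 9‖ := cmp _ (by simp) (by simpa using hy2)
  have c4 : ‖(2 + y * I : ℂ)‖ ≤ ‖s + 9‖ := cmp _ (by simp; norm_num) (by simpa using hy2)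
  have c5 : ‖(3 + y * I : ℂ)‖ ≤ ‖s + 9‖ := cmp _ (by simp; norm_num) (by simpa using hy2)
  have hpi : ‖((Real.pi : ℝ) : ℂ) ^ (-s / 2)‖ ≤ 1 := by
    rw [norm_cpow_eq_rpow_re_of_pos Real.pi_pos]
    apply Real.rpow_le_one_of_one_le_of_nonpos
    · linarith [Real.pi_gt_three]
    · simp [hs]; norm_num
  have hGb : ‖Gamma (1 + y * I)‖ ≤ 8 * ‖s + 9‖ * Real.exp (-(Real.pi / 4 * |t|)) := by
    have h := (norm_Gamma_one_add_bounds y).2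
    have hyt : |y| = |t| / 2 := by rw [hy, abs_div, abs_two]
    rw [← sq_le_sq₀ (norm_nonneg _) (by positivity)]
    refine h.trans ?_
    have : (8 * ‖s + 9‖ * Real.exp (-(Real.pi / 4 * |t|))) ^ 2 =
      (8 * ‖s + 9‖) ^ 2 * Real.exp (-(Real.pi * |y|)) := by
      rw [mul_pow, ← Real.exp_nat_mul, hyt]; congr 2; push_cast; ring
    rw [this]
    apply mul_le_mul_of_nonneg_right _ (Real.exp_pos _).le
    rw [hyt]
    have := Real.pi_lt_four
    nlinarith [abs_nonneg t]
  rw [hG, norm_mul, norm_mul, norm_mul]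
  set N := ‖s + 9‖
  have hN0 : 0 ≤ N := norm_nonneg _
  calc ‖s‖ * ‖s - 1‖ * (‖((Real.pi : ℝ) : ℂ) ^ (-s / 2)‖ * (‖(3 + y * I : ℂ)‖ * (‖(2 + y * I : ℂ)‖ *
        (‖(1 + y * I : ℂ)‖ * ‖Gamma (1 + y * I)‖)))) * ‖riemannZeta s‖
      ≤ N * N * (1 * (N * (N * (N * (8 * N * Real.exp (-(Real.pi / 4 * |t|))))))) * C := by
        gcongr
    _ = _ := by ring

lemma fxi_bound : ∃ C, 0 < C ∧ ∀ s : ℂ, -7 ≤ s.re → s.re ≤ 8 → ‖fxi s‖ ≤ C * ‖s + 9‖ ^ 6 := by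
  obtain ⟨C, hC0, hC⟩ := xi_bound_eight
  obtain ⟨D, hD⟩ := completedZeta₀_bounded (-7) 8
  have hD0 : 0 ≤ D := (norm_nonneg _).trans (hD 0 (by simp) (by simp))
  set C' := C * 9 ^ 6 + 1
  refine ⟨C', by positivity, fun s hs1 hs2 => ?_⟩
  have hne : ∀ z : ℂ, -7 ≤ z.re → z + 9 ≠ 0 := by
    intro z hz h
    have := congrArg re h
    simp at this
    linarith
  have hexp : ∀ t : ℝ, Real.exp (-(Real.pi / 4 * |t|)) * Real.exp (Real.pi / 4 * t) ≤ 1 := by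
    intro t
    rw [← Real.exp_add, Real.exp_le_one_iff]
    have := le_abs_self t
    have := Real.pi_pos
    nlinarith
  have key : ‖fxi s / (s + 9) ^ 6‖ ≤ C' := by
    refine PhragmenLindelof.vertical_strip (a := -7) (b := 8) (f := fun z => fxi z / (z + 9) ^ 6)
      ?_ ?_ ?_ ?_ hs1 hs2
    · apply DifferentiableOn.diffContOnCl
      rw [closure_preimage_re, closure_Ioo (by norm_num)]
      intro z hz
      have : (z + 9) ^ 6 ≠ 0 := pow_ne_zero _ (hne z hz.1)
      have := differentiable_fxi z
      apply DifferentiableAt.differentiableWithinAt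
      fun_prop (disch := assumption)
    · refine ⟨0.1, ?_, 30, ?_⟩
      · rw [lt_div_iff₀ (by norm_num)]; linarith [Real.pi_gt_three]
      · apply Asymptotics.IsBigO.of_bound (81 * D + 1)
        apply Filter.mem_inf_of_right
        intro z hz
        have hz1 : -7 < z.re := hz.1
        have hz2 : z.re < 8 := hz.2
        simp only [Set.mem_ofPred_eq]
        rw [Real.norm_of_nonneg (Real.exp_pos _).le, norm_div, norm_pow, norm_fxi]
        set t := |z.im|
        have ht0 : 0 ≤ t := abs_nonneg _
        have hz9 : 1 ≤ ‖z + 9‖ := by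
          have := re_le_norm (z + 9)
          simp at this
          linarith
        have hzn : ‖z‖ ≤ 8 + t := by
          have := norm_le_abs_re_add_abs_im z
          have : |z.re| ≤ 8 := abs_le.mpr ⟨by linarith, by linarith⟩
          linarith
        have hz1n : ‖z - 1‖ ≤ 9 + t := by
          have := norm_sub_le z 1
          simp at this
          linarith
        have e1 : 1 + t ≤ Real.exp t := by linarith [Real.add_one_le_exp t]
        have hxi : ‖xi z‖ ≤ (81 * D + 1) * Real.exp (2 * t) := by
          unfold xi
          have h1 : ‖z * (z - 1) * completedRiemannZeta₀ z + 1‖ ≤ (8 + t) * (9 + t) * D + 1 := by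
            refine (norm_add_le _ _).trans ?_
            rw [norm_mul, norm_mul, norm_one]
            have := hD z hz1.le hz2.le
            gcongr
          have h2 : (8 + t) * (9 + t) ≤ 81 * Real.exp (2 * t) := by
            have : Real.exp (2 * t) = Real.exp t * Real.exp t := by rw [← Real.exp_add]; ring_nf
            rw [this]
            nlinarith
          have h3 : 1 ≤ Real.exp (2 * t) := Real.one_le_exp (by linarith)
          nlinarith
        have e2 : Real.exp (Real.pi / 4 * z.im) ≤ Real.exp t := by
          apply Real.exp_le_exp.mpr
          have := le_abs_self z.im
          have := Real.pi_lt_four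
          have := Real.pi_pos
          have h : Real.pi / 4 * z.im ≤ Real.pi / 4 * t := by gcongr
          nlinarith
        have e3 : Real.exp (2 * t) * Real.exp t ≤ Real.exp (30 * Real.exp (0.1 * t)) := by
          rw [← Real.exp_add]
          apply Real.exp_le_exp.mpr
          have := Real.add_one_le_exp (0.1 * t)
          linarith
        have hz96 : 1 ≤ ‖z + 9‖ ^ 6 := one_le_pow₀ hz9
        calc _ ≤ ‖xi z‖ * Real.exp (Real.pi / 4 * z.im) := div_le_self (by positivity) hz96
          _ ≤ ((81 * D + 1) * Real.exp (2 * t)) * Real.exp t := by gcongr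
          _ = (81 * D + 1) * (Real.exp (2 * t) * Real.exp t) := by ring
          _ ≤ _ := by gcongr
    · intro z hz
      have h9 := hne z hz.ge
      rw [norm_div, norm_pow, div_le_iff₀ (by positivity), norm_fxi, ← xi_one_sub]
      have hb := hC (1 - z) (by simp [hz]; norm_num)
      have him : |(1 - z).im| = |z.im| := by simp
      rw [him] at hb
      have hcmp : ‖1 - z + 9‖ ≤ 9 * ‖z + 9‖ := by
        have h2 : 2 ≤ ‖z + 9‖ := by
          have := re_le_norm (z + 9)
          simp [hz] at this
          linarith
        have : ‖1 - z + 9‖ ≤ ‖z + 9‖ + 15 := by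
          have e : 1 - z + 9 = -(z + 9 - 19) := by ring
          have e2 : z + 9 - 19 = (z - (-7 - z.im * I) ) - (17 - 0) - z.im * I + 0 := by ring
          rw [e, norm_neg]
          rw [← sq_le_sq₀ (norm_nonneg _) (by positivity)]
          have hs1 : ‖z + 9 - 19‖ ^ 2 = 289 + z.im ^ 2 := by
            rw [← normSq_eq_norm_sq, normSq_apply]; simp [hz]; ring
          have hs2 : ‖z + 9‖ ^ 2 = 4 + z.im ^ 2 := by
            rw [← normSq_eq_norm_sq, normSq_apply]; simp [hz]; ring
          rw [hs1]
          nlinarith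
        linarith
      have hE := hexp z.im
      set E1 := Real.exp (-(Real.pi / 4 * |z.im|))
      set E2 := Real.exp (Real.pi / 4 * z.im)
      calc ‖xi (1 - z)‖ * E2 ≤ (C * ‖1 - z + 9‖ ^ 6 * E1) * E2 := by gcongr
        _ = (C * ‖1 - z + 9‖ ^ 6) * (E1 * E2) := by ring
        _ ≤ (C * (9 * ‖z + 9‖) ^ 6) * 1 := by gcongr
        _ ≤ C' * ‖z + 9‖ ^ 6 := by
          have : 0 ≤ ‖z + 9‖ ^ 6 := by positivity
          simp only [C']
          nlinarith
    · intro z hz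
      have h9 := hne z (by linarith)
      rw [norm_div, norm_pow, div_le_iff₀ (by positivity), norm_fxi]
      have hb := hC z hz
      have hE := hexp z.im
      set E1 := Real.exp (-(Real.pi / 4 * |z.im|))
      set E2 := Real.exp (Real.pi / 4 * z.im)
      calc ‖xi z‖ * E2 ≤ (C * ‖z + 9‖ ^ 6 * E1) * E2 := by gcongr
        _ = (C * ‖z + 9‖ ^ 6) * (E1 * E2) := by ring
        _ ≤ (C * ‖z + 9‖ ^ 6) * 1 := by gcongr
        _ ≤ C' * ‖z + 9‖ ^ 6 := by
          have : 0 ≤ ‖z + 9‖ ^ 6 := by positivity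
          simp only [C']
          have h96 : (1:ℝ) ≤ 9 ^ 6 := by norm_num
          nlinarith [mul_nonneg hC0 this]
  have h9 := hne s hs1
  rwa [norm_div, norm_pow, div_le_iff₀ (by positivity)] at key

lemma fxi_lower : ∃ c, 0 < c ∧ ∀ T : ℝ, 1 ≤ T → c ≤ ‖fxi (2 + T * I)‖ := by
  obtain ⟨C, hC⟩ := inv_zeta_bounded (b := 2) (by norm_num)
  refine ⟨Real.pi⁻¹ * (|C| + 1)⁻¹, by positivity, fun T hT => ?_⟩
  set s : ℂ := 2 + T * I with hs
  have hre : s.re = 2 := by simp [hs]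
  have him : s.im = T := by simp [hs]
  have h0 : s ≠ 0 := by intro h; rw [h] at hre; simp at hre
  have h1 : s ≠ 1 := by intro h; rw [h] at hre; simp at hre
  rw [norm_fxi, xi_eq_zeta h0 h1 (Gammaℝ_ne_zero_of_re_pos (by linarith)), norm_mul, norm_mul,
    norm_mul, Gammaℝ_def, norm_mul, him]
  have hz : (|C| + 1)⁻¹ ≤ ‖riemannZeta s‖ := by
    have h := (hC s hre.ge).1
    rw [norm_inv] at h
    have hp : 0 < ‖riemannZeta s‖ :=
      norm_pos_iff.mpr (riemannZeta_ne_zero_of_one_le_re (by linarith))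
    apply inv_le_of_inv_le₀ hp
    linarith [le_abs_self C]
  have hsn : 1 ≤ ‖s‖ := by
    have := re_le_norm s
    linarith
  have hs1n : 1 ≤ ‖s - 1‖ := by
    have := re_le_norm (s - 1)
    simp [hre] at this
    linarith
  have hpi : ‖((Real.pi : ℝ) : ℂ) ^ (-s / 2)‖ = Real.pi⁻¹ := by
    rw [norm_cpow_eq_rpow_re_of_pos Real.pi_pos]
    simp [hre, Real.rpow_neg_one]
  have hG : Real.exp (-(Real.pi / 4 * T)) ≤ ‖Gamma (s / 2)‖ := by
    have e : s / 2 = 1 + ((T / 2 : ℝ) : ℂ) * I := by rw [hs]; push_cast; ring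
    have h := (norm_Gamma_one_add_bounds (T / 2)).1
    rw [e, ← sq_le_sq₀ (Real.exp_pos _).le (norm_nonneg _)]
    refine le_trans (le_of_eq ?_) h
    rw [← Real.exp_nat_mul, abs_of_pos (by linarith)]
    congr 1; push_cast; ring
  rw [hpi]
  calc Real.pi⁻¹ * (|C| + 1)⁻¹ = 1 * 1 * (Real.pi⁻¹ * Real.exp (-(Real.pi / 4 * T))) *
        (|C| + 1)⁻¹ * Real.exp (Real.pi / 4 * T) := by
        have : Real.exp (-(Real.pi / 4 * T)) * Real.exp (Real.pi / 4 * T) = 1 := by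
          rw [← Real.exp_add]; simp
        linear_combination -this * Real.pi⁻¹ * (|C| + 1)⁻¹
    _ ≤ _ := by gcongr

/-- The reciprocal zeta function, written through `xi` so that it is meromorphic on `-2 < re w`
without exceptional points. -/
noncomputable def zi (w : ℂ) : ℂ :=
  2 * (Real.pi : ℂ) ^ (-w / 2) * Gamma (w / 2 + 1) * (w - 1) / xi w

lemma zi_eq {w : ℂ} (hw : -2 < w.re) (h0 : w ≠ 0) (h1 : w ≠ 1) : zi w = (riemannZeta w)⁻¹ := by
  have hG : Gammaℝ w ≠ 0 := by
    rw [Ne, Gammaℝ_eq_zero_iff]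
    rintro ⟨n, hn⟩
    rcases Nat.eq_zero_or_pos n with rfl | hn'
    · simp at hn; exact h0 hn
    · rw [hn] at hw
      simp at hw
      have : (1 : ℝ) ≤ n := by exact_mod_cast hn'
      linarith
  have hG' := hG
  rw [Gammaℝ_def] at hG'
  have hw1 : w - 1 ≠ 0 := sub_ne_zero.mpr h1
  rw [zi, xi_eq_zeta h0 h1 hG, Gamma_add_one _ (div_ne_zero h0 two_ne_zero), Gammaℝ_def]
  have a1 := left_ne_zero_of_mul hG'
  have a2 := right_ne_zero_of_mul hG'
  by_cases hz : riemannZeta w = 0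
  · simp [hz]
  · field_simp

lemma differentiableAt_zi {w : ℂ} (hw : -2 < w.re) (hx : xi w ≠ 0) : DifferentiableAt ℂ zi w := by
  unfold zi
  have h1 : DifferentiableAt ℂ (fun w : ℂ => Gamma (w / 2 + 1)) w := by
    apply DifferentiableAt.comp (f := fun w : ℂ => w / 2 + 1) (g := Gamma)
    · apply differentiableAt_Gamma
      intro m h
      have := congrArg re h
      simp at this
      have : (0 : ℝ) ≤ m := m.cast_nonneg
      linarith
    · fun_prop
  have h2 : DifferentiableAt ℂ (fun w : ℂ => (Real.pi : ℂ) ^ (-w / 2)) w := by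
    apply DifferentiableAt.const_cpow
    · fun_prop
    · left; exact_mod_cast Real.pi_ne_zero
  have h3 := differentiable_xi w
  fun_prop (disch := assumption)

lemma norm_zi_le_xi : ∃ C, 0 < C ∧ ∀ w : ℂ, -1 ≤ w.re → w.re ≤ 2 →
    ‖zi w‖ ≤ C * ‖w - 1‖ / ‖xi w‖ := by
  have hc : ContinuousOn (fun x : ℝ => Real.Gamma x) (Set.Icc (1/2) 2) := by
    intro x hx
    apply ContinuousAt.continuousWithinAt
    apply (Real.differentiableAt_Gamma _).continuousAt
    intro m h
    have : (0 : ℝ) ≤ m := m.cast_nonneg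
    have := hx.1
    linarith
  obtain ⟨B, hB⟩ := isCompact_Icc.exists_bound_of_continuousOn hc
  have hB0 : 0 ≤ B := (norm_nonneg _).trans (hB 1 (by norm_num))
  refine ⟨2 * Real.pi * (B + 1), by positivity, fun w hw1 hw2 => ?_⟩
  rw [zi, norm_div, norm_mul, norm_mul, norm_mul]
  have hre : (w / 2 + 1).re = w.re / 2 + 1 := by simp
  have h1 : ‖(Real.pi : ℂ) ^ (-w / 2)‖ ≤ Real.pi := by
    rw [norm_cpow_eq_rpow_re_of_pos Real.pi_pos]
    conv_rhs => rw [← Real.rpow_one Real.pi]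
    apply Real.rpow_le_rpow_of_exponent_le
    · linarith [Real.pi_gt_three]
    · simp; linarith
  have h2 : ‖Gamma (w / 2 + 1)‖ ≤ B + 1 := by
    refine (norm_Gamma_le (by rw [hre]; linarith)).trans ?_
    refine ((le_abs_self _).trans (hB _ ?_)).trans (by linarith)
    rw [hre]; constructor <;> linarith
  simp only [Complex.norm_ofNat]
  gcongr

lemma zi_bounded_two : ∃ C, 0 ≤ C ∧ ∀ w : ℂ, w.re = 2 → ‖zi w‖ ≤ C := by
  obtain ⟨C, hC⟩ := inv_zeta_bounded (b := 2) (by norm_num)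
  refine ⟨C, (norm_nonneg _).trans (hC 2 (by simp)).1, fun w hw => ?_⟩
  rw [zi_eq (by rw [hw]; norm_num) (by rintro rfl; simp at hw) (by rintro rfl; simp at hw)]
  exact (hC w hw.ge).1

lemma zi_bounded_neg_one : ∃ C, 0 ≤ C ∧ ∀ w : ℂ, w.re = -1 → ‖zi w‖ ≤ C := by
  obtain ⟨C, hC⟩ := inv_zeta_bounded (b := 2) (by norm_num)
  have hC0 := (norm_nonneg _).trans (hC 2 (by simp)).1
  refine ⟨2 * Real.pi ^ (1 / 2 : ℝ) * (3 * Real.pi * C), by positivity, fun w hw => ?_⟩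
  set y := w.im / 2 with hy
  set v := 1 - w with hv
  have hvr : v.re = 2 := by simp [hv, hw]; norm_num
  have hv0 : v ≠ 0 := by intro h; rw [h] at hvr; simp at hvr
  have hv1 : v ≠ 1 := by intro h; rw [h] at hvr; simp at hvr
  have e1 : w / 2 + 1 = 1 / 2 + y * I := by
    apply Complex.ext
    · simp [hw]; norm_num
    · simp [hy]
  have e2 : v / 2 = 1 + (-y : ℝ) * I := by
    apply Complex.ext
    · simp [hvr]
    · simp [hv, hy]; ring
  have hGv : Gammaℝ v ≠ 0 := Gammaℝ_ne_zero_of_re_pos (by rw [hvr]; norm_num)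
  have hz := (hC v hvr.ge).1
  have hw1 : ‖w - 1‖ = ‖v‖ := by rw [hv, norm_sub_rev]
  have hv1n : 1 ≤ ‖v - 1‖ := by
    have := re_le_norm (v - 1)
    simp [hvr] at this
    linarith
  have hvn : 0 < ‖v‖ := norm_pos_iff.mpr hv0
  rw [zi, ← xi_one_sub, ← hv, xi_eq_zeta hv0 hv1 hGv, Gammaℝ_def, e1, e2]
  have g1 := norm_Gamma_half_add_bound y
  have g2 := (norm_Gamma_one_add_bounds (-y)).1
  rw [abs_neg] at g2
  set A := ‖Gamma (1 / 2 + y * I)‖ with hA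
  set B := ‖Gamma (1 + (-y : ℝ) * I)‖ with hB
  have hB0 : 0 < B := by
    have := (Real.exp_pos _).trans_le g2
    have hB' : 0 ≤ B := norm_nonneg _
    nlinarith
  have hAB : A ≤ 3 * B := by
    rw [← sq_le_sq₀ (norm_nonneg _) (by positivity)]
    have := Real.pi_lt_four
    have := Real.exp_pos (-(Real.pi * |y|))
    nlinarith
  have p1 : ‖(Real.pi : ℂ) ^ (-w / 2)‖ = Real.pi ^ (1 / 2 : ℝ) := by
    rw [norm_cpow_eq_rpow_re_of_pos Real.pi_pos]; congr 1; simp [hw]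
  have p2 : ‖(Real.pi : ℂ) ^ (-v / 2)‖ = Real.pi⁻¹ := by
    rw [norm_cpow_eq_rpow_re_of_pos Real.pi_pos, ← Real.rpow_neg_one]; congr 1; simp [hvr]
  rw [norm_inv] at hz
  simp only [norm_mul, norm_div, p1, p2, hw1, Complex.norm_ofNat]
  rw [← hA, ← hB]
  have hpi := Real.pi_pos
  by_cases hzz : riemannZeta v = 0
  · simp [hzz]; positivity
  have hzp : 0 < ‖riemannZeta v‖ := norm_pos_iff.mpr hzz
  have hC' : 1 ≤ C * ‖riemannZeta v‖ := by
    rwa [inv_le_iff_one_le_mul₀ hzp] at hz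
  rw [div_le_iff₀ (by positivity)]
  have : 2 * Real.pi ^ (1 / 2 : ℝ) * (3 * Real.pi * C) *
      (‖v‖ * ‖v - 1‖ * (Real.pi⁻¹ * B) * ‖riemannZeta v‖) =
      2 * Real.pi ^ (1 / 2 : ℝ) * ((3 * B) * (‖v - 1‖ * (C * ‖riemannZeta v‖))) * ‖v‖ := by
    field_simp
  rw [this]
  gcongr
  calc A = A * 1 := (mul_one _).symm
    _ ≤ (3 * B) * (‖v - 1‖ * (C * ‖riemannZeta v‖)) :=
      mul_le_mul hAB (one_le_mul_of_one_le_of_one_le hv1n hC') zero_le_one (by positivity)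

lemma exists_factor_zeros (Z : Finset ℂ) : ∀ f : ℂ → ℂ, Differentiable ℂ f → (∀ z ∈ Z, f z = 0) →
    ∃ g : ℂ → ℂ, Differentiable ℂ g ∧ ∀ s, f s = g s * ∏ z ∈ Z, (s - z) := by
  classical
  induction Z using Finset.induction_on with
  | empty => intro f hf _; exact ⟨f, hf, fun s => by simp⟩
  | insert a Z ha ih =>
    intro f hf hz
    have hfa : f a = 0 := hz a (Finset.mem_insert_self _ _)
    have hd : Differentiable ℂ (dslope f a) := by
      rw [← differentiableOn_univ] at hf ⊢
      exact (differentiableOn_dslope univ_mem).mpr hf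
    have hfac : ∀ s, f s = (s - a) * dslope f a s := by
      intro s
      have := sub_smul_dslope f a s
      rw [hfa, sub_zero, smul_eq_mul] at this
      exact this.symm
    obtain ⟨g, hg, hgs⟩ := ih (dslope f a) hd (by
      intro z hzZ
      have h1 := hz z (Finset.mem_insert_of_mem hzZ)
      rw [hfac] at h1
      rcases mul_eq_zero.mp h1 with h | h
      · exact absurd (sub_eq_zero.mp h ▸ hzZ) ha
      · exact h)
    refine ⟨g, hg, fun s => ?_⟩
    rw [hfac, hgs, Finset.prod_insert ha]; ring

/-- The Blaschke-type numerator attached to a zero `z` in the disc of centre `c` and radius `R`. -/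
noncomputable def blaschkeNum (c : ℂ) (R : ℝ) (z s : ℂ) : ℂ :=
  ((R : ℂ) ^ 2 - (starRingEnd ℂ) (z - c) * (s - c)) / R

lemma norm_blaschkeNum_of_sphere {c z s : ℂ} {R : ℝ} (hR : 0 < R) (hs : ‖s - c‖ = R) :
    ‖blaschkeNum c R z s‖ = ‖s - z‖ := by
  have h1 : (R : ℂ) ^ 2 = (starRingEnd ℂ) (s - c) * (s - c) := by
    rw [conj_mul', hs]
  have : (R : ℂ) ^ 2 - (starRingEnd ℂ) (z - c) * (s - c) = (starRingEnd ℂ) (s - z) * (s - c) := by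
    rw [h1]; simp only [map_sub]; ring
  rw [blaschkeNum, this, norm_div, norm_mul, hs, RCLike.norm_conj, norm_real, Real.norm_of_nonneg hR.le]
  field_simp

lemma blaschkeNum_bounds {c z s : ℂ} {R : ℝ} (hR : 0 < R) (hz : ‖z - c‖ < R) (hs : ‖s - c‖ ≤ R) :
    blaschkeNum c R z s ≠ 0 ∧ ‖blaschkeNum c R z s‖ ≤ 2 * R := by
  have h1 : ‖(starRingEnd ℂ) (z - c) * (s - c)‖ < R ^ 2 := by
    rw [norm_mul, RCLike.norm_conj]
    calc ‖z - c‖ * ‖s - c‖ ≤ ‖z - c‖ * R := by gcongr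
      _ < R * R := by gcongr
      _ = R ^ 2 := by ring
  have h2 : ‖(R : ℂ) ^ 2‖ = R ^ 2 := by rw [norm_pow, norm_real, Real.norm_of_nonneg hR.le]
  constructor
  · rw [blaschkeNum, Ne, div_eq_zero_iff, not_or]
    refine ⟨fun h => ?_, by exact_mod_cast hR.ne'⟩
    rw [← sub_eq_zero.mp h, h2] at h1
    exact lt_irrefl _ h1
  · rw [blaschkeNum, norm_div, norm_real, Real.norm_of_nonneg hR.le, div_le_iff₀ hR]
    refine (norm_sub_le _ _).trans ?_
    rw [h2]; nlinarith

lemma blaschke {f : ℂ → ℂ} (hf : Differentiable ℂ f) {c : ℂ} {R M : ℝ} (hR : 0 < R) {Z : Finset ℂ}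
    (hZ0 : ∀ z ∈ Z, f z = 0) (hZ : ∀ z ∈ Z, ‖z - c‖ < R) (hM : ∀ s, ‖s - c‖ = R → ‖f s‖ ≤ M) :
    ∃ G : ℂ → ℂ, Differentiable ℂ G ∧
      (∀ s, G s * ∏ z ∈ Z, (s - z) = f s * ∏ z ∈ Z, blaschkeNum c R z s) ∧
      (∀ s, ‖s - c‖ ≤ R → ‖G s‖ ≤ M) ∧
      ∀ s, ‖s - c‖ ≤ R → (f s ≠ 0 ∨ s ∈ Z ∧ deriv f s ≠ 0) → G s ≠ 0 := by
  classical
  obtain ⟨g, hg, hgs⟩ := exists_factor_zeros Z f hf hZ0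
  have hGd : Differentiable ℂ (fun s => g s * ∏ z ∈ Z, blaschkeNum c R z s) := by
    unfold blaschkeNum
    fun_prop
  refine ⟨fun s => g s * ∏ z ∈ Z, blaschkeNum c R z s, hGd, ?_, ?_, ?_⟩
  · intro s; rw [hgs]; ring
  · intro s hs
    apply Complex.norm_le_of_forall_mem_frontier_norm_le (U := Metric.ball c R)
      Metric.isBounded_ball hGd.diffContOnCl
    · intro w hw
      rw [frontier_ball _ hR.ne', mem_sphere_iff_norm] at hw
      refine le_trans (le_of_eq ?_) (hM w hw)
      rw [hgs, norm_mul, norm_mul, norm_prod, norm_prod]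
      congr 1
      exact Finset.prod_congr rfl fun z _ => norm_blaschkeNum_of_sphere hR hw
    · rw [closure_ball _ hR.ne', mem_closedBall_iff_norm]; exact hs
  · intro s hs h
    refine mul_ne_zero ?_ (Finset.prod_ne_zero_iff.mpr fun z hz =>
      (blaschkeNum_bounds hR (hZ z hz) hs).1)
    rcases h with h | ⟨hsZ, h⟩
    · rw [hgs] at h; exact left_ne_zero_of_mul h
    · intro hg0
      apply h
      have e : f = fun w => g w * ∏ z ∈ Z, (w - z) := funext hgs
      have h2 : DifferentiableAt ℂ (fun w => ∏ z ∈ Z, (w - z)) s := by fun_prop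
      rw [e, deriv_fun_mul (hg s) h2, hg0, Finset.prod_eq_zero hsZ (sub_self s)]
      simp

lemma blaschke_count {f : ℂ → ℂ} (hf : Differentiable ℂ f) {c : ℂ} {r R M : ℝ} (hr : 0 < r)
    (hrR : r < R) {Z : Finset ℂ}
    (hZ0 : ∀ z ∈ Z, f z = 0) (hZ : ∀ z ∈ Z, ‖z - c‖ ≤ r) (hM : ∀ s, ‖s - c‖ = R → ‖f s‖ ≤ M) :
    (R / r) ^ Z.card * ‖f c‖ ≤ M := by
  have hR := hr.trans hrR
  obtain ⟨G, -, h1, h2, -⟩ := blaschke hf hR hZ0 (fun z hz => (hZ z hz).trans_lt hrR) hM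
  have hc := congrArg norm (h1 c)
  have hG := h2 c (by simpa using hR.le)
  have hb : ∀ z, blaschkeNum c R z c = R := by
    intro z; simp [blaschkeNum]; field_simp
  simp only [hb, norm_mul, norm_prod, norm_pow, norm_real, Real.norm_of_nonneg hR.le,
    Finset.prod_const] at hc
  have hp : ∏ z ∈ Z, ‖c - z‖ ≤ r ^ Z.card := by
    rw [← Finset.prod_const]
    exact Finset.prod_le_prod (fun _ _ => norm_nonneg _) fun z hz => by
      rw [norm_sub_rev]; exact hZ z hz
  have hM0 : 0 ≤ M := (norm_nonneg _).trans hG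
  rw [div_pow, div_mul_eq_mul_div, div_le_iff₀ (by positivity), mul_comm, ← hc]
  exact mul_le_mul hG hp (Finset.prod_nonneg fun _ _ => norm_nonneg _) hM0

lemma min_modulus_of_ne_zero {G : ℂ → ℂ} (hG : Differentiable ℂ G) {c : ℂ} {r R L : ℝ}
    (hr : 0 ≤ r) (hrR : r < R) (hL : 0 < L) (h0 : ∀ s, ‖s - c‖ < R → G s ≠ 0)
    (hM : ∀ s, ‖s - c‖ < R → ‖G s‖ ≤ ‖G c‖ * Real.exp L) {s : ℂ} (hs : ‖s - c‖ ≤ r) :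
    ‖G c‖ * Real.exp (-(2 * L * r / (R - r))) ≤ ‖G s‖ := by
  have hR := hr.trans_lt hrR
  have hd : DifferentiableOn ℂ (fun w => deriv G w / G w) (Metric.ball c R) := by
    intro w hw
    have h1 : DifferentiableAt ℂ (deriv G) w :=
      (hG.contDiff (n := 2)).differentiable_deriv_two w
    exact (h1.div (hG w) (h0 w (mem_ball_iff_norm.mp hw))).differentiableWithinAt
  obtain ⟨h, hh⟩ := hd.isExactOn_ball
  have hexp : ∀ w ∈ Metric.ball c R, G w = G c * exp (h w - h c) := by
    have hder : ∀ w ∈ Metric.ball c R,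
        HasDerivWithinAt (fun w => G w * exp (-(h w - h c))) 0 (Metric.ball c R) w := by
      intro w hw
      have hne := h0 w (mem_ball_iff_norm.mp hw)
      refine HasDerivAt.hasDerivWithinAt (HasDerivAt.congr_deriv
        ((hG w).hasDerivAt.fun_mul (((hh w hw).sub_const (h c)).fun_neg.cexp)) ?_)
      field_simp
      ring
    intro w hw
    have hcm : c ∈ Metric.ball c R := Metric.mem_ball_self hR
    have := (convex_ball c R).is_const_of_fderivWithin_eq_zero (𝕜 := ℂ)
      (f := fun w => G w * exp (-(h w - h c)))
      (fun w hw => (hder w hw).differentiableWithinAt) (fun w hw => by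
        rw [(hder w hw).hasFDerivWithinAt.fderivWithin (Metric.isOpen_ball.uniqueDiffWithinAt hw)]
        ext; simp) hcm hw
    simp only [sub_self, neg_zero, exp_zero, mul_one] at this
    rw [this, mul_assoc, ← exp_add]; simp
  have hGc : 0 < ‖G c‖ := norm_pos_iff.mpr (h0 c (by simpa using hR))
  have hsR : s - c ∈ Metric.ball (0 : ℂ) R := by
    rw [mem_ball_zero_iff]; exact hs.trans_lt hrR
  have hball : ∀ w ∈ Metric.ball (0 : ℂ) R, c + w ∈ Metric.ball c R := by
    intro w hw; rw [mem_ball_iff_norm]; simpa using hw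
  have key := Complex.borelCaratheodory_zero (f := fun w => h (c + w) - h c) (R := R) (M := L)
    (z := s - c) hL
    (by
      intro w hw
      have h1 : DifferentiableAt ℂ h (c + w) := (hh _ (hball w hw)).differentiableAt
      have h2 : DifferentiableAt ℂ (fun w => h (c + w)) w :=
        DifferentiableAt.comp (f := fun w => c + w) (g := h) w h1 (by fun_prop)
      exact (h2.sub_const _).differentiableWithinAt)
    (by
      intro w hw
      have h1 := hM (c + w) (by simpa using hw)
      rw [hexp _ (hball w hw), norm_mul, norm_exp] at h1
      have h2 := le_of_mul_le_mul_left h1 hGc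
      exact Real.exp_le_exp.mp h2)
    hR hsR (by simp)
  simp only [add_sub_cancel] at key
  rw [hexp s (by rw [mem_ball_iff_norm]; exact hs.trans_lt hrR), norm_mul, norm_exp]
  apply mul_le_mul_of_nonneg_left _ hGc.le
  apply Real.exp_le_exp.mpr
  have h1 := (abs_le.mp (abs_re_le_norm (h s - h c))).1
  have h2 : 2 * L * ‖s - c‖ / (R - ‖s - c‖) ≤ 2 * L * r / (R - r) := by
    apply div_le_div₀ <;> first | positivity | nlinarith [norm_nonneg (s - c)]
  linarith

lemma min_modulus {f : ℂ → ℂ} (hf : Differentiable ℂ f) {c : ℂ} {r R M δ : ℝ} (hr : 0 ≤ r)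
    (hrR : r < R) {Z : Finset ℂ} (hδ : 0 ≤ δ)
    (hZ0 : ∀ z ∈ Z, f z = 0 ∧ deriv f z ≠ 0) (hZ : ∀ z ∈ Z, ‖z - c‖ < R)
    (hZall : ∀ s, ‖s - c‖ < R → f s = 0 → s ∈ Z)
    (hM : ∀ s, ‖s - c‖ = R → ‖f s‖ ≤ M) (hfc : f c ≠ 0)
    {s : ℂ} (hs : ‖s - c‖ ≤ r) (hsZ : ∀ z ∈ Z, δ ≤ ‖s - z‖) :
    ‖f c‖ * Real.exp (-(2 * (Real.log (M / ‖f c‖) + 1) * r / (R - r))) * (δ / (2 * R)) ^ Z.card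
      ≤ ‖f s‖ := by
  have hR := hr.trans_lt hrR
  obtain ⟨G, hG, h1, h2, h3⟩ := blaschke hf hR (fun z hz => (hZ0 z hz).1) hZ hM
  have hne : ∀ s, ‖s - c‖ < R → G s ≠ 0 := by
    intro w hw
    apply h3 w hw.le
    by_cases h : f w = 0
    · exact Or.inr ⟨hZall w hw h, (hZ0 w (hZall w hw h)).2⟩
    · exact Or.inl h
  have hfc0 : 0 < ‖f c‖ := norm_pos_iff.mpr hfc
  have hGc : ‖f c‖ ≤ ‖G c‖ := by
    have hc := congrArg norm (h1 c)
    have hb : ∀ z, blaschkeNum c R z c = R := by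
      intro z; simp [blaschkeNum]; field_simp
    simp only [hb, norm_mul, norm_prod, norm_pow, norm_real, Real.norm_of_nonneg hR.le,
      Finset.prod_const] at hc
    have hp : ∏ z ∈ Z, ‖c - z‖ ≤ R ^ Z.card := by
      rw [← Finset.prod_const]
      exact Finset.prod_le_prod (fun _ _ => norm_nonneg _) fun z hz => by
        rw [norm_sub_rev]; exact (hZ z hz).le
    have hRp : 0 < R ^ Z.card := by positivity
    have := mul_le_mul_of_nonneg_left hp (norm_nonneg (G c))
    rw [hc] at this
    exact le_of_mul_le_mul_right this hRp
  have hGM : ‖G c‖ ≤ M := h2 c (by simpa using hR.le)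
  have hMpos : 0 < M := hfc0.trans_le (hGc.trans hGM)
  set L := Real.log (M / ‖f c‖) + 1 with hL
  have hlog : 0 ≤ Real.log (M / ‖f c‖) := by
    apply Real.log_nonneg
    rw [le_div_iff₀ hfc0]; linarith
  have hMe : M ≤ ‖G c‖ * Real.exp L := by
    rw [hL, Real.exp_add, Real.exp_log (by positivity)]
    have : 1 ≤ Real.exp 1 := Real.one_le_exp zero_le_one
    calc M = ‖f c‖ * (M / ‖f c‖ * 1) := by field_simp
      _ ≤ ‖G c‖ * (M / ‖f c‖ * Real.exp 1) := by gcongr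
  have key := min_modulus_of_ne_zero hG hr hrR (by linarith : 0 < L) hne
    (fun w hw => (h2 w hw.le).trans hMe) hs
  have hsR : ‖s - c‖ ≤ R := hs.trans hrR.le
  have e := congrArg norm (h1 s)
  simp only [norm_mul, norm_prod] at e
  have hb1 : ∏ z ∈ Z, ‖blaschkeNum c R z s‖ ≤ (2 * R) ^ Z.card := by
    rw [← Finset.prod_const]
    exact Finset.prod_le_prod (fun _ _ => norm_nonneg _) fun z hz =>
      (blaschkeNum_bounds hR (hZ z hz) hsR).2
  have hb2 : δ ^ Z.card ≤ ∏ z ∈ Z, ‖s - z‖ := by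
    rw [← Finset.prod_const]
    exact Finset.prod_le_prod (fun _ _ => hδ) hsZ
  rw [div_pow, mul_div_assoc', div_le_iff₀ (by positivity)]
  calc ‖f c‖ * Real.exp (-(2 * L * r / (R - r))) * δ ^ Z.card
      ≤ ‖G c‖ * Real.exp (-(2 * L * r / (R - r))) * ∏ z ∈ Z, ‖s - z‖ := by gcongr
    _ ≤ ‖G s‖ * ∏ z ∈ Z, ‖s - z‖ := by
      gcongr
    _ = ‖f s‖ * ∏ z ∈ Z, ‖blaschkeNum c R z s‖ := e
    _ ≤ _ := by gcongr

lemma fxi_ratio : ∃ K, 1 ≤ K ∧ ∀ T : ℝ, 1 ≤ T → ∀ s : ℂ, ‖s - (2 + T * I)‖ ≤ 6 →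
    ‖fxi s‖ ≤ Real.exp (K * Real.sqrt (T + 17)) * ‖fxi (2 + T * I)‖ := by
  obtain ⟨C, hC0, hC⟩ := fxi_bound
  obtain ⟨c, hc0, hc⟩ := fxi_lower
  refine ⟨|Real.log (C / c)| + 13, by linarith [abs_nonneg (Real.log (C / c))], fun T hT s hs => ?_⟩
  have hre := (abs_re_le_norm _).trans hs
  simp at hre
  have hre' := abs_le.mp hre
  set X := T + 17 with hX
  have hXp : 1 ≤ X := by linarith
  have hS : 1 ≤ Real.sqrt X := Real.one_le_sqrt.mpr hXp
  have h9 : ‖s + 9‖ ≤ X := by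
    have : s + 9 = (s - (2 + T * I)) + (11 + T * I) := by ring
    rw [this]
    refine (norm_add_le _ _).trans ?_
    have h2 : ‖(11 + T * I : ℂ)‖ ≤ 11 + T := by
      refine (norm_add_le _ _).trans ?_
      simp [abs_of_pos (by linarith : 0 < T)]
    linarith
  have hlog : Real.log X ≤ 2 * Real.sqrt X := by
    have h := Real.log_le_sub_one_of_pos (by linarith : 0 < Real.sqrt X)
    have h2 : Real.log (Real.sqrt X) = Real.log X / 2 := Real.log_sqrt (by linarith)
    linarith
  have h1 := hC s (by linarith [hre'.1]) (by linarith [hre'.2])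
  have h2 : C * X ^ 6 ≤ Real.exp ((|Real.log (C / c)| + 13) * Real.sqrt X) * c := by
    rw [← div_le_iff₀ hc0]
    rw [← Real.log_le_iff_le_exp (by positivity)]
    have : C * X ^ 6 / c = (C / c) * X ^ 6 := by ring
    rw [this, Real.log_mul (by positivity) (by positivity), Real.log_pow]
    have := le_abs_self (Real.log (C / c))
    have := abs_nonneg (Real.log (C / c))
    push_cast
    nlinarith
  calc ‖fxi s‖ ≤ C * ‖s + 9‖ ^ 6 := h1
    _ ≤ C * X ^ 6 := by gcongr
    _ ≤ _ := h2
    _ ≤ _ := by gcongr; exact hc T hT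

lemma fxi_center_ne_zero {T : ℝ} (hT : 1 ≤ T) : fxi (2 + T * I) ≠ 0 := by
  obtain ⟨c, hc0, hc⟩ := fxi_lower
  exact norm_pos_iff.mp (hc0.trans_le (hc T hT))

lemma card_zeros_near : ∃ C, 0 < C ∧ ∀ T : ℝ, 1 ≤ T → ∀ Z : Finset ℂ, (∀ z ∈ Z, xi z = 0) →
    (∀ z ∈ Z, ‖z - (2 + T * I)‖ ≤ 5) → (Z.card : ℝ) ≤ C * Real.sqrt (T + 17) := by
  obtain ⟨K, hK1, hK⟩ := fxi_ratio
  have hl : 0 < Real.log (6 / 5) := Real.log_pos (by norm_num)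
  refine ⟨K / Real.log (6 / 5), by positivity, fun T hT Z hZ0 hZ => ?_⟩
  have h := blaschke_count differentiable_fxi (c := 2 + T * I) (r := 5) (R := 6)
    (M := Real.exp (K * Real.sqrt (T + 17)) * ‖fxi (2 + T * I)‖) (by norm_num) (by norm_num)
    (fun z hz => fxi_eq_zero.mpr (hZ0 z hz)) hZ (fun s hs => hK T hT s hs.le)
  have h' := le_of_mul_le_mul_right h (norm_pos_iff.mpr (fxi_center_ne_zero hT))
  have h2 := Real.log_le_log (by positivity) h'
  rw [Real.log_exp, Real.log_pow] at h2
  rw [div_mul_eq_mul_div, le_div_iff₀ hl]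
  exact h2

/-- Ordinates of the zeros of `ζ` on the critical line. -/
def ordSet : Set ℝ := {γ | riemannZeta (1 / 2 + γ * I) = 0}

lemma xi_eq_zero_of_mem {γ : ℝ} (h : γ ∈ ordSet) : xi (1 / 2 + γ * I) = 0 :=
  xi_zero_of_zeta (by simp) h

lemma mem_ordSet_iff {γ : ℝ} : γ ∈ ordSet ↔ xi (1 / 2 + γ * I) = 0 :=
  ⟨xi_eq_zero_of_mem, fun h => (zeros_of_xi h).2.2⟩

lemma neg_mem_ordSet {γ : ℝ} : -γ ∈ ordSet ↔ γ ∈ ordSet := by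
  rw [mem_ordSet_iff, mem_ordSet_iff, ← xi_one_sub]
  have : (1 - (1 / 2 + ((-γ : ℝ) : ℂ) * I)) = 1 / 2 + γ * I := by push_cast; ring
  rw [this]

lemma crit_ne_one (γ : ℝ) : (1 / 2 + γ * I : ℂ) ≠ 1 := by
  intro h
  have := congrArg re h
  norm_num at this

lemma finite_ordSet_inter (A B : ℝ) : (ordSet ∩ Set.Icc A B).Finite := by
  have hK : IsCompact ((fun γ : ℝ => (1 / 2 + γ * I : ℂ)) '' Set.Icc A B) :=
    isCompact_Icc.image (by fun_prop)
  have := hK.inter_riemannZetaZeros_finite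
  refine Set.Finite.of_finite_image (f := fun γ : ℝ => (1 / 2 + γ * I : ℂ)) (this.subset ?_) ?_
  · rintro _ ⟨γ, ⟨h1, h2⟩, rfl⟩
    exact ⟨⟨γ, h2, rfl⟩, h1⟩
  · intro a _ b _ h
    simpa using h

/-- The Riemann hypothesis together with simplicity of the nontrivial zeros. -/
structure SimpleRH : Prop where
  rh : ∀ ρ : ℂ, riemannZeta ρ = 0 → 0 < ρ.re → ρ.re < 1 → ρ.re = 1 / 2
  simple : ∀ ρ : ℂ, riemannZeta ρ = 0 → 0 < ρ.re → ρ.re < 1 → deriv riemannZeta ρ ≠ 0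

namespace SimpleRH

variable (H : SimpleRH)
include H

lemma re_eq {s : ℂ} (h : xi s = 0) : s.re = 1 / 2 :=
  H.rh s (zeros_of_xi h).2.2 (zeros_of_xi h).1 (zeros_of_xi h).2.1

lemma xi_eq_zero_iff {s : ℂ} : xi s = 0 ↔ s.re = 1 / 2 ∧ s.im ∈ ordSet := by
  constructor
  · intro h
    refine ⟨H.re_eq h, ?_⟩
    rw [mem_ordSet_iff]
    convert h
    apply Complex.ext <;> simp [H.re_eq h]
  · rintro ⟨h1, h2⟩
    rw [mem_ordSet_iff] at h2
    convert h2
    apply Complex.ext <;> simp [h1]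

lemma deriv_zeta_ne {γ : ℝ} (h : γ ∈ ordSet) : deriv riemannZeta (1 / 2 + γ * I) ≠ 0 :=
  H.simple _ h (by simp) (by norm_num)

lemma deriv_xi_ne {s : ℂ} (h : xi s = 0) : deriv xi s ≠ 0 := by
  intro hd
  obtain ⟨h1, h2, h3⟩ := zeros_of_xi h
  apply H.simple s h3 h1 h2
  have h0 : s ≠ 0 := by rintro rfl; simp at h1
  have hs1 : s ≠ 1 := by rintro rfl; simp at h2
  have hev : riemannZeta =ᶠ[𝓝 s] fun w => xi w * ((w * (w - 1))⁻¹ * (Gammaℝ w)⁻¹) := by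
    have e1 : ∀ᶠ w : ℂ in 𝓝 s, 0 < w.re := (isOpen_lt continuous_const continuous_re).mem_nhds h1
    have e2 : ∀ᶠ w : ℂ in 𝓝 s, w.re < 1 := (isOpen_lt continuous_re continuous_const).mem_nhds h2
    filter_upwards [e1, e2] with w w1 w2
    have w0 : w ≠ 0 := by rintro rfl; simp at w1
    have w1' : w ≠ 1 := by rintro rfl; simp at w2
    have hG := Gammaℝ_ne_zero_of_re_pos w1
    rw [xi_eq_zeta w0 w1' hG]
    have : w - 1 ≠ 0 := sub_ne_zero.mpr w1'
    field_simp
  rw [hev.deriv_eq]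
  have hm : s * (s - 1) ≠ 0 := mul_ne_zero h0 (sub_ne_zero.mpr hs1)
  have hg : DifferentiableAt ℂ (fun w : ℂ => (w * (w - 1))⁻¹ * (Gammaℝ w)⁻¹) s := by
    have := differentiable_Gammaℝ_inv s
    have h2 : DifferentiableAt ℂ (fun w : ℂ => (w * (w - 1))⁻¹) s := by fun_prop (disch := assumption)
    exact h2.mul this
  rw [deriv_fun_mul (differentiable_xi s) hg, hd, h]; simp

lemma deriv_fxi_ne {s : ℂ} (h : fxi s = 0) : deriv fxi s ≠ 0 := by
  have hx := fxi_eq_zero.mp h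
  have e : fxi = fun s => xi s * exp (-(Real.pi / 4 * I * s)) := by ext s; rfl
  have he : DifferentiableAt ℂ (fun s : ℂ => exp (-(Real.pi / 4 * I * s))) s := by fun_prop
  rw [e, deriv_fun_mul (differentiable_xi s) he, hx, zero_mul, add_zero]
  exact mul_ne_zero (H.deriv_xi_ne hx) (exp_ne_zero _)

lemma zero_notMem : (0 : ℝ) ∉ ordSet := by
  intro h
  have hx := xi_eq_zero_of_mem h
  simp only [ofReal_zero, zero_mul, add_zero] at hx
  apply H.deriv_xi_ne hx
  have h1 : deriv xi (1 / 2) = - deriv xi (1 / 2) := by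
    have e : xi = fun s => xi (1 - s) := funext fun s => (xi_one_sub s).symm
    conv_lhs => rw [e]
    rw [deriv_comp_const_sub]
    norm_num
  exact self_eq_neg.mp h1

lemma xi_ne_zero {s : ℂ} (h : s.re ≠ 1 / 2) : xi s ≠ 0 := fun hx => h (H.re_eq hx)

end SimpleRH

lemma norm_deriv_zeta_neg (γ : ℝ) :
    ‖deriv riemannZeta (1 / 2 + ((-γ : ℝ) : ℂ) * I)‖ = ‖deriv riemannZeta (1 / 2 + γ * I)‖ := by
  have e : (1 / 2 + ((-γ : ℝ) : ℂ) * I) = (starRingEnd ℂ) (1 / 2 + γ * I) := by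
    simp [Complex.ext_iff]
  have h1 := (differentiableAt_riemannZeta (crit_ne_one γ)).hasDerivAt.conj_conj
  have hev : riemannZeta =ᶠ[𝓝 ((starRingEnd ℂ) (1 / 2 + γ * I))]
      ((starRingEnd ℂ) ∘ riemannZeta ∘ (starRingEnd ℂ)) := by
    have hne : (starRingEnd ℂ) (1 / 2 + γ * I) ≠ 1 := by
      rw [← e]; exact crit_ne_one _
    filter_upwards [isOpen_compl_singleton.mem_nhds hne] with w hw
    simp [zeta_conj w hw]
  rw [e, hev.deriv_eq, h1.deriv, RCLike.norm_conj]

lemma exists_far_point (S : Finset ℝ) (a : ℝ) :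
    ∃ T ∈ Set.Icc a (a + 1), ∀ γ ∈ S, 1 / (4 * ((S.card : ℝ) + 1)) ≤ |T - γ| := by
  by_contra! h
  set δ : ℝ := 1 / (4 * ((S.card : ℝ) + 1)) with hδ
  have hsub : Set.Icc a (a + 1) ⊆ ⋃ γ ∈ S, Metric.ball γ δ := by
    intro T hT
    obtain ⟨γ, hγ, hlt⟩ := h T hT
    exact Set.mem_biUnion hγ (by rwa [Metric.mem_ball, Real.dist_eq])
  have h1 := (measure_mono hsub).trans (measure_biUnion_finset_le (μ := volume) S _)
  simp only [Real.volume_Icc, Real.volume_ball, Finset.sum_const, add_sub_cancel_left,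
    nsmul_eq_mul] at h1
  have h2 : (S.card : ENNReal) * ENNReal.ofReal (2 * δ) = ENNReal.ofReal (S.card * (2 * δ)) := by
    rw [ENNReal.ofReal_mul (p := (S.card : ℝ)) (by positivity), ENNReal.ofReal_natCast]
  rw [h2, ENNReal.ofReal_le_ofReal_iff (by positivity)] at h1
  have h3 : (S.card : ℝ) * (2 * δ) < 1 := by
    rw [hδ]
    have : (0 : ℝ) ≤ S.card := by positivity
    field_simp
    nlinarith
  linarith

lemma card_ord_near : ∃ C, 0 < C ∧ ∀ t : ℝ, ∀ S : Finset ℝ, (∀ γ ∈ S, γ ∈ ordSet) →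
    (∀ γ ∈ S, |γ - t| ≤ 1) → (S.card : ℝ) ≤ C * Real.sqrt (|t| + 18) := by
  obtain ⟨C, hC0, hC⟩ := card_zeros_near
  have key : ∀ t : ℝ, 0 ≤ t → ∀ S : Finset ℝ, (∀ γ ∈ S, γ ∈ ordSet) →
      (∀ γ ∈ S, |γ - t| ≤ 1) → (S.card : ℝ) ≤ C * Real.sqrt (|t| + 18) := by
    intro t ht S hS1 hS2
    have hinj : Function.Injective (fun γ : ℝ => (1 / 2 + γ * I : ℂ)) := by
      intro a b h; simpa using h
    have h := hC (t + 1) (by linarith) (S.image (fun γ : ℝ => (1 / 2 + γ * I : ℂ)))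
      (by
        intro z hz
        obtain ⟨γ, hγ, rfl⟩ := Finset.mem_image.mp hz
        exact xi_eq_zero_of_mem (hS1 γ hγ))
      (by
        intro z hz
        obtain ⟨γ, hγ, rfl⟩ := Finset.mem_image.mp hz
        refine (norm_le_abs_re_add_abs_im _).trans ?_
        have := abs_le.mp (hS2 γ hγ)
        simp
        have : |γ - (t + 1)| ≤ 2 := abs_le.mpr ⟨by linarith, by linarith⟩
        norm_num
        linarith)
    rw [Finset.card_image_of_injective _ hinj] at h
    rw [abs_of_nonneg ht]
    convert h using 3
    ring
  refine ⟨C, hC0, fun t S hS1 hS2 => ?_⟩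
  rcases le_total 0 t with ht | ht
  · exact key t ht S hS1 hS2
  · have h := key (-t) (by linarith) (S.image Neg.neg)
      (by
        intro z hz
        obtain ⟨γ, hγ, rfl⟩ := Finset.mem_image.mp hz
        exact neg_mem_ordSet.mpr (hS1 γ hγ))
      (by
        intro z hz
        obtain ⟨γ, hγ, rfl⟩ := Finset.mem_image.mp hz
        have := hS2 γ hγ
        rwa [← abs_neg, show -(-γ - -t) = γ - t by ring])
    rwa [Finset.card_image_of_injective _ neg_injective, abs_neg] at h

set_option maxHeartbeats 1000000 in
lemma SimpleRH.exists_good_height (H : SimpleRH) : ∃ A, 0 < A ∧ ∀ n : ℕ, 1 ≤ n →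
    ∃ T : ℝ, (n : ℝ) ≤ T ∧ T ≤ n + 1 ∧ ∀ x : ℝ, -1 ≤ x → x ≤ 2 →
      xi (x + T * I) ≠ 0 ∧ xi (x - T * I) ≠ 0 ∧
      ‖zi (x + T * I)‖ ≤ Real.exp (A * T) ∧ ‖zi (x - T * I)‖ ≤ Real.exp (A * T) := by
  classical
  obtain ⟨K, hK1, hK⟩ := fxi_ratio
  obtain ⟨C, hC0, hC⟩ := card_zeros_near
  obtain ⟨c, hc0, hc⟩ := fxi_lower
  obtain ⟨B, hB0, hB⟩ := norm_zi_le_xi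
  have hD0 : 0 ≤ |Real.log (B / c)| := abs_nonneg _
  refine ⟨8 * (K + 1) * 18 + 40 * (C * 18) * (C * 18 + 1) + 1 + 4 + |Real.log (B / c)|,
    by positivity, fun n hn => ?_⟩
  set N : ℝ := (n : ℝ) with hN
  have hN1 : 1 ≤ N := Nat.one_le_cast.mpr hn
  -- ordinates of zeros close to the height `N`
  have hfin : (ordSet ∩ Set.Icc (N - 5) (N + 5)).Finite := finite_ordSet_inter _ _
  set S := hfin.toFinset.filter (fun γ : ℝ => ‖(1 / 2 + γ * I : ℂ) - (2 + N * I)‖ < 5) with hS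
  have hinj : Function.Injective (fun γ : ℝ => (1 / 2 + γ * I : ℂ)) := by
    intro a b h; simpa using h
  set Z := S.image (fun γ : ℝ => (1 / 2 + γ * I : ℂ)) with hZ
  have hcardZ : Z.card = S.card := Finset.card_image_of_injective _ hinj
  have hZ0 : ∀ z ∈ Z, xi z = 0 := by
    intro z hz
    obtain ⟨γ, hγ, rfl⟩ := Finset.mem_image.mp hz
    have := (Finset.mem_filter.mp hγ).1
    rw [Set.Finite.mem_toFinset] at this
    exact xi_eq_zero_of_mem this.1
  have hZ5 : ∀ z ∈ Z, ‖z - (2 + N * I)‖ < 5 := by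
    intro z hz
    obtain ⟨γ, hγ, rfl⟩ := Finset.mem_image.mp hz
    exact (Finset.mem_filter.mp hγ).2
  have hZall : ∀ s, ‖s - (2 + N * I)‖ < 5 → fxi s = 0 → s ∈ Z := by
    intro s hs h0
    obtain ⟨h1, h2⟩ := H.xi_eq_zero_iff.mp (fxi_eq_zero.mp h0)
    have hse : (1 / 2 + s.im * I : ℂ) = s := by apply Complex.ext <;> simp [h1]
    refine Finset.mem_image.mpr ⟨s.im, Finset.mem_filter.mpr ⟨?_, by rwa [hse]⟩, hse⟩
    rw [Set.Finite.mem_toFinset]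
    have := (abs_im_le_norm _).trans hs.le
    simp at this
    have := abs_le.mp this
    exact ⟨h2, by constructor <;> linarith⟩
  have hcard := hC N hN1 Z hZ0 (fun z hz => (hZ5 z hz).le)
  obtain ⟨T, ⟨hT1, hT2⟩, hT⟩ := exists_far_point S N
  refine ⟨T, hT1, hT2, ?_⟩
  set k : ℝ := (S.card : ℝ) with hk
  have hk0 : 0 ≤ k := by positivity
  rw [hcardZ] at hcard
  have hsqrt : Real.sqrt (N + 17) ≤ 18 * T := by
    rw [Real.sqrt_le_left (by linarith)]
    nlinarith
  have hsqrt2 : Real.sqrt (N + 17) ^ 2 ≤ 18 * T := by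
    rw [Real.sq_sqrt (by linarith)]; linarith
  set Q := 8 * (K + 1) * 18 + 40 * (C * 18) * (C * 18 + 1) with hQ
  have key : ∀ x : ℝ, -1 ≤ x → x ≤ 2 →
      c * Real.exp (-((Q + 1) * T)) ≤ ‖xi (x + T * I)‖ := by
    intro x hx1 hx2
    have hdist : ‖(x + T * I : ℂ) - (2 + N * I)‖ ≤ 4 := by
      refine (norm_le_abs_re_add_abs_im _).trans ?_
      simp
      have h1 : |x - 2| ≤ 3 := abs_le.mpr ⟨by linarith, by linarith⟩
      have h2 : |T - N| ≤ 1 := abs_le.mpr ⟨by linarith, by linarith⟩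
      linarith
    have hf0 := fxi_center_ne_zero hN1
    have hfp : 0 < ‖fxi (2 + N * I)‖ := norm_pos_iff.mpr hf0
    have hδ : 0 ≤ 1 / (4 * (k + 1)) := by positivity
    have hm := min_modulus differentiable_fxi (c := 2 + N * I) (r := 4) (R := 5)
      (M := Real.exp (K * Real.sqrt (N + 17)) * ‖fxi (2 + N * I)‖) (by norm_num) (by norm_num)
      hδ (fun z hz => ⟨fxi_eq_zero.mpr (hZ0 z hz), H.deriv_fxi_ne (fxi_eq_zero.mpr (hZ0 z hz))⟩)
      hZ5 hZall (fun s hs => hK N hN1 s (by rw [hs]; norm_num)) hf0 hdist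
      (by
        intro z hz
        obtain ⟨γ, hγ, rfl⟩ := Finset.mem_image.mp hz
        refine (hT γ hγ).trans ?_
        have := abs_im_le_norm ((x + T * I : ℂ) - (1 / 2 + γ * I))
        simpa using this)
    rw [mul_div_cancel_right₀ _ hfp.ne', Real.log_exp, hcardZ] at hm
    have hpow : Real.exp (-(40 * (k + 1) * k)) ≤ (1 / (4 * (k + 1)) / (2 * 5)) ^ S.card := by
      have : Real.exp (-(40 * (k + 1) * k)) = Real.exp (-(40 * (k + 1))) ^ S.card := by
        rw [← Real.exp_nat_mul]; congr 1; rw [← hk]; ring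
      rw [this]
      apply pow_le_pow_left₀ (Real.exp_pos _).le
      rw [Real.exp_neg, inv_le_comm₀ (Real.exp_pos _) (by positivity)]
      have := Real.add_one_le_exp (40 * (k + 1))
      refine le_trans (le_of_eq ?_) (by linarith : 40 * (k + 1) ≤ _)
      field_simp
      norm_num
    have hbig : c * Real.exp (-(Q * T))
        ≤ ‖fxi (x + T * I)‖ := by
      refine le_trans ?_ hm
      have e1 : c * Real.exp (-(8 * (K + 1) * 18 * T)) * Real.exp (-(40 * (k + 1) * k)) ≤
          ‖fxi (2 + N * I)‖ * Real.exp (-(2 * (K * Real.sqrt (N + 17) + 1) * 4 / (5 - 4))) *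
          (1 / (4 * (k + 1)) / (2 * 5)) ^ S.card := by
        gcongr
        · exact hc N hN1
        · norm_num
          nlinarith
      refine le_trans ?_ e1
      rw [mul_assoc, ← Real.exp_add]
      gcongr
      have : k * k ≤ (C * Real.sqrt (N + 17)) * (C * Real.sqrt (N + 17)) := by gcongr
      have hT0 : 0 ≤ T := by linarith
      have e3 : k ≤ C * (18 * T) := hcard.trans (by gcongr)
      have e4 : k * k ≤ C * C * (18 * T) := by nlinarith [mul_pos hC0 hC0]
      have e5 : C * C * (18 * T) ≤ C * C * 18 * 18 * T := by nlinarith [mul_nonneg (mul_pos hC0 hC0).le hT0]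
      nlinarith
    have h1 := norm_fxi (x + T * I)
    simp at h1
    rw [h1] at hbig
    have h2 : c * Real.exp (-((Q + 1) * T)) * Real.exp T ≤ ‖xi (x + T * I)‖ * Real.exp T := by
      rw [mul_assoc, ← Real.exp_add]
      rw [show -((Q + 1) * T) + T = -(Q * T) by ring]
      refine hbig.trans ?_
      gcongr
      nlinarith [Real.pi_lt_four]
    exact le_of_mul_le_mul_right h2 (Real.exp_pos _)
  have fin : ∀ w : ℂ, -1 ≤ w.re → w.re ≤ 2 → |w.im| = T →
      c * Real.exp (-((Q + 1) * T)) ≤ ‖xi w‖ →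
      ‖zi w‖ ≤ Real.exp ((Q + 1 + 4 + |Real.log (B / c)|) * T) := by
    intro w h1 h2 h3 h4
    have hw : ‖w - 1‖ ≤ Real.exp (4 * T) := by
      have h5 := norm_le_abs_re_add_abs_im (w - 1)
      simp [h3] at h5
      have h6 : |w.re - 1| ≤ 2 := abs_le.mpr ⟨by linarith, by linarith⟩
      have := Real.add_one_le_exp (4 * T)
      linarith
    calc ‖zi w‖ ≤ B * ‖w - 1‖ / ‖xi w‖ := hB w h1 h2
      _ ≤ B * Real.exp (4 * T) / (c * Real.exp (-((Q + 1) * T))) := by gcongr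
      _ = (B / c) * Real.exp ((Q + 1 + 4) * T) := by
        rw [Real.exp_neg, show (Q + 1 + 4) * T = 4 * T + (Q + 1) * T by ring, Real.exp_add]
        field_simp
      _ ≤ Real.exp (|Real.log (B / c)| * T) * Real.exp ((Q + 1 + 4) * T) := by
        gcongr
        rw [← Real.log_le_iff_le_exp (by positivity)]
        refine (le_abs_self _).trans ?_
        nlinarith
      _ = _ := by rw [← Real.exp_add]; congr 1; ring
  have hpos : 0 < c * Real.exp (-((Q + 1) * T)) := by positivity
  have hT0 : 0 ≤ T := by linarith
  intro x hx1 hx2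
  have k1 := key x hx1 hx2
  have k2 := key (1 - x) (by linarith) (by linarith)
  rw [← xi_one_sub] at k2
  have e : (1 - (((1 - x : ℝ) : ℂ) + T * I)) = x - T * I := by push_cast; ring
  rw [e] at k2
  refine ⟨norm_pos_iff.mp (hpos.trans_le k1), norm_pos_iff.mp (hpos.trans_le k2),
    fin _ (by simpa using hx1) (by simpa using hx2) (by simpa using hT0) k1,
    fin _ (by simpa using hx1) (by simpa using hx2) (by simpa using hT0) k2⟩

/-- Counterclockwise integral over the boundary of the rectangle `[a, b] × [c, d]`. -/
noncomputable def rectInt (f : ℂ → ℂ) (a b c d : ℝ) : ℂ :=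
  (∫ x in a..b, f (x + c * I)) - (∫ x in a..b, f (x + d * I)) +
    I * (∫ y in c..d, f (b + y * I)) - I * ∫ y in c..d, f (a + y * I)

lemma integral_horizontal_inv {a b c : ℝ} {p : ℂ} (h : c - p.im ≠ 0) :
    ∫ x in a..b, ((x + c * I : ℂ) - p)⁻¹ = log (b + c * I - p) - log (a + c * I - p) := by
  have hs : ∀ x : ℝ, (x + c * I : ℂ) - p ∈ slitPlane := fun x => by
    rw [mem_slitPlane_iff]; right; simpa using h
  have := intervalIntegral.integral_eq_sub_of_hasDerivAt (a := a) (b := b)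
    (f := fun x : ℝ => log ((x + c * I : ℂ) - p)) (f' := fun x : ℝ => ((x + c * I : ℂ) - p)⁻¹)
    (fun x _ => by
      have h1 : HasDerivAt (fun x : ℝ => (x + c * I : ℂ) - p) 1 x :=
        (((hasDerivAt_id x).ofReal_comp).add_const _).sub_const _
      simpa using h1.clog_real (hs x))
    (by
      apply ContinuousOn.intervalIntegrable
      intro x _
      have := slitPlane_ne_zero (hs x)
      apply ContinuousAt.continuousWithinAt
      fun_prop (disch := assumption))
  exact this

lemma integral_vertical_inv {b c d : ℝ} {p : ℂ} (h : 0 < b - p.re) :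
    I * ∫ y in c..d, ((b + y * I : ℂ) - p)⁻¹ = log (b + d * I - p) - log (b + c * I - p) := by
  have hs : ∀ x : ℝ, (b + x * I : ℂ) - p ∈ slitPlane := fun x => by
    rw [mem_slitPlane_iff]; left; simpa using h
  have := intervalIntegral.integral_eq_sub_of_hasDerivAt (a := c) (b := d)
    (f := fun x : ℝ => log ((b + x * I : ℂ) - p)) (f' := fun x : ℝ => I * ((b + x * I : ℂ) - p)⁻¹)
    (fun x _ => by
      have h1 : HasDerivAt (fun x : ℝ => (b + x * I : ℂ) - p) (1 * I) x :=
        ((((hasDerivAt_id x).ofReal_comp).mul_const I).const_add _).sub_const _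
      simpa [div_eq_mul_inv] using h1.clog_real (hs x))
    (by
      apply ContinuousOn.intervalIntegrable
      intro x _
      have := slitPlane_ne_zero (hs x)
      apply ContinuousAt.continuousWithinAt
      fun_prop (disch := assumption))
  rw [← this, intervalIntegral.integral_const_mul]

lemma integral_vertical_inv_left {a c d : ℝ} {p : ℂ} (h : a - p.re < 0) :
    I * ∫ y in c..d, ((a + y * I : ℂ) - p)⁻¹ =
      log (-(a + d * I - p)) - log (-(a + c * I - p)) := by
  have hs : ∀ x : ℝ, -((a + x * I : ℂ) - p) ∈ slitPlane := fun x => by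
    rw [mem_slitPlane_iff]; left; simpa using h
  have := intervalIntegral.integral_eq_sub_of_hasDerivAt (a := c) (b := d)
    (f := fun x : ℝ => log (-((a + x * I : ℂ) - p)))
    (f' := fun x : ℝ => I * ((a + x * I : ℂ) - p)⁻¹)
    (fun x _ => by
      have h1 : HasDerivAt (fun x : ℝ => -((a + x * I : ℂ) - p)) (-(1 * I)) x :=
        (((((hasDerivAt_id x).ofReal_comp).mul_const I).const_add _).sub_const _).fun_neg
      have := h1.clog_real (hs x)
      rw [neg_div_neg_eq] at this
      simpa [div_eq_mul_inv] using this)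
    (by
      apply ContinuousOn.intervalIntegrable
      intro x _
      have := neg_ne_zero.mp (slitPlane_ne_zero (hs x))
      apply ContinuousAt.continuousWithinAt
      fun_prop (disch := assumption))
  rw [← this, intervalIntegral.integral_const_mul]

lemma rectInt_inv {a b c d : ℝ} {p : ℂ} (h1 : a < p.re) (h2 : p.re < b) (h3 : c < p.im)
    (h4 : p.im < d) : rectInt (fun w => (w - p)⁻¹) a b c d = 2 * Real.pi * I := by
  unfold rectInt
  rw [integral_horizontal_inv (by linarith : c - p.im < 0).ne,
    integral_horizontal_inv (by linarith : 0 < d - p.im).ne',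
    integral_vertical_inv (by linarith), integral_vertical_inv_left (by linarith)]
  have e1 : log (-(a + d * I - p)) = log (a + d * I - p) - Real.pi * I := by
    rw [log, log, norm_neg, arg_neg_eq_arg_sub_pi_of_im_pos (by simpa using h4)]
    push_cast; ring
  have e2 : log (-(a + c * I - p)) = log (a + c * I - p) + Real.pi * I := by
    rw [log, log, norm_neg, arg_neg_eq_arg_add_pi_of_im_neg (by simpa using h3)]
    push_cast; ring
  rw [e1, e2]; ring

lemma rectInt_congr {f g : ℂ → ℂ} {a b c d : ℝ} (hab : a ≤ b) (hcd : c ≤ d)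
    (h : ∀ w : ℂ, a ≤ w.re → w.re ≤ b → c ≤ w.im → w.im ≤ d →
      (w.re = a ∨ w.re = b ∨ w.im = c ∨ w.im = d) → f w = g w) :
    rectInt f a b c d = rectInt g a b c d := by
  unfold rectInt
  congr 1
  · congr 1
    · congr 1
      · refine intervalIntegral.integral_congr fun x hx => ?_
        rw [Set.uIcc_of_le hab] at hx
        exact h _ (by simpa using hx.1) (by simpa using hx.2) (by simp) (by simpa) (by simp)
      · refine intervalIntegral.integral_congr fun x hx => ?_
        rw [Set.uIcc_of_le hab] at hx
        exact h _ (by simpa using hx.1) (by simpa using hx.2) (by simpa) (by simp) (by simp)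
    · congr 1
      refine intervalIntegral.integral_congr fun x hx => ?_
      rw [Set.uIcc_of_le hcd] at hx
      exact h _ (by simpa) (by simp) (by simpa using hx.1) (by simpa using hx.2) (by simp)
  · congr 1
    refine intervalIntegral.integral_congr fun x hx => ?_
    rw [Set.uIcc_of_le hcd] at hx
    exact h _ (by simp) (by simpa) (by simpa using hx.1) (by simpa using hx.2) (by simp)

lemma rectInt_sub {f g : ℂ → ℂ} {a b c d : ℝ} (hab : a ≤ b) (hcd : c ≤ d)
    (hf : ∀ w : ℂ, a ≤ w.re → w.re ≤ b → c ≤ w.im → w.im ≤ d →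
      (w.re = a ∨ w.re = b ∨ w.im = c ∨ w.im = d) → ContinuousAt f w)
    (hg : ∀ w : ℂ, a ≤ w.re → w.re ≤ b → c ≤ w.im → w.im ≤ d →
      (w.re = a ∨ w.re = b ∨ w.im = c ∨ w.im = d) → ContinuousAt g w) :
    rectInt (fun w => f w - g w) a b c d = rectInt f a b c d - rectInt g a b c d := by
  have hor : ∀ (f : ℂ → ℂ) (e : ℝ), (∀ x ∈ Set.Icc a b, ContinuousAt f (x + e * I)) →
      IntervalIntegrable (fun x : ℝ => f (x + e * I)) volume a b := by
    intro f e he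
    apply ContinuousOn.intervalIntegrable
    rw [Set.uIcc_of_le hab]
    intro x hx
    exact (ContinuousAt.comp (f := fun x : ℝ => (x + e * I : ℂ)) (he x hx)
      (by fun_prop)).continuousWithinAt
  have ver : ∀ (f : ℂ → ℂ) (e : ℝ), (∀ x ∈ Set.Icc c d, ContinuousAt f (e + x * I)) →
      IntervalIntegrable (fun x : ℝ => f (e + x * I)) volume c d := by
    intro f e he
    apply ContinuousOn.intervalIntegrable
    rw [Set.uIcc_of_le hcd]
    intro x hx
    exact (ContinuousAt.comp (f := fun x : ℝ => (e + x * I : ℂ)) (he x hx)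
      (by fun_prop)).continuousWithinAt
  have sides : ∀ f : ℂ → ℂ, (∀ w : ℂ, a ≤ w.re → w.re ≤ b → c ≤ w.im → w.im ≤ d →
      (w.re = a ∨ w.re = b ∨ w.im = c ∨ w.im = d) → ContinuousAt f w) →
      IntervalIntegrable (fun x : ℝ => f (x + c * I)) volume a b ∧
      IntervalIntegrable (fun x : ℝ => f (x + d * I)) volume a b ∧
      IntervalIntegrable (fun x : ℝ => f (b + x * I)) volume c d ∧
      IntervalIntegrable (fun x : ℝ => f (a + x * I)) volume c d := by
    intro f hf
    refine ⟨hor f c fun x hx => ?_, hor f d fun x hx => ?_, ver f b fun x hx => ?_,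
      ver f a fun x hx => ?_⟩ <;> apply hf <;> simp [hx.1, hx.2, hab, hcd]
  obtain ⟨f1, f2, f3, f4⟩ := sides f hf
  obtain ⟨g1, g2, g3, g4⟩ := sides g hg
  unfold rectInt
  rw [intervalIntegral.integral_sub f1 g1, intervalIntegral.integral_sub f2 g2,
    intervalIntegral.integral_sub f3 g3, intervalIntegral.integral_sub f4 g4]
  ring

lemma rectInt_const_mul (k : ℂ) (f : ℂ → ℂ) (a b c d : ℝ) :
    rectInt (fun w => k * f w) a b c d = k * rectInt f a b c d := by
  unfold rectInt
  simp only [intervalIntegral.integral_const_mul]; ring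

/-- The residue theorem for rectangles and finitely many simple poles. -/
theorem rectInt_eq_sum_residues {a b c d : ℝ} (hab : a ≤ b) (hcd : c ≤ d) (P : Finset ℂ)
    (r : ℂ → ℂ) : ∀ f : ℂ → ℂ,
    (∀ p ∈ P, a < p.re ∧ p.re < b ∧ c < p.im ∧ p.im < d) →
    (∀ w : ℂ, a ≤ w.re → w.re ≤ b → c ≤ w.im → w.im ≤ d → w ∉ P → DifferentiableAt ℂ f w) →
    (∀ p ∈ P, Tendsto (fun w => (w - p) * f w) (𝓝[≠] p) (𝓝 (r p))) →
    rectInt f a b c d = 2 * Real.pi * I * ∑ p ∈ P, r p := by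
  classical
  induction P using Finset.induction_on with
  | empty =>
    intro f _ hf _
    have := integral_boundary_rect_eq_zero_of_differentiableOn f (a + c * I) (b + d * I)
      (by
        intro w hw
        simp only [add_re, ofReal_re, mul_re, I_re, mul_zero, ofReal_im, I_im, mul_one, sub_self,
          add_zero, add_im, mul_im, zero_add] at hw
        rw [Set.uIcc_of_le hab, Set.uIcc_of_le hcd, mem_reProdIm] at hw
        exact (hf w hw.1.1 hw.1.2 hw.2.1 hw.2.2 (by simp)).differentiableWithinAt)
    simpa [rectInt] using this
  | insert p P hp ih =>
    intro f hP hf hr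
    obtain ⟨p1, p2, p3, p4⟩ := hP p (Finset.mem_insert_self _ _)
    set g : ℂ → ℂ := fun w => f w - r p * (w - p)⁻¹ with hg
    set h : ℂ → ℂ := Function.update g p (limUnder (𝓝[≠] p) g) with hh
    have hgd : ∀ w : ℂ, a ≤ w.re → w.re ≤ b → c ≤ w.im → w.im ≤ d → w ∉ P → w ≠ p →
        DifferentiableAt ℂ g w := by
      intro w w1 w2 w3 w4 w5 w6
      have := hf w w1 w2 w3 w4 (by simp [w5, w6])
      have h6 : w - p ≠ 0 := sub_ne_zero.mpr w6
      rw [hg]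
      fun_prop (disch := assumption)
    set U : Set ℂ := {w | a < w.re} ∩ {w | w.re < b} ∩ {w | c < w.im} ∩ {w | w.im < d} ∩ (P : Set ℂ)ᶜ
      with hU
    have hUo : IsOpen U := by
      refine IsOpen.inter (IsOpen.inter (IsOpen.inter (IsOpen.inter ?_ ?_) ?_) ?_)
        P.finite_toSet.isClosed.isOpen_compl
      · exact isOpen_lt continuous_const continuous_re
      · exact isOpen_lt continuous_re continuous_const
      · exact isOpen_lt continuous_const continuous_im
      · exact isOpen_lt continuous_im continuous_const
    have hpU : p ∈ U := ⟨⟨⟨⟨p1, p2⟩, p3⟩, p4⟩, by simpa using hp⟩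
    have hUn : U ∈ 𝓝 p := hUo.mem_nhds hpU
    have hlim : Tendsto (fun w => (w - p) * g w) (𝓝[≠] p) (𝓝 0) := by
      have h1 := (hr p (Finset.mem_insert_self _ _)).sub
        (tendsto_const_nhds (x := r p) (f := 𝓝[≠] p))
      rw [sub_self] at h1
      refine h1.congr' ?_
      filter_upwards [self_mem_nhdsWithin] with w hw
      have : w - p ≠ 0 := sub_ne_zero.mpr hw
      simp only [hg]; field_simp
    have hdiff : DifferentiableOn ℂ h U := by
      apply differentiableOn_update_limUnder_of_isLittleO hUn
      · rintro w ⟨⟨⟨⟨⟨w1, w2⟩, w3⟩, w4⟩, w5⟩, w6⟩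
        exact (hgd w (le_of_lt w1) (le_of_lt w2) (le_of_lt w3) (le_of_lt w4)
          (by simpa using w5) w6).differentiableWithinAt
      · have h2 : Tendsto (fun w => (w - p) * (g w - g p)) (𝓝[≠] p) (𝓝 0) := by
          have h3 : Tendsto (fun w : ℂ => (w - p) * g p) (𝓝[≠] p) (𝓝 0) := by
            have : ContinuousAt (fun w : ℂ => (w - p) * g p) p := by fun_prop
            have := this.tendsto
            simp only [sub_self, zero_mul] at this
            exact this.mono_left nhdsWithin_le_nhds
          have := hlim.sub h3
          rw [sub_zero] at this
          exact this.congr fun w => by ring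
        rw [Asymptotics.isLittleO_iff_tendsto']
        · refine h2.congr fun w => ?_
          rw [div_inv_eq_mul, mul_comm]
        · filter_upwards [self_mem_nhdsWithin] with w hw h0
          exact absurd (inv_eq_zero.mp h0) (sub_ne_zero.mpr hw)
    have heq : ∀ w, w ≠ p → h w = g w := fun w hw => Function.update_of_ne hw _ _
    have key := ih h (fun q hq => hP q (Finset.mem_insert_of_mem hq))
      (by
        intro w w1 w2 w3 w4 w5
        by_cases hwp : w = p
        · subst hwp; exact hdiff.differentiableAt hUn
        · refine (hgd w w1 w2 w3 w4 w5 hwp).congr_of_eventuallyEq ?_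
          filter_upwards [isOpen_ne.mem_nhds hwp] with z hz using heq z hz)
      (by
        intro q hq
        have hqp : q ≠ p := by rintro rfl; exact hp hq
        have h1 := hr q (Finset.mem_insert_of_mem hq)
        have h2 : Tendsto (fun w : ℂ => (w - q) * (r p * (w - p)⁻¹)) (𝓝[≠] q) (𝓝 0) := by
          have hne : q - p ≠ 0 := sub_ne_zero.mpr hqp
          have : ContinuousAt (fun w : ℂ => (w - q) * (r p * (w - p)⁻¹)) q := by
            fun_prop (disch := assumption)
          have := this.tendsto
          simp only [sub_self, zero_mul] at this
          exact this.mono_left nhdsWithin_le_nhds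
        have := h1.sub h2
        rw [sub_zero] at this
        refine this.congr' ?_
        filter_upwards [nhdsWithin_le_nhds (isOpen_ne.mem_nhds hqp)] with w hw
        rw [heq w hw]; simp only [hg]; ring)
    have hbd : ∀ w : ℂ, a ≤ w.re → w.re ≤ b → c ≤ w.im → w.im ≤ d →
      (w.re = a ∨ w.re = b ∨ w.im = c ∨ w.im = d) → w ∉ insert p P := by
      intro w _ _ _ _ hw hmem
      obtain ⟨q1, q2, q3, q4⟩ := hP w hmem
      rcases hw with h | h | h | h <;> linarith
    have hne : ∀ w : ℂ, a ≤ w.re → w.re ≤ b → c ≤ w.im → w.im ≤ d →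
      (w.re = a ∨ w.re = b ∨ w.im = c ∨ w.im = d) → w ≠ p := by
      intro w w1 w2 w3 w4 w5 h
      exact hbd w w1 w2 w3 w4 w5 (h ▸ Finset.mem_insert_self _ _)
    have e1 : rectInt h a b c d = rectInt g a b c d :=
      rectInt_congr hab hcd fun w w1 w2 w3 w4 w5 => heq w (hne w w1 w2 w3 w4 w5)
    have e2 : rectInt g a b c d = rectInt f a b c d - rectInt (fun w => r p * (w - p)⁻¹) a b c d := by
      apply rectInt_sub hab hcd
      · intro w w1 w2 w3 w4 w5
        exact (hf w w1 w2 w3 w4 (hbd w w1 w2 w3 w4 w5)).continuousAt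
      · intro w w1 w2 w3 w4 w5
        have := sub_ne_zero.mpr (hne w w1 w2 w3 w4 w5)
        fun_prop (disch := assumption)
    rw [e1, e2, rectInt_const_mul, rectInt_inv p1 p2 p3 p4] at key
    rw [Finset.sum_insert hp]
    linear_combination key

/-- The point of height `γ` on the critical line. -/
noncomputable def crit (γ : ℝ) : ℂ := 1 / 2 + γ * I

lemma crit_injective : Function.Injective crit := by
  intro a b h; simpa [crit] using h

@[simp] lemma crit_re (γ : ℝ) : (crit γ).re = 1 / 2 := by simp [crit]
@[simp] lemma crit_im (γ : ℝ) : (crit γ).im = γ := by simp [crit]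

lemma crit_ne_zero (γ : ℝ) : crit γ ≠ 0 := by
  intro h; have := congrArg re h; norm_num at this

/-- The absolute value of the residue of `1 / ζ` at the zero of ordinate `γ`. -/
noncomputable def resAbs (γ : ℝ) : ℝ := ‖deriv riemannZeta (crit γ)‖⁻¹

lemma resAbs_neg (γ : ℝ) : resAbs (-γ) = resAbs γ := by
  unfold resAbs crit; rw [norm_deriv_zeta_neg]

lemma SimpleRH.tendsto_zi (H : SimpleRH) {γ : ℝ} (hγ : γ ∈ ordSet) :
    Tendsto (fun w => (w - crit γ) * zi w) (𝓝[≠] (crit γ)) (𝓝 (deriv riemannZeta (crit γ))⁻¹) := by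
  have hd := H.deriv_zeta_ne hγ
  have h1 := (differentiableAt_riemannZeta (crit_ne_one γ)).hasDerivAt
  rw [hasDerivAt_iff_tendsto_slope] at h1
  have h2 := h1.inv₀ hd
  refine h2.congr' ?_
  have e1 : ∀ᶠ w : ℂ in 𝓝 (crit γ), 0 < w.re :=
    (isOpen_lt continuous_const continuous_re).mem_nhds (by simp)
  have e2 : ∀ᶠ w : ℂ in 𝓝 (crit γ), w.re < 1 :=
    (isOpen_lt continuous_re continuous_const).mem_nhds (by norm_num)
  have hz : riemannZeta (1 / 2 + γ * I) = 0 := hγ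
  filter_upwards [nhdsWithin_le_nhds e1, nhdsWithin_le_nhds e2] with w w1 w2
  rw [zi_eq (by linarith) (by rintro rfl; simp at w1) (by rintro rfl; simp at w2),
    slope_def_field, hz, sub_zero, inv_div, div_eq_mul_inv]
  rfl

lemma norm_exp_sq (u : ℂ) : ‖exp (u ^ 2)‖ = Real.exp (u.re ^ 2 - u.im ^ 2) := by
  rw [norm_exp]; congr 1; simp [sq]

lemma integral_exp_neg_sub_sq_le (t a b : ℝ) (hab : a ≤ b) :
    ∫ y in a..b, Real.exp (-(y - t) ^ 2) ≤ Real.sqrt Real.pi := by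
  have hi : Integrable (fun y : ℝ => Real.exp (-(y - t) ^ 2)) := by
    have := (integrable_exp_neg_mul_sq one_pos).comp_sub_right t
    simpa using this
  have he : ∫ y : ℝ, Real.exp (-(y - t) ^ 2) = Real.sqrt Real.pi := by
    have h1 := integral_sub_right_eq_self (μ := volume) (fun y : ℝ => Real.exp (-y ^ 2)) t
    rw [h1]
    have := integral_gaussian 1
    simpa using this
  rw [intervalIntegral.integral_of_le hab, ← he]
  exact setIntegral_le_integral hi (Eventually.of_forall fun y => (Real.exp_pos _).le)

theorem SimpleRH.norm_zi_le (H : SimpleRH) : ∃ C, 0 ≤ C ∧ ∀ s : ℂ, 1 / 2 < s.re → s.re ≤ 1 →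
    ∃ S : Finset ℝ, (∀ γ ∈ S, γ ∈ ordSet) ∧
      ‖zi s‖ ≤ ∑ γ ∈ S, resAbs γ * Real.exp (1 - (γ - s.im) ^ 2) / ‖s - crit γ‖ + C := by
  classical
  obtain ⟨A, hA0, hA⟩ := H.exists_good_height
  obtain ⟨C1, hC10, hC1⟩ := zi_bounded_two
  obtain ⟨C2, hC20, hC2⟩ := zi_bounded_neg_one
  set V := Real.exp 4 * Real.sqrt Real.pi with hV
  refine ⟨6 + C1 * V + C2 * V, by positivity, fun s hs1 hs2 => ?_⟩
  set t := s.im with ht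
  obtain ⟨n, hn⟩ := exists_nat_ge (4 * A + 8 + 2 * |t|)
  have ht0 := abs_nonneg t
  have hn1 : 1 ≤ n := by
    have : (1 : ℝ) ≤ n := by linarith
    exact_mod_cast this
  obtain ⟨T, hT1, hT2, hT⟩ := hA n hn1
  have hTt : 2 * |t| + 4 * A + 8 ≤ T := by linarith
  obtain ⟨ht1, ht2⟩ := abs_le.mp (le_refl |t|)
  have hTdecay : ∀ y : ℝ, |y| = T → A * T + 4 - (y - t) ^ 2 ≤ 0 := by
    intro y hy
    have h1 : T / 2 ≤ |y - t| := by
      have := abs_sub_abs_le_abs_sub y t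
      rw [hy] at this; linarith
    have h2 : (T / 2) ^ 2 ≤ (y - t) ^ 2 := by
      rw [← sq_abs (y - t)]; exact pow_le_pow_left₀ (by linarith) h1 2
    nlinarith
  set S := (finite_ordSet_inter (-T) T).toFinset with hS
  have hSmem : ∀ γ, γ ∈ S ↔ γ ∈ ordSet ∧ -T ≤ γ ∧ γ ≤ T := by
    intro γ; rw [hS, Set.Finite.mem_toFinset]; rfl
  have hSlt : ∀ γ ∈ S, -T < γ ∧ γ < T := by
    intro γ hγ
    obtain ⟨h1, h2, h3⟩ := (hSmem γ).mp hγ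
    have hx := xi_eq_zero_of_mem h1
    have hh := hT (1 / 2) (by norm_num) (by norm_num)
    constructor
    · refine lt_of_le_of_ne h2 ?_
      rintro rfl
      apply hh.2.1
      rw [← hx]; push_cast; congr 1; ring
    · refine lt_of_le_of_ne h3 ?_
      rintro rfl
      apply hh.1
      rw [← hx]; push_cast; congr 1
  have hsS : s ∉ S.image crit := by
    intro h
    obtain ⟨γ, _, h⟩ := Finset.mem_image.mp h
    rw [← h] at hs1; simp at hs1
  set f : ℂ → ℂ := fun w => zi w * exp ((w - s) ^ 2) / (w - s) with hf
  set r : ℂ → ℂ := fun w => if w = s then zi s else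
    (deriv riemannZeta w)⁻¹ * exp ((w - s) ^ 2) / (w - s) with hr
  have hxs : xi s ≠ 0 := H.xi_ne_zero hs1.ne'
  have hres := rectInt_eq_sum_residues (a := -1) (b := 2) (c := -T) (d := T) (by norm_num)
    (by linarith) (insert s (S.image crit)) r f
    (by
      intro p hp
      rcases Finset.mem_insert.mp hp with rfl | hp
      · refine ⟨by linarith, by linarith, by linarith, by linarith⟩
      · obtain ⟨γ, hγ, rfl⟩ := Finset.mem_image.mp hp
        have := hSlt γ hγ
        simp only [crit_re, crit_im]
        refine ⟨by norm_num, by norm_num, this.1, this.2⟩)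
    (by
      intro w w1 w2 w3 w4 w5
      have hws : w - s ≠ 0 := by
        intro h; exact w5 (by rw [sub_eq_zero.mp h]; exact Finset.mem_insert_self _ _)
      have hxw : xi w ≠ 0 := by
        intro h
        obtain ⟨g1, g2⟩ := H.xi_eq_zero_iff.mp h
        apply w5
        refine Finset.mem_insert_of_mem (Finset.mem_image.mpr ⟨w.im, (hSmem _).mpr ⟨g2, w3, w4⟩, ?_⟩)
        apply Complex.ext
        · rw [crit_re, g1]
        · rw [crit_im]
      have hz := differentiableAt_zi (by linarith) hxw
      rw [hf]
      fun_prop (disch := assumption))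
    (by
      intro p hp
      rcases Finset.mem_insert.mp hp with rfl | hp'
      · have hz := (differentiableAt_zi (by linarith) hxs).continuousAt
        have h1 : ContinuousAt (fun w => zi w * exp ((w - p) ^ 2)) p := by fun_prop
        have h2 := h1.tendsto.mono_left (nhdsWithin_le_nhds (s := {p}ᶜ))
        simp only [sub_self, ne_eq, OfNat.ofNat_ne_zero, not_false_eq_true, zero_pow, exp_zero,
          mul_one] at h2
        simp only [hr, if_true]
        refine h2.congr' ?_
        filter_upwards [self_mem_nhdsWithin] with w hw
        have : w - p ≠ 0 := sub_ne_zero.mpr hw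
        simp only [hf]; field_simp
      · have hps : p ≠ s := fun h => hsS (h ▸ hp')
        obtain ⟨γ, hγ, rfl⟩ := Finset.mem_image.mp hp'
        have h1 := H.tendsto_zi ((hSmem γ).mp hγ).1
        have hne : crit γ - s ≠ 0 := sub_ne_zero.mpr hps
        have h2 : ContinuousAt (fun w => exp ((w - s) ^ 2) / (w - s)) (crit γ) := by
          fun_prop (disch := assumption)
        have h3 := h1.mul (h2.tendsto.mono_left (nhdsWithin_le_nhds (s := {crit γ}ᶜ)))
        simp only [hr, if_neg hps]
        rw [mul_div_assoc]
        refine h3.congr fun w => ?_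
        simp only [hf]; ring)
  rw [Finset.sum_insert hsS, Finset.sum_image (fun a _ b _ h => crit_injective h)] at hres
  have hr1 : r s = zi s := by simp [hr]
  rw [hr1] at hres
  have hterm : ∀ γ ∈ S, ‖r (crit γ)‖ ≤ resAbs γ * Real.exp (1 - (γ - t) ^ 2) / ‖s - crit γ‖ := by
    intro γ hγ
    have hps : crit γ ≠ s := by rintro h; exact hsS (h ▸ Finset.mem_image_of_mem _ hγ)
    simp only [hr, if_neg hps]
    rw [norm_div, norm_mul, norm_exp_sq, norm_inv, norm_sub_rev]
    have : (crit γ - s).re ^ 2 - (crit γ - s).im ^ 2 ≤ 1 - (γ - t) ^ 2 := by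
      simp only [sub_re, sub_im, crit_re, crit_im, ht]
      nlinarith
    unfold resAbs
    gcongr
  have hver : ∀ e : ℝ, ∀ D : ℝ, 0 ≤ D → 1 ≤ |e - s.re| → |e - s.re| ≤ 2 →
      (∀ y : ℝ, ‖zi (e + y * I)‖ ≤ D) → ‖∫ y in (-T)..T, f (e + y * I)‖ ≤ D * V := by
    intro e D hD0 he1 he2 hD
    have hb : ∀ y : ℝ, ‖f (e + y * I)‖ ≤ D * Real.exp 4 * Real.exp (-(y - t) ^ 2) := by
      intro y
      rw [hf]
      simp only
      rw [norm_div, norm_mul, norm_exp_sq]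
      have h1 : 1 ≤ ‖(e + y * I : ℂ) - s‖ := by
        have := abs_re_le_norm ((e + y * I : ℂ) - s)
        simp at this; linarith
      have h2 : ((e + y * I : ℂ) - s).re ^ 2 - ((e + y * I : ℂ) - s).im ^ 2 ≤ 4 + (-(y - t) ^ 2) := by
        simp only [sub_re, add_re, ofReal_re, mul_re, I_re, mul_zero, ofReal_im, I_im, mul_one,
          sub_self, add_zero, sub_im, add_im, mul_im, zero_add]
        rw [← sq_abs (e - s.re)]
        nlinarith [abs_nonneg (e - s.re)]
      have h3 := div_le_self (a := ‖zi (e + y * I)‖ *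
        Real.exp (((e + y * I : ℂ) - s).re ^ 2 - ((e + y * I : ℂ) - s).im ^ 2)) (by positivity) h1
      refine h3.trans ?_
      rw [mul_assoc, ← Real.exp_add]
      gcongr
      exact hD y
    have hI : IntervalIntegrable (fun y : ℝ => D * Real.exp 4 * Real.exp (-(y - t) ^ 2))
        volume (-T) T := (by fun_prop : Continuous _).intervalIntegrable _ _
    refine (intervalIntegral.norm_integral_le_of_norm_le (by linarith)
      (Eventually.of_forall fun y _ => hb y) hI).trans ?_
    rw [intervalIntegral.integral_const_mul, hV, ← mul_assoc]
    gcongr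
    exact integral_exp_neg_sub_sq_le _ _ _ (by linarith)
  have hhor : ∀ y : ℝ, |y| = T → (∀ x : ℝ, -1 ≤ x → x ≤ 2 → ‖zi (x + y * I)‖ ≤ Real.exp (A * T)) →
      ‖∫ x in (-1 : ℝ)..2, f (x + y * I)‖ ≤ 3 := by
    intro y hy hz
    have := intervalIntegral.norm_integral_le_of_norm_le_const (a := (-1 : ℝ)) (b := 2) (C := 1)
      (f := fun x : ℝ => f (x + y * I)) (by
        intro x hx
        rw [Set.uIoc_of_le (by norm_num)] at hx
        rw [hf]
        simp only
        rw [norm_div, norm_mul, norm_exp_sq]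
        have h1 : 1 ≤ ‖(x + y * I : ℂ) - s‖ := by
          have h2 := abs_im_le_norm ((x + y * I : ℂ) - s)
          have := abs_sub_abs_le_abs_sub y t
          simp at h2; linarith
        refine (div_le_self (by positivity) h1).trans ?_
        calc _ ≤ Real.exp (A * T) *
            Real.exp (((x + y * I : ℂ) - s).re ^ 2 - ((x + y * I : ℂ) - s).im ^ 2) := by
              gcongr; exact hz x hx.1.le hx.2
          _ ≤ 1 := by
              rw [← Real.exp_add, Real.exp_le_one_iff]
              simp only [sub_re, add_re, ofReal_re, mul_re, I_re, mul_zero, ofReal_im, I_im,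
                mul_one, sub_self, add_zero, sub_im, add_im, mul_im, zero_add]
              have := hTdecay y hy
              have h3 : -2 ≤ x - s.re := by linarith [hx.1]
              have h4 : x - s.re ≤ 2 := by linarith [hx.2]
              nlinarith)
    refine this.trans ?_
    norm_num
  have hTpos : 0 < T := by linarith
  have b1 := hhor T (abs_of_pos hTpos) fun x h1 h2 => (hT x h1 h2).2.2.1
  have b2 := hhor (-T) (by rw [abs_neg, abs_of_pos hTpos]) fun x h1 h2 => by
    have := (hT x h1 h2).2.2.2
    rwa [show (x + ((-T : ℝ) : ℂ) * I : ℂ) = x - T * I by push_cast; ring]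
  have b3 := hver 2 C1 hC10 (by rw [abs_of_pos] <;> linarith) (by rw [abs_of_pos] <;> linarith)
    fun y => hC1 _ (by simp)
  have b4 := hver (-1) C2 hC20 (by rw [abs_of_neg] <;> linarith) (by rw [abs_of_neg] <;> linarith)
    fun y => hC2 _ (by simp)
  have hrect : ‖rectInt f (-1) 2 (-T) T‖ ≤ 6 + C1 * V + C2 * V := by
    unfold rectInt
    refine (norm_sub_le _ _).trans ?_
    refine (add_le_add (norm_add_le _ _) le_rfl).trans ?_
    refine (add_le_add (add_le_add (norm_sub_le _ _) le_rfl) le_rfl).trans ?_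
    rw [norm_mul, norm_mul, norm_I, one_mul, one_mul]
    linarith
  have hpi : ‖(2 * Real.pi * I : ℂ)‖ = 2 * Real.pi := by
    simp [abs_of_pos Real.pi_pos]
  have hzi : zi s = (2 * Real.pi * I)⁻¹ * rectInt f (-1) 2 (-T) T - ∑ γ ∈ S, r (crit γ) := by
    have : (2 * Real.pi * I : ℂ) ≠ 0 := by simp [Real.pi_ne_zero]
    rw [hres, inv_mul_cancel_left₀ this]; ring
  refine ⟨S, fun γ hγ => ((hSmem γ).mp hγ).1, ?_⟩
  rw [hzi]
  refine (norm_sub_le _ _).trans ?_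
  rw [add_comm]
  refine add_le_add ((norm_sum_le _ _).trans (Finset.sum_le_sum hterm)) ?_
  rw [norm_mul, norm_inv, hpi]
  have h1 : (2 * Real.pi)⁻¹ ≤ 1 := by
    apply inv_le_one_of_one_le₀
    linarith [Real.pi_gt_three]
  calc _ ≤ 1 * ‖rectInt f (-1) 2 (-T) T‖ := by gcongr
    _ ≤ _ := by rw [one_mul]; exact hrect

lemma countable_ordSet : ordSet.Countable := by
  have : ordSet = ⋃ n : ℕ, ordSet ∩ Set.Icc (-(n : ℝ)) n := by
    ext x
    simp only [Set.mem_iUnion, Set.mem_inter_iff, Set.mem_Icc]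
    constructor
    · intro hx
      obtain ⟨n, hn⟩ := exists_nat_ge |x|
      exact ⟨n, hx, by linarith [neg_abs_le x], by linarith [le_abs_self x]⟩
    · rintro ⟨n, hx, -⟩; exact hx
  rw [this]
  exact Set.countable_iUnion fun n => (finite_ordSet_inter _ _).countable

instance : Countable ordSet := countable_ordSet.to_subtype

lemma tsum_indicator_neg_symm (H : SimpleRH) (g : ℝ → ENNReal) (hg : ∀ x, g (-x) = g x) :
    ∑' γ : ordSet, g γ = 2 * ∑' γ : {γ : ℝ // 0 < γ ∧ γ ∈ ordSet}, g γ := by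
  set P : Set ℝ := {γ | 0 < γ ∧ γ ∈ ordSet} with hP
  have e1 : ∑' γ : ordSet, g γ = ∑' x : ℝ, ordSet.indicator g x := tsum_subtype ordSet g
  have e2 : ∑' γ : {γ : ℝ // 0 < γ ∧ γ ∈ ordSet}, g γ = ∑' x : ℝ, P.indicator g x :=
    tsum_subtype P g
  have e3 : ∑' x : ℝ, P.indicator g (-x) = ∑' x : ℝ, P.indicator g x :=
    (Equiv.neg ℝ).tsum_eq (P.indicator g)
  rw [e1, e2, two_mul]
  nth_rewrite 2 [← e3]
  rw [← ENNReal.tsum_add]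
  refine tsum_congr fun x => ?_
  have h0 := H.zero_notMem
  by_cases hx : x ∈ ordSet
  · have hx' : -x ∈ ordSet := neg_mem_ordSet.mpr hx
    rw [Set.indicator_of_mem hx]
    rcases lt_trichotomy x 0 with h | h | h
    · rw [Set.indicator_of_notMem (fun h2 : x ∈ P => by have := h2.1; linarith),
        Set.indicator_of_mem (show -x ∈ P from ⟨by linarith, hx'⟩), hg, zero_add]
    · exact absurd (h ▸ hx) h0
    · rw [Set.indicator_of_mem (show x ∈ P from ⟨h, hx⟩),
        Set.indicator_of_notMem (fun h2 : -x ∈ P => by have := h2.1; linarith), add_zero]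
  · rw [Set.indicator_of_notMem hx, Set.indicator_of_notMem (fun h2 : x ∈ P => hx h2.2),
      Set.indicator_of_notMem (fun h2 : -x ∈ P => hx (neg_mem_ordSet.mp h2.2)), add_zero]

/-- Weights controlling `1 / ζ` to the right of the critical line in mean square. -/
noncomputable def wt (γ : ℝ) : ℝ := resAbs γ ^ 2 * (1 + |γ|) ^ (-(3 / 2) : ℝ)

lemma wt_nonneg (γ : ℝ) : 0 ≤ wt γ := by unfold wt; positivity

lemma wt_neg (γ : ℝ) : wt (-γ) = wt γ := by unfold wt; rw [resAbs_neg, abs_neg]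

lemma tsum_resAbs_le {θ C : ℝ}
    (hJ : ∀ T : ℝ, 1 ≤ T →
      (∑' γ : {γ : ℝ // 0 < γ ∧ γ ≤ T ∧ riemannZeta (1 / 2 + γ * Complex.I) = 0},
        1 / ‖deriv riemannZeta (1 / 2 + (γ : ℝ) * Complex.I)‖ ^ 2) ≤ C * T ^ θ)
    {T : ℝ} (hT : 1 ≤ T) :
    ∑' γ : {γ : ℝ // 0 < γ ∧ γ ∈ ordSet}, (if (γ : ℝ) ≤ T then ENNReal.ofReal (resAbs γ ^ 2) else 0)
      ≤ ENNReal.ofReal (C * T ^ θ) := by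
  set P : Set ℝ := {γ | 0 < γ ∧ γ ∈ ordSet} with hP
  set Q : Set ℝ := {γ | 0 < γ ∧ γ ≤ T ∧ riemannZeta (1 / 2 + γ * Complex.I) = 0} with hQ
  have hQf : Q.Finite := (finite_ordSet_inter 0 T).subset fun x hx => ⟨hx.2.2, hx.1.le, hx.2.1⟩
  have : Finite Q := hQf
  have e1 := tsum_subtype P (fun γ => if (γ : ℝ) ≤ T then ENNReal.ofReal (resAbs γ ^ 2) else 0)
  have e2 := tsum_subtype Q (fun γ => ENNReal.ofReal (resAbs γ ^ 2))
  have e3 : ∑' γ : Q, ENNReal.ofReal (resAbs γ ^ 2) ≤ ENNReal.ofReal (C * T ^ θ) := by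
    rw [← ENNReal.ofReal_tsum_of_nonneg (fun γ => sq_nonneg _) Summable.of_finite]
    refine ENNReal.ofReal_le_ofReal (le_trans (le_of_eq ?_) (hJ T hT))
    refine tsum_congr fun γ => ?_
    unfold resAbs crit
    rw [inv_pow]; exact (one_div _).symm
  refine le_trans (le_of_eq ?_) e3
  refine e1.trans (Eq.trans ?_ e2.symm)
  refine tsum_congr fun x => ?_
  by_cases hx : x ∈ Q
  · rw [Set.indicator_of_mem hx, Set.indicator_of_mem (show x ∈ P from ⟨hx.1, hx.2.2⟩), if_pos hx.2.1]
  · rw [Set.indicator_of_notMem hx]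
    by_cases hx' : x ∈ P
    · rw [Set.indicator_of_mem hx', if_neg]
      intro h; exact hx ⟨hx'.1, h, hx'.2⟩
    · rw [Set.indicator_of_notMem hx']

lemma tsum_wt_ne_top (H : SimpleRH) {θ C : ℝ} (hθ : θ < 3 / 2)
    (hJ : ∀ T : ℝ, 1 ≤ T →
      (∑' γ : {γ : ℝ // 0 < γ ∧ γ ≤ T ∧ riemannZeta (1 / 2 + γ * Complex.I) = 0},
        1 / ‖deriv riemannZeta (1 / 2 + (γ : ℝ) * Complex.I)‖ ^ 2) ≤ C * T ^ θ) :
    ∑' γ : ordSet, ENNReal.ofReal (wt γ) ≠ ⊤ := by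
  rw [tsum_indicator_neg_symm H (fun γ => ENNReal.ofReal (wt γ)) (fun x => by simp only [wt_neg])]
  refine ENNReal.mul_ne_top (by simp) ?_
  set q : ℝ := 2 ^ (-(3 / 2) : ℝ) with hq
  have hq0 : 0 < q := by positivity
  have key : ∀ γ : {γ : ℝ // 0 < γ ∧ γ ∈ ordSet}, ENNReal.ofReal (wt γ) ≤
      ∑' k : ℕ, ENNReal.ofReal (q ^ k) *
        (if (γ : ℝ) ≤ 2 ^ (k + 1) then ENNReal.ofReal (resAbs γ ^ 2) else 0) := by
    intro γ
    obtain ⟨k, hk1, hk2⟩ := exists_nat_pow_near (x := 1 + (γ : ℝ)) (y := 2)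
      (by linarith [γ.2.1]) (by norm_num)
    refine le_trans ?_ (ENNReal.le_tsum k)
    rw [if_pos (by linarith), ← ENNReal.ofReal_mul (by positivity)]
    refine ENNReal.ofReal_le_ofReal ?_
    unfold wt
    rw [mul_comm, abs_of_pos γ.2.1]
    gcongr
    have : q ^ k = ((2 : ℝ) ^ k) ^ (-(3 / 2) : ℝ) := by
      rw [hq, ← Real.rpow_natCast, ← Real.rpow_natCast, ← Real.rpow_mul (by norm_num),
        ← Real.rpow_mul (by norm_num), mul_comm]
    rw [this]
    exact Real.rpow_le_rpow_of_nonpos (by positivity) hk1 (by norm_num)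
  refine ne_top_of_le_ne_top ?_ (ENNReal.tsum_le_tsum key)
  rw [ENNReal.tsum_comm]
  have hb : ∀ k : ℕ, ∑' γ : {γ : ℝ // 0 < γ ∧ γ ∈ ordSet}, ENNReal.ofReal (q ^ k) *
        (if (γ : ℝ) ≤ 2 ^ (k + 1) then ENNReal.ofReal (resAbs γ ^ 2) else 0) ≤
      ENNReal.ofReal (|C| * 2 ^ θ * (2 ^ (θ - 3 / 2) : ℝ) ^ k) := by
    intro k
    rw [ENNReal.tsum_mul_left]
    refine (mul_le_mul_right (tsum_resAbs_le hJ (one_le_pow₀ (by norm_num))) _).trans ?_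
    rw [← ENNReal.ofReal_mul (by positivity)]
    refine ENNReal.ofReal_le_ofReal ?_
    have e : q ^ k * ((2 : ℝ) ^ (k + 1)) ^ θ = 2 ^ θ * (2 ^ (θ - 3 / 2) : ℝ) ^ k := by
      rw [hq, ← Real.rpow_natCast, ← Real.rpow_natCast, ← Real.rpow_natCast,
        ← Real.rpow_mul (by norm_num), ← Real.rpow_mul (by norm_num),
        ← Real.rpow_mul (by norm_num), ← Real.rpow_add (by norm_num),
        ← Real.rpow_add (by norm_num)]
      congr 1; push_cast; ring
    calc _ = C * (q ^ k * ((2 : ℝ) ^ (k + 1)) ^ θ) := by ring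
      _ ≤ |C| * (q ^ k * ((2 : ℝ) ^ (k + 1)) ^ θ) := by
          gcongr; exact le_abs_self C
      _ = _ := by rw [e]; ring
  refine ne_top_of_le_ne_top ?_ (ENNReal.tsum_le_tsum hb)
  have hs : Summable fun k : ℕ => |C| * 2 ^ θ * (2 ^ (θ - 3 / 2) : ℝ) ^ k :=
    (summable_geometric_of_lt_one (by positivity)
      (Real.rpow_lt_one_of_one_lt_of_neg (by norm_num) (by linarith))).mul_left _
  rw [← ENNReal.ofReal_tsum_of_nonneg (fun k => by positivity) hs]
  exact ENNReal.ofReal_ne_top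

lemma summable_int_one_add_abs_mul_exp :
    Summable fun j : ℤ => (1 + |(j : ℝ)|) * Real.exp (-|(j : ℝ)|) := by
  have h : Summable fun n : ℕ => (1 + (n : ℝ)) * Real.exp (-(n : ℝ)) := by
    have h0 := Real.summable_pow_mul_exp_neg_nat_mul 0 one_pos
    have h1 := Real.summable_pow_mul_exp_neg_nat_mul 1 one_pos
    refine (h0.add h1).congr fun n => ?_
    simp; ring
  refine Summable.of_nat_of_neg ?_ ?_
  · simpa using h
  · simpa using h

lemma exists_sum_gaussian_le : ∃ C, 0 < C ∧ ∀ t : ℝ, ∀ S : Finset ℝ, (∀ γ ∈ S, γ ∈ ordSet) →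
    ∑ γ ∈ S, Real.exp (-(γ - t) ^ 2) ≤ C * √(|t| + 18) := by
  classical
  obtain ⟨C, hC0, hC⟩ := card_ord_near
  set B := ∑' j : ℤ, (1 + |(j : ℝ)|) * Real.exp (-|(j : ℝ)|) with hB
  have hB : 0 < B := by
    refine summable_int_one_add_abs_mul_exp.tsum_pos (fun j => by positivity) 0 (by simp)
  refine ⟨C * Real.exp 2 * B, by positivity, fun t S hS => ?_⟩
  have hmap : ∀ γ ∈ S, ⌊γ - t⌋ ∈ S.image (fun γ => ⌊γ - t⌋) := fun γ hγ =>
    Finset.mem_image_of_mem _ hγ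
  rw [← Finset.sum_fiberwise_of_maps_to hmap]
  have hfib : ∀ j : ℤ, ∑ γ ∈ S with ⌊γ - t⌋ = j, Real.exp (-(γ - t) ^ 2) ≤
      C * Real.exp 2 * √(|t| + 18) * ((1 + |(j : ℝ)|) * Real.exp (-|(j : ℝ)|)) := by
    intro j
    have h1 : ∀ γ ∈ S.filter (fun γ => ⌊γ - t⌋ = j), Real.exp (-(γ - t) ^ 2) ≤
        Real.exp 2 * Real.exp (-|(j : ℝ)|) := by
      intro γ hγ
      obtain ⟨_, hj⟩ := Finset.mem_filter.mp hγ
      have f1 := Int.floor_le (γ - t)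
      have f2 := Int.lt_floor_add_one (γ - t)
      rw [hj] at f1 f2
      rw [← Real.exp_add, Real.exp_le_exp]
      rcases abs_cases (j : ℝ) with h | h <;> nlinarith [sq_nonneg (γ - t - 1), sq_nonneg (γ - t + 1)]
    have h2 : ((S.filter (fun γ => ⌊γ - t⌋ = j)).card : ℝ) ≤ C * √(|t + j| + 18) := by
      refine hC (t + j) _ (fun γ hγ => hS γ (Finset.mem_filter.mp hγ).1) fun γ hγ => ?_
      obtain ⟨_, hj⟩ := Finset.mem_filter.mp hγ
      have f1 := Int.floor_le (γ - t)
      have f2 := Int.lt_floor_add_one (γ - t)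
      rw [hj] at f1 f2
      rw [abs_le]; constructor <;> linarith
    have h3 : √(|t + j| + 18) ≤ √(|t| + 18) * (1 + |(j : ℝ)|) := by
      have a0 := abs_nonneg t
      have a1 := abs_nonneg (j : ℝ)
      rw [← Real.sqrt_sq (by positivity : (0 : ℝ) ≤ 1 + |(j : ℝ)|), ← Real.sqrt_mul (by positivity)]
      refine Real.sqrt_le_sqrt ?_
      have := abs_add_le t j
      nlinarith [mul_nonneg a0 a1, mul_nonneg a0 (mul_nonneg a1 a1)]
    refine (Finset.sum_le_card_nsmul _ _ _ h1).trans ?_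
    rw [nsmul_eq_mul]
    calc _ ≤ (C * (√(|t| + 18) * (1 + |(j : ℝ)|))) * (Real.exp 2 * Real.exp (-|(j : ℝ)|)) := by
          gcongr; exact h2.trans (by gcongr)
      _ = _ := by ring
  refine (Finset.sum_le_sum fun j _ => hfib j).trans ?_
  rw [← Finset.mul_sum]
  have := summable_int_one_add_abs_mul_exp.sum_le_tsum (S.image (fun γ => ⌊γ - t⌋))
    (fun j _ => by positivity)
  calc _ ≤ C * Real.exp 2 * √(|t| + 18) * B := by gcongr
    _ = _ := by ring

/-- The point `1 / 2 + σ + i t`. -/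
noncomputable def pt (σ t : ℝ) : ℂ := ((1 / 2 + σ : ℝ) : ℂ) + t * I

@[simp] lemma pt_re (σ t : ℝ) : (pt σ t).re = 1 / 2 + σ := by simp [pt]
@[simp] lemma pt_im (σ t : ℝ) : (pt σ t).im = t := by simp [pt]

lemma norm_pt_sub_crit_sq (σ t γ : ℝ) : ‖pt σ t - crit γ‖ ^ 2 = σ ^ 2 + (t - γ) ^ 2 := by
  rw [← normSq_eq_norm_sq, normSq_apply]; simp; ring

lemma norm_pt_sq (σ t : ℝ) : ‖pt σ t‖ ^ 2 = (1 / 2 + σ) ^ 2 + t ^ 2 := by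
  rw [← normSq_eq_norm_sq, normSq_apply]; simp; ring

lemma weight_transfer {σ : ℝ} (hσ : 0 < σ) (t γ : ℝ) :
    √(|t| + 18) * Real.exp (-(γ - t) ^ 2) / ‖pt σ t‖ ^ 2 ≤
      (16 * √18) * (1 + |γ|) ^ (-(3 / 2) : ℝ) := by
  have a0 := abs_nonneg t
  have b0 := abs_nonneg γ
  set u := |γ - t| with hu
  have u0 : 0 ≤ u := abs_nonneg _
  have h1 : √(|t| + 18) ≤ √18 * (1 + |t|) ^ (1 / 2 : ℝ) := by
    rw [← Real.sqrt_eq_rpow, ← Real.sqrt_mul (by norm_num)]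
    exact Real.sqrt_le_sqrt (by linarith)
  have h2 : (1 + |t|) ^ 2 / 8 ≤ ‖pt σ t‖ ^ 2 := by
    rw [norm_pt_sq]
    nlinarith [sq_abs t, sq_nonneg (1 - |t|)]
  have h3 : (1 + |γ|) ^ (3 / 2 : ℝ) ≤ (1 + |t|) ^ (3 / 2 : ℝ) * (1 + u) ^ 2 := by
    have : 1 + |γ| ≤ (1 + |t|) * (1 + u) := by
      have := abs_sub_abs_le_abs_sub γ t
      nlinarith [mul_nonneg a0 u0]
    calc _ ≤ ((1 + |t|) * (1 + u)) ^ (3 / 2 : ℝ) := by gcongr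
      _ = (1 + |t|) ^ (3 / 2 : ℝ) * (1 + u) ^ (3 / 2 : ℝ) :=
          Real.mul_rpow (by positivity) (by positivity)
      _ ≤ _ := by
          gcongr
          rw [← Real.rpow_natCast]
          exact Real.rpow_le_rpow_of_exponent_le (by linarith) (by norm_num)
  have h4 : (1 + u) ^ 2 ≤ 2 * Real.exp ((γ - t) ^ 2) := by
    have := Real.add_one_le_exp ((γ - t) ^ 2)
    rw [← sq_abs (γ - t)] at this ⊢
    nlinarith [sq_nonneg (u - 1)]
  rw [Real.rpow_neg (by positivity), Real.exp_neg, ← div_eq_mul_inv, ← div_eq_mul_inv, div_div]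
  rw [div_le_div_iff₀ (by rw [norm_pt_sq]; positivity) (by positivity)]
  have e : (1 + |t|) ^ (1 / 2 : ℝ) * (1 + |t|) ^ (3 / 2 : ℝ) = (1 + |t|) ^ 2 := by
    rw [← Real.rpow_add (by positivity), ← Real.rpow_natCast]; norm_num
  calc _ ≤ (√18 * (1 + |t|) ^ (1 / 2 : ℝ)) *
        ((1 + |t|) ^ (3 / 2 : ℝ) * (2 * Real.exp ((γ - t) ^ 2))) := by
        gcongr; exact h3.trans (by gcongr)
    _ = √18 * 2 * Real.exp ((γ - t) ^ 2) * ((1 + |t|) ^ (1 / 2 : ℝ) * (1 + |t|) ^ (3 / 2 : ℝ)) := by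
        ring
    _ = 16 * √18 * (Real.exp ((γ - t) ^ 2) * ((1 + |t|) ^ 2 / 8)) := by rw [e]; ring
    _ ≤ _ := by gcongr

/-- `|1 / (s ζ(s))|²` at `s = 1 / 2 + σ + i t`. -/
noncomputable def sqF (σ t : ℝ) : ℝ := ‖zi (pt σ t) / pt σ t‖ ^ 2

lemma sqF_nonneg (σ t : ℝ) : 0 ≤ sqF σ t := sq_nonneg _

theorem SimpleRH.sqF_le (H : SimpleRH) : ∃ K, 0 ≤ K ∧ ∀ σ t : ℝ, 0 < σ → σ ≤ 1 / 2 →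
    ENNReal.ofReal (sqF σ t) ≤ ENNReal.ofReal K * ((∑' γ : ordSet, ENNReal.ofReal (wt γ) *
      ENNReal.ofReal (σ ^ 2 + (t - γ) ^ 2)⁻¹) + ENNReal.ofReal (1 + t ^ 2)⁻¹) := by
  classical
  obtain ⟨C, hC0, hC⟩ := H.norm_zi_le
  obtain ⟨D, hD0, hD⟩ := exists_sum_gaussian_le
  set K1 := 2 * D * Real.exp 2 * (16 * √18) with hK1
  set K2 := 8 * C ^ 2 with hK2
  have hK10 : 0 ≤ K1 := by positivity
  have hK20 : 0 ≤ K2 := by positivity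
  refine ⟨K1 + K2, by positivity, fun σ t hσ hσ2 => ?_⟩
  obtain ⟨S, hS, hb⟩ := hC (pt σ t) (by simp [hσ]) (by simp; linarith)
  rw [pt_im] at hb
  have hnp : 0 < ‖pt σ t‖ ^ 2 := by rw [norm_pt_sq]; positivity
  have hcs : (∑ γ ∈ S, resAbs γ * Real.exp (1 - (γ - t) ^ 2) / ‖pt σ t - crit γ‖) ^ 2 ≤
      (∑ γ ∈ S, Real.exp (-(γ - t) ^ 2)) * ∑ γ ∈ S, resAbs γ ^ 2 *
        (Real.exp 2 * Real.exp (-(γ - t) ^ 2)) * (σ ^ 2 + (t - γ) ^ 2)⁻¹ := by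
    refine Finset.sum_sq_le_sum_mul_sum_of_sq_le_mul _ (fun _ _ => by positivity)
      (fun _ _ => by positivity) fun γ _ => ?_
    rw [div_pow, norm_pt_sub_crit_sq, mul_pow, ← Real.exp_nat_mul, div_eq_mul_inv]
    have : Real.exp (((2 : ℕ) : ℝ) * (1 - (γ - t) ^ 2)) =
        Real.exp (-(γ - t) ^ 2) * (Real.exp 2 * Real.exp (-(γ - t) ^ 2)) := by
      rw [← Real.exp_add, ← Real.exp_add]; congr 1; push_cast; ring
    rw [this]; exact le_of_eq (by ring)
  have hmain : sqF σ t ≤ K1 * ∑ γ ∈ S, wt γ * (σ ^ 2 + (t - γ) ^ 2)⁻¹ + K2 * (1 + t ^ 2)⁻¹ := by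
    have e1 : ‖zi (pt σ t)‖ ^ 2 ≤ 2 * (∑ γ ∈ S, resAbs γ * Real.exp (1 - (γ - t) ^ 2) /
        ‖pt σ t - crit γ‖) ^ 2 + 2 * C ^ 2 := by
      refine (pow_le_pow_left₀ (norm_nonneg _) hb 2).trans ?_
      nlinarith [sq_nonneg (∑ γ ∈ S, resAbs γ * Real.exp (1 - (γ - t) ^ 2) / ‖pt σ t - crit γ‖ - C)]
    unfold sqF
    rw [norm_div, div_pow, div_le_iff₀ hnp]
    refine e1.trans ?_
    rw [add_mul]
    refine add_le_add ?_ ?_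
    · refine (mul_le_mul_of_nonneg_left (hcs.trans (mul_le_mul_of_nonneg_right (hD t S hS)
        (Finset.sum_nonneg fun γ _ => by positivity))) two_pos.le).trans ?_
      rw [Finset.mul_sum, Finset.mul_sum, Finset.mul_sum, Finset.sum_mul]
      refine Finset.sum_le_sum fun γ _ => ?_
      have hw := weight_transfer hσ t γ
      rw [div_le_iff₀ hnp] at hw
      calc _ = 2 * D * Real.exp 2 * resAbs γ ^ 2 * (σ ^ 2 + (t - γ) ^ 2)⁻¹ *
            (√(|t| + 18) * Real.exp (-(γ - t) ^ 2)) := by ring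
        _ ≤ 2 * D * Real.exp 2 * resAbs γ ^ 2 * (σ ^ 2 + (t - γ) ^ 2)⁻¹ *
            (16 * √18 * (1 + |γ|) ^ (-(3 / 2) : ℝ) * ‖pt σ t‖ ^ 2) := by gcongr
        _ = _ := by rw [hK1, wt]; ring
    · have : (1 + t ^ 2) / 4 ≤ ‖pt σ t‖ ^ 2 := by
        rw [norm_pt_sq]; nlinarith
      rw [hK2, ← div_eq_mul_inv, div_mul_eq_mul_div, le_div_iff₀ (by positivity)]
      nlinarith [mul_le_mul_of_nonneg_left this (by positivity : 0 ≤ 8 * C ^ 2)]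
  refine (ENNReal.ofReal_le_ofReal hmain).trans ?_
  rw [ENNReal.ofReal_add (mul_nonneg hK10 (Finset.sum_nonneg fun γ _ =>
    mul_nonneg (wt_nonneg γ) (by positivity))) (by positivity), ENNReal.ofReal_mul hK10,
    ENNReal.ofReal_mul hK20, mul_add]
  refine add_le_add (mul_le_mul' (ENNReal.ofReal_le_ofReal (by linarith)) ?_)
    (mul_le_mul' (ENNReal.ofReal_le_ofReal (by linarith)) le_rfl)
  rw [ENNReal.ofReal_sum_of_nonneg fun γ _ => mul_nonneg (wt_nonneg γ) (by positivity)]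
  have : ∑ γ ∈ S, ENNReal.ofReal (wt γ * (σ ^ 2 + (t - γ) ^ 2)⁻¹) =
      ∑ γ ∈ S.subtype (· ∈ ordSet), ENNReal.ofReal (wt γ) *
        ENNReal.ofReal (σ ^ 2 + (t - γ) ^ 2)⁻¹ := by
    rw [Finset.sum_subtype_of_mem (fun γ => ENNReal.ofReal (wt γ) *
        ENNReal.ofReal (σ ^ 2 + (t - γ) ^ 2)⁻¹) hS]
    exact Finset.sum_congr rfl fun γ _ => ENNReal.ofReal_mul (wt_nonneg γ)
  rw [this]
  exact ENNReal.sum_le_tsum _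

lemma pt_ne_zero {σ : ℝ} (hσ : 0 < σ) (t : ℝ) : pt σ t ≠ 0 := by
  intro h; have := congrArg re h; simp at this; linarith

lemma SimpleRH.continuous_zi_pt (H : SimpleRH) {σ : ℝ} (hσ : 0 < σ) :
    Continuous fun t => zi (pt σ t) / pt σ t := by
  have hp : Continuous (pt σ) := by unfold pt; fun_prop
  refine Continuous.div ?_ hp (pt_ne_zero hσ)
  refine continuous_iff_continuousAt.mpr fun t => ?_
  have h1 : ContinuousAt zi (pt σ t) :=
    (differentiableAt_zi (by simp; linarith) (H.xi_ne_zero (by simp; linarith))).continuousAt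
  exact h1.comp hp.continuousAt

lemma SimpleRH.continuous_sqF (H : SimpleRH) {σ : ℝ} (hσ : 0 < σ) : Continuous (sqF σ) :=
  (H.continuous_zi_pt hσ).norm.pow 2

/-- The mean square contribution of the zero `1 / 2 + i γ`. -/
noncomputable def coef (γ : ℝ) : ℝ := (resAbs γ / ‖crit γ‖) ^ 2

lemma coef_nonneg (γ : ℝ) : 0 ≤ coef γ := sq_nonneg _

lemma norm_crit_sq (γ : ℝ) : ‖crit γ‖ ^ 2 = 1 / 4 + γ ^ 2 := by
  rw [← normSq_eq_norm_sq, normSq_apply]; simp; ring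

lemma coef_le (γ : ℝ) : coef γ ≤ 8 * wt γ := by
  have h0 := abs_nonneg γ
  unfold coef wt
  rw [div_pow, norm_crit_sq, div_le_iff₀ (by positivity)]
  have h1 : ((1 + |γ|) ^ 2)⁻¹ ≤ (1 + |γ|) ^ (-(3 / 2) : ℝ) := by
    rw [← Real.rpow_natCast, ← Real.rpow_neg (by positivity)]
    exact Real.rpow_le_rpow_of_exponent_le (by linarith) (by norm_num)
  have h2 : (1 + |γ|) ^ 2 ≤ 8 * (1 / 4 + γ ^ 2) := by
    rw [← sq_abs γ]; nlinarith [sq_nonneg (1 - |γ|)]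
  have h3 : 1 ≤ 8 * ((1 + |γ|) ^ (-(3 / 2) : ℝ)) * (1 / 4 + γ ^ 2) := by
    calc (1 : ℝ) = ((1 + |γ|) ^ 2)⁻¹ * (1 + |γ|) ^ 2 := by field_simp
      _ ≤ (1 + |γ|) ^ (-(3 / 2) : ℝ) * (8 * (1 / 4 + γ ^ 2)) := by gcongr
      _ = _ := by ring
  calc resAbs γ ^ 2 = resAbs γ ^ 2 * 1 := by ring
    _ ≤ resAbs γ ^ 2 * (8 * ((1 + |γ|) ^ (-(3 / 2) : ℝ)) * (1 / 4 + γ ^ 2)) := by gcongr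
    _ = _ := by ring

lemma pt_sub_crit (σ u γ : ℝ) : pt σ (γ + σ * u) - crit γ = σ * (1 + u * I) := by
  unfold pt crit; push_cast; ring

theorem SimpleRH.tendsto_local (H : SimpleRH) {γ : ℝ} (hγ : γ ∈ ordSet) :
    ∃ δ₀ > 0, ∀ δ, 0 < δ → δ ≤ δ₀ →
      Tendsto (fun σ => σ * ∫ t in (γ - δ)..(γ + δ), sqF σ t) (𝓝[>] 0) (𝓝 (Real.pi * coef γ)) := by
  have h1 : Tendsto (fun w => ‖(w - crit γ) * zi w / w‖ ^ 2) (𝓝[≠] (crit γ)) (𝓝 (coef γ)) := by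
    have h0 : ContinuousAt (fun w : ℂ => w) (crit γ) := continuousAt_id
    have := (((H.tendsto_zi hγ).div (h0.tendsto.mono_left nhdsWithin_le_nhds)
      (crit_ne_zero γ)).norm.pow 2)
    rw [norm_div, norm_inv] at this
    exact this
  have h2 : ∀ᶠ w in 𝓝[≠] (crit γ), ‖(w - crit γ) * zi w / w‖ ^ 2 < coef γ + 1 :=
    h1.eventually (gt_mem_nhds (by linarith))
  obtain ⟨r, hr0, hr⟩ := Metric.mem_nhdsWithin_iff.mp h2
  set B := coef γ + 1 with hB
  have hB0 : 0 < B := by have := coef_nonneg γ; linarith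
  have hid : ∀ σ u : ℝ, 0 < σ → σ ^ 2 * sqF σ (γ + σ * u) =
      ‖(pt σ (γ + σ * u) - crit γ) * zi (pt σ (γ + σ * u)) / pt σ (γ + σ * u)‖ ^ 2 *
        (1 + u ^ 2)⁻¹ := by
    intro σ u hσ
    have hn : ‖(1 + u * I : ℂ)‖ ^ 2 = 1 + u ^ 2 := by
      rw [← normSq_eq_norm_sq, normSq_apply]; simp; ring
    unfold sqF
    rw [pt_sub_crit, mul_div_assoc, norm_mul, norm_mul, mul_pow, mul_pow, hn, norm_real,
      Real.norm_eq_abs, sq_abs]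
    have : (1 + u ^ 2 : ℝ) ≠ 0 := by positivity
    field_simp
  refine ⟨r / 2, by positivity, fun δ hδ0 hδ => ?_⟩
  set F : ℝ → ℝ → ℝ := fun σ u => (Set.Ioc (-(δ / σ)) (δ / σ)).indicator
    (fun u => σ ^ 2 * sqF σ (γ + σ * u)) u with hF
  have hrew : ∀ σ : ℝ, 0 < σ → σ * ∫ t in (γ - δ)..(γ + δ), sqF σ t = ∫ u, F σ u := by
    intro σ hσ
    have := intervalIntegral.integral_comp_add_mul (a := -(δ / σ)) (b := δ / σ) (sqF σ) hσ.ne' γ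
    rw [show γ + σ * -(δ / σ) = γ - δ by field_simp; ring,
      show γ + σ * (δ / σ) = γ + δ by field_simp, smul_eq_mul] at this
    rw [hF]
    simp only
    rw [integral_indicator measurableSet_Ioc, ← intervalIntegral.integral_of_le
      (by have : 0 < δ / σ := by positivity
          linarith), intervalIntegral.integral_const_mul, this]
    field_simp
  have hpi : Real.pi * coef γ = ∫ u : ℝ, coef γ * (1 + u ^ 2)⁻¹ := by
    rw [integral_const_mul, integral_univ_inv_one_add_sq, mul_comm]
  have hsmall : ∀ᶠ σ : ℝ in 𝓝[>] 0, 0 < σ ∧ σ < r / 2 := by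
    filter_upwards [self_mem_nhdsWithin, nhdsWithin_le_nhds (gt_mem_nhds (half_pos hr0))]
      with σ h1 h2 using ⟨h1, h2⟩
  rw [hpi]
  refine Tendsto.congr' (f₁ := fun σ => ∫ u, F σ u) ?_ ?_
  · filter_upwards [self_mem_nhdsWithin] with σ hσ using (hrew σ hσ).symm
  refine tendsto_integral_filter_of_dominated_convergence (fun u => B * (1 + u ^ 2)⁻¹) ?_ ?_ ?_ ?_
  · filter_upwards [self_mem_nhdsWithin] with σ hσ
    have hc := H.continuous_sqF hσ
    have : Continuous fun u => σ ^ 2 * sqF σ (γ + σ * u) := by fun_prop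
    exact this.aestronglyMeasurable.indicator measurableSet_Ioc
  · filter_upwards [hsmall] with σ hσ
    refine Eventually.of_forall fun u => ?_
    rw [hF]
    simp only
    by_cases hu : u ∈ Set.Ioc (-(δ / σ)) (δ / σ)
    · rw [Set.indicator_of_mem hu, hid σ u hσ.1, Real.norm_of_nonneg (by positivity)]
      refine mul_le_mul_of_nonneg_right (le_of_lt ?_) (by positivity)
      refine hr ⟨?_, ?_⟩
      · rw [Metric.mem_ball, dist_eq_norm]
        have e : ‖pt σ (γ + σ * u) - crit γ‖ ≤ σ + δ := by
          rw [pt_sub_crit, norm_mul, norm_real, Real.norm_of_nonneg hσ.1.le]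
          have a1 : ‖(1 + u * I : ℂ)‖ ≤ 1 + |u| := by
            refine (norm_add_le _ _).trans ?_; simp
          have a2 : |u| ≤ δ / σ := abs_le.mpr ⟨hu.1.le, hu.2⟩
          calc _ ≤ σ * (1 + δ / σ) := by
                refine mul_le_mul_of_nonneg_left (by linarith) hσ.1.le
            _ = σ + δ := by have := hσ.1.ne'; field_simp
        linarith
      · intro h
        have := congrArg re h
        simp at this; linarith
    · rw [Set.indicator_of_notMem hu, norm_zero]; positivity
  · exact integrable_inv_one_add_sq.const_mul _
  · refine Eventually.of_forall fun u => ?_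
    have hin : ∀ᶠ σ : ℝ in 𝓝[>] 0, u ∈ Set.Ioc (-(δ / σ)) (δ / σ) := by
      have : ∀ᶠ σ : ℝ in 𝓝[>] 0, σ < δ / (|u| + 1) :=
        nhdsWithin_le_nhds (gt_mem_nhds (by positivity))
      filter_upwards [this, self_mem_nhdsWithin] with σ h1 h2
      have h2' : 0 < σ := h2
      have : |u| < δ / σ := by
        rw [lt_div_iff₀ (by positivity)] at h1 ⊢
        nlinarith [abs_nonneg u]
      obtain ⟨b1, b2⟩ := abs_lt.mp this
      exact ⟨b1, b2.le⟩
    have hto : Tendsto (fun σ : ℝ => pt σ (γ + σ * u)) (𝓝[>] 0) (𝓝[≠] (crit γ)) := by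
      refine tendsto_nhdsWithin_iff.mpr ⟨?_, ?_⟩
      · have : Continuous fun σ : ℝ => pt σ (γ + σ * u) := by unfold pt; fun_prop
        have h := this.tendsto 0
        have e : pt 0 (γ + 0 * u) = crit γ := by simp [pt, crit]
        rw [e] at h
        exact h.mono_left nhdsWithin_le_nhds
      · filter_upwards [self_mem_nhdsWithin] with σ hσ h
        have := congrArg re h
        simp at this
        exact absurd this (ne_of_gt hσ)
    refine ((h1.comp hto).mul_const (1 + u ^ 2)⁻¹).congr' ?_
    filter_upwards [hin, self_mem_nhdsWithin] with σ h1 h2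
    rw [hF]
    simp only
    rw [Set.indicator_of_mem h1, hid σ u h2]
    rfl

lemma lintegral_inv_one_add_sq_sub (γ : ℝ) :
    ∫⁻ t : ℝ, ENNReal.ofReal (1 + (t - γ) ^ 2)⁻¹ = ENNReal.ofReal Real.pi := by
  rw [lintegral_sub_right_eq_self (fun t : ℝ => ENNReal.ofReal (1 + t ^ 2)⁻¹) γ,
    ← integral_univ_inv_one_add_sq,
    ofReal_integral_eq_lintegral_ofReal integrable_inv_one_add_sq
      (Eventually.of_forall fun t => by positivity)]

lemma lintegral_inv_sq_add_sq_sub {σ : ℝ} (hσ : 0 < σ) (γ : ℝ) :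
    ∫⁻ t : ℝ, ENNReal.ofReal (σ ^ 2 + (t - γ) ^ 2)⁻¹ = ENNReal.ofReal (Real.pi / σ) := by
  rw [lintegral_sub_right_eq_self (fun t : ℝ => ENNReal.ofReal (σ ^ 2 + t ^ 2)⁻¹) γ]
  have h : ∀ t : ℝ, (σ ^ 2 + t ^ 2)⁻¹ = (σ ^ 2)⁻¹ * (1 + (t / σ) ^ 2)⁻¹ := by
    intro t
    rw [← mul_inv]; congr 1; field_simp
  have hi : Integrable fun t : ℝ => (σ ^ 2)⁻¹ * (1 + (t / σ) ^ 2)⁻¹ :=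
    (integrable_inv_one_add_sq.comp_div hσ.ne').const_mul _
  simp_rw [h]
  rw [← ofReal_integral_eq_lintegral_ofReal hi (Eventually.of_forall fun t => by positivity),
    integral_const_mul, Measure.integral_comp_div (fun t : ℝ => (1 + t ^ 2)⁻¹) σ,
    integral_univ_inv_one_add_sq, abs_of_pos hσ, smul_eq_mul]
  congr 1
  field_simp

theorem SimpleRH.lintegral_sqF_compl_le (H : SimpleRH) : ∃ K, 0 ≤ K ∧ ∀ (S : Finset ordSet)
    (δ : ℝ), 0 < δ → ∀ σ, 0 < σ → σ ≤ 1 / 2 → ∀ U : Set ℝ, MeasurableSet U →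
    (∀ γ ∈ S, ∀ t ∈ U, δ ≤ |t - γ|) →
    ∫⁻ t in U, ENNReal.ofReal (sqF σ t) ≤ ENNReal.ofReal K *
      ((∑' γ : ordSet, ENNReal.ofReal (wt γ)) * ENNReal.ofReal ((1 + (δ ^ 2)⁻¹) * Real.pi) +
       (∑' γ : {γ : ordSet // γ ∉ S}, ENNReal.ofReal (wt γ)) * ENNReal.ofReal (Real.pi / σ) +
       ENNReal.ofReal Real.pi) := by
  classical
  obtain ⟨K, hK0, hK⟩ := H.sqF_le
  refine ⟨K, hK0, fun S δ hδ σ hσ hσ2 U hU hUS => ?_⟩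
  have hm : ∀ γ : ordSet, Measurable fun t : ℝ => ENNReal.ofReal (wt γ) *
      ENNReal.ofReal (σ ^ 2 + (t - γ) ^ 2)⁻¹ := by intro γ; fun_prop
  refine (lintegral_mono fun t => hK σ t hσ hσ2).trans ?_
  rw [lintegral_const_mul' _ _ ENNReal.ofReal_ne_top]
  refine mul_le_mul_right ?_ _
  rw [lintegral_add_right _ (by fun_prop)]
  refine add_le_add ?_ ?_
  swap
  · have := lintegral_inv_one_add_sq_sub 0
    simp only [sub_zero] at this
    exact (setLIntegral_le_lintegral _ _).trans this.le
  rw [lintegral_tsum fun γ => (hm γ).aemeasurable]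
  have hout : ∑' γ : {γ : ordSet // γ ∉ S}, ENNReal.ofReal (wt γ) =
      ∑' γ : ordSet, if γ ∈ S then 0 else ENNReal.ofReal (wt γ) := by
    have := tsum_subtype {γ : ordSet | γ ∉ S} (fun γ => ENNReal.ofReal (wt γ))
    refine this.trans (tsum_congr fun γ => ?_)
    by_cases h : γ ∈ S
    · rw [if_pos h, Set.indicator_of_notMem]; simpa using h
    · rw [if_neg h, Set.indicator_of_mem]; simpa using h
  rw [hout, ← ENNReal.tsum_mul_right, ← ENNReal.tsum_mul_right, ← ENNReal.tsum_add]
  refine ENNReal.tsum_le_tsum fun γ => ?_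
  rw [lintegral_const_mul' _ _ ENNReal.ofReal_ne_top]
  by_cases h : γ ∈ S
  · refine le_trans ?_ le_self_add
    refine mul_le_mul_right ?_ _
    rw [ENNReal.ofReal_mul (by positivity), ← lintegral_inv_one_add_sq_sub γ,
      ← lintegral_const_mul' _ _ ENNReal.ofReal_ne_top]
    refine le_trans (setLIntegral_mono' hU fun t ht => ?_) (setLIntegral_le_lintegral U _)
    rw [← ENNReal.ofReal_mul (by positivity)]
    refine ENNReal.ofReal_le_ofReal ?_
    have h1 := pow_le_pow_left₀ hδ.le (hUS γ h t ht) 2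
    rw [sq_abs] at h1
    have hδ2 : 0 < δ ^ 2 := by positivity
    rw [inv_eq_one_div, ← div_eq_mul_inv, div_le_div_iff₀ (by positivity) (by positivity), one_mul]
    have h2 : 1 ≤ (δ ^ 2)⁻¹ * (t - γ) ^ 2 := by
      rw [inv_mul_eq_div, le_div_iff₀ hδ2]; linarith
    nlinarith [sq_nonneg σ, mul_nonneg (inv_nonneg.mpr hδ2.le) (sq_nonneg σ)]
  · rw [if_neg h]
    refine le_trans ?_ le_add_self
    refine mul_le_mul_right ?_ _
    rw [← lintegral_inv_sq_add_sq_sub hσ γ]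
    exact setLIntegral_le_lintegral U _

lemma SimpleRH.integrable_sqF (H : SimpleRH) (hw : ∑' γ : ordSet, ENNReal.ofReal (wt γ) ≠ ⊤)
    {σ : ℝ} (hσ : 0 < σ) (hσ2 : σ ≤ 1 / 2) : Integrable (sqF σ) := by
  obtain ⟨K, hK0, hK⟩ := H.lintegral_sqF_compl_le
  refine ⟨(H.continuous_sqF hσ).aestronglyMeasurable, ?_⟩
  rw [hasFiniteIntegral_iff_ofReal (Eventually.of_forall fun t => sqF_nonneg σ t)]
  have := hK ∅ 1 one_pos σ hσ hσ2 Set.univ MeasurableSet.univ (by simp)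
  rw [Measure.restrict_univ] at this
  refine this.trans_lt ?_
  refine ENNReal.mul_lt_top ENNReal.ofReal_lt_top (ENNReal.add_lt_top.mpr
    ⟨ENNReal.add_lt_top.mpr ⟨ENNReal.mul_lt_top hw.lt_top ENNReal.ofReal_lt_top,
    ENNReal.mul_lt_top ?_ ENNReal.ofReal_lt_top⟩, ENNReal.ofReal_lt_top⟩)
  refine lt_of_le_of_lt ?_ hw.lt_top
  exact ENNReal.tsum_comp_le_tsum_of_injective Subtype.val_injective _

lemma summable_coef (hw : ∑' γ : ordSet, ENNReal.ofReal (wt γ) ≠ ⊤) :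
    Summable fun γ : ordSet => coef γ := by
  have h1 : Summable fun γ : ordSet => wt γ :=
    (ENNReal.summable_toReal hw).congr fun γ => ENNReal.toReal_ofReal (wt_nonneg γ)
  exact Summable.of_nonneg_of_le (fun γ => coef_nonneg γ) (fun γ => coef_le γ) (h1.mul_left 8)

theorem SimpleRH.tendsto_integral_sqF (H : SimpleRH)
    (hw : ∑' γ : ordSet, ENNReal.ofReal (wt γ) ≠ ⊤) :
    Tendsto (fun σ => σ * ∫ t, sqF σ t) (𝓝[>] 0) (𝓝 (Real.pi * ∑' γ : ordSet, coef γ)) := by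
  classical
  obtain ⟨K, hK0, hK⟩ := H.lintegral_sqF_compl_le
  have hpi := Real.pi_pos
  rw [Metric.tendsto_nhds]
  intro ε' hε'
  set ε := ε' / (1 + Real.pi + K * (1 + Real.pi) + 1) with hε
  have hε0 : 0 < ε := by positivity
  have a1 : ∀ᶠ S : Finset ordSet in atTop,
      ∑' γ : {γ : ordSet // γ ∉ S}, ENNReal.ofReal (wt γ) < ENNReal.ofReal ε :=
    (ENNReal.tendsto_tsum_compl_atTop_zero hw).eventually
      (gt_mem_nhds (ENNReal.ofReal_pos.mpr hε0))
  have a2 : ∀ᶠ S : Finset ordSet in atTop, |∑ γ ∈ S, coef γ - ∑' γ : ordSet, coef γ| < ε :=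
    (Metric.tendsto_nhds.mp (summable_coef hw).hasSum ε hε0)
  obtain ⟨S, hS1, hS2⟩ := (a1.and a2).exists
  have hloc : ∀ γ : ordSet, ∃ δ₀ > 0, ∀ δ, 0 < δ → δ ≤ δ₀ →
      Tendsto (fun σ => σ * ∫ t in (γ - δ : ℝ)..(γ + δ), sqF σ t) (𝓝[>] 0)
        (𝓝 (Real.pi * coef γ)) := fun γ => H.tendsto_local γ.2
  choose δ₀ hδ₀ hloc using hloc
  have b1 : ∀ᶠ δ : ℝ in 𝓝[>] 0, ∀ γ ∈ S, δ < δ₀ γ :=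
    (Filter.eventually_all_finset S).mpr fun γ _ => nhdsWithin_le_nhds (gt_mem_nhds (hδ₀ γ))
  have b2 : ∀ᶠ δ : ℝ in 𝓝[>] 0, ∀ γ ∈ S, ∀ γ' ∈ S, γ ≠ γ' → δ < |(γ : ℝ) - γ'| / 2 := by
    refine (Filter.eventually_all_finset S).mpr fun γ _ =>
      (Filter.eventually_all_finset S).mpr fun γ' _ => ?_
    by_cases h : γ = γ'
    · exact Eventually.of_forall fun _ h' => absurd h h'
    · have : (γ : ℝ) - γ' ≠ 0 := fun h' => h (Subtype.ext (sub_eq_zero.mp h'))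
      filter_upwards [nhdsWithin_le_nhds (gt_mem_nhds (by positivity : 0 < |(γ : ℝ) - γ'| / 2))]
        with δ hδ _ using hδ
  obtain ⟨δ, ⟨hδ1, hδ2⟩, hδ0⟩ := ((b1.and b2).and self_mem_nhdsWithin).exists
  have hδ0 : 0 < δ := hδ0
  set V : Set ℝ := ⋃ γ ∈ S, Set.Ioc ((γ : ℝ) - δ) (γ + δ) with hV
  have hVm : MeasurableSet V := Finset.measurableSet_biUnion S fun _ _ => measurableSet_Ioc
  have c1 : Tendsto (fun σ => ∑ γ ∈ S, σ * ∫ t in (γ - δ : ℝ)..(γ + δ), sqF σ t) (𝓝[>] 0)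
      (𝓝 (∑ γ ∈ S, Real.pi * coef γ)) :=
    tendsto_finsetSum _ fun γ hγ => hloc γ δ hδ0 (hδ1 γ hγ).le
  have c2 := Metric.tendsto_nhds.mp c1 ε hε0
  set W0 := (∑' γ : ordSet, ENNReal.ofReal (wt γ)).toReal with hW0
  have hW00 : 0 ≤ W0 := ENNReal.toReal_nonneg
  set B := W0 * ((1 + (δ ^ 2)⁻¹) * Real.pi) + Real.pi with hB
  have hB0 : 0 < B := by positivity
  have c3 : ∀ᶠ σ : ℝ in 𝓝[>] 0, σ < ε / B := nhdsWithin_le_nhds (gt_mem_nhds (by positivity))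
  have c4 : ∀ᶠ σ : ℝ in 𝓝[>] 0, σ < 1 / 2 := nhdsWithin_le_nhds (gt_mem_nhds (by positivity))
  filter_upwards [c2, c3, c4, self_mem_nhdsWithin] with σ d2 d3 d4 hσ
  have hσ : 0 < σ := hσ
  have hint := H.integrable_sqF hw hσ d4.le
  have e1 : ∫ t in V, sqF σ t = ∑ γ ∈ S, ∫ t in (γ - δ : ℝ)..(γ + δ), sqF σ t := by
    rw [hV, integral_biUnion_finset S (fun _ _ => measurableSet_Ioc) ?_
      (fun _ _ => hint.integrableOn)]
    · refine Finset.sum_congr rfl fun γ _ => ?_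
      rw [intervalIntegral.integral_of_le (by linarith)]
    · intro γ hγ γ' hγ' hne
      rw [Function.onFun, Set.disjoint_left]
      rintro x ⟨x1, x2⟩ ⟨x3, x4⟩
      have := hδ2 γ hγ γ' hγ' hne
      rcases abs_cases ((γ : ℝ) - γ') with h | h <;> linarith
  have e2 := integral_add_compl hVm hint
  have e3 : ∫ t in Vᶜ, sqF σ t ≤ K * (W0 * ((1 + (δ ^ 2)⁻¹) * Real.pi) + ε * (Real.pi / σ) +
      Real.pi) := by
    rw [integral_eq_lintegral_of_nonneg_ae (Eventually.of_forall fun t => sqF_nonneg σ t)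
      hint.aestronglyMeasurable.restrict]
    refine ENNReal.toReal_le_of_le_ofReal (by positivity) ?_
    refine (hK S δ hδ0 σ hσ d4.le Vᶜ hVm.compl ?_).trans ?_
    · intro γ hγ t ht
      by_contra! h
      apply ht
      obtain ⟨h1, h2⟩ := abs_lt.mp h
      exact Set.mem_biUnion (show γ ∈ (S : Set ordSet) from hγ) ⟨by linarith, by linarith⟩
    · rw [ENNReal.ofReal_mul hK0, ENNReal.ofReal_add (by positivity) (by positivity),
        ENNReal.ofReal_add (by positivity) (by positivity), ENNReal.ofReal_mul hW00,
        ENNReal.ofReal_mul hε0.le, ENNReal.ofReal_toReal hw]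
      gcongr
  have e4 : 0 ≤ ∫ t in Vᶜ, sqF σ t := integral_nonneg fun t => sqF_nonneg σ t
  have e5 : σ * ∫ t in Vᶜ, sqF σ t ≤ K * (ε * (1 + Real.pi)) := by
    calc _ ≤ σ * (K * (W0 * ((1 + (δ ^ 2)⁻¹) * Real.pi) + ε * (Real.pi / σ) + Real.pi)) := by
          gcongr
      _ = K * (σ * B + ε * Real.pi) := by rw [hB]; field_simp; ring
      _ ≤ K * (ε * (1 + Real.pi)) := by
          rw [lt_div_iff₀ hB0] at d3
          gcongr; linarith
  have e6 : 0 ≤ σ * ∫ t in Vᶜ, sqF σ t := by positivity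
  rw [Real.dist_eq] at d2 ⊢
  rw [← Finset.mul_sum, ← Finset.mul_sum, ← e1] at d2
  rw [← e2]
  have e7 : |Real.pi * ∑ γ ∈ S, coef γ - Real.pi * ∑' γ : ordSet, coef γ| ≤ Real.pi * ε := by
    rw [← mul_sub, abs_mul, abs_of_pos hpi]; gcongr
  have e8 : ε * (1 + Real.pi + K * (1 + Real.pi) + 1) = ε' := by
    rw [hε]; field_simp
  have f1 := abs_lt.mp d2
  have f2 := abs_le.mp e7
  rw [abs_lt]
  constructor <;> nlinarith

open scoped FourierTransform in
lemma integral_norm_sq_fourier {h : ℝ → ℂ} (hc : Continuous h) (hi : Integrable h)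
    (hi' : Integrable (𝓕 h)) : ∫ x, ‖𝓕 h x‖ ^ 2 = ∫ x, ‖h x‖ ^ 2 := by
  have h0 : ∀ M : ℂ →L⋆[ℂ] ℂ →L[ℂ] ℂ,
      ∫ ξ, M (𝓕 h ξ) (𝓕 h ξ) = ∫ x, M (h x) (𝓕⁻ (𝓕 h) x) := by
    intro M
    simpa using! VectorFourier.integral_sesq_fourierIntegral_eq_neg_flip M
      (L := innerₗ ℝ) Real.continuous_fourierChar continuous_inner hi hi'
  have h1 := h0 (innerSL ℂ)
  rw [hc.fourierInv_fourier_eq hi hi'] at h1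
  simp only [innerSL_apply_apply, inner_self_eq_norm_sq_to_K] at h1
  have h2 : ∀ f : ℝ → ℂ, ∫ x, ((‖f x‖ : ℝ) : ℂ) ^ 2 = ((∫ x, ‖f x‖ ^ 2 : ℝ) : ℂ) := by
    intro f
    rw [← integral_complex_ofReal]
    push_cast
    rfl
  have h3 := (h2 (𝓕 h)).symm.trans (h1.trans (h2 h))
  exact_mod_cast h3

open scoped FourierTransform in
/-- Plancherel's identity for a continuous integrable function with integrable transform, in the
normalization without `2π` in the exponent. -/
lemma integral_norm_sq_transform {h : ℝ → ℂ} (hc : Continuous h) (hi : Integrable h)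
    (hE : Integrable fun y : ℝ => ∫ t : ℝ, h t * exp (y * t * I)) :
    ∫ y : ℝ, ‖∫ t : ℝ, h t * exp (y * t * I)‖ ^ 2 = 2 * Real.pi * ∫ t, ‖h t‖ ^ 2 := by
  have hpi := Real.pi_pos
  set c : ℝ := -(2 * Real.pi) with hcdef
  have hc0 : c ≠ 0 := by rw [hcdef]; exact neg_ne_zero.mpr (by positivity)
  have hF : 𝓕 h = fun w : ℝ => (fun y : ℝ => ∫ t : ℝ, h t * exp (y * t * I)) (c * w) := by
    ext w
    rw [Real.fourier_eq']
    refine integral_congr_ae (Eventually.of_forall fun t => ?_)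
    simp only [smul_eq_mul]
    rw [mul_comm]
    congr 2
    simp only [hcdef, RCLike.inner_apply, conj_trivial]
    push_cast
    ring
  have h1 : Integrable (𝓕 h) := by
    rw [hF]; exact hE.comp_mul_left' hc0
  have h2 := integral_norm_sq_fourier hc hi h1
  rw [hF] at h2
  rw [Measure.integral_comp_mul_left (fun y : ℝ => ‖∫ t : ℝ, h t * exp (y * t * I)‖ ^ 2) c,
    smul_eq_mul] at h2
  rw [← h2, abs_inv, hcdef, abs_neg, abs_of_pos (by positivity), ← mul_assoc,
    mul_inv_cancel₀ (by positivity), one_mul]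

/-- The summatory function of the Möbius function on a logarithmic scale. -/
noncomputable def mexp (y : ℝ) : ℝ := Mfun (Real.exp y)

lemma abs_Mfun_le {x : ℝ} (hx : 0 ≤ x) : |Mfun x| ≤ x := by
  unfold Mfun
  refine (Finset.abs_sum_le_sum_abs _ _).trans ?_
  have h : ∀ n ∈ Finset.Icc 1 ⌊x⌋₊, |((ArithmeticFunction.moebius n : ℤ) : ℝ)| ≤ 1 := by
    intro n _
    have := ArithmeticFunction.abs_moebius_le_one (n := n)
    exact_mod_cast this
  refine (Finset.sum_le_card_nsmul _ _ _ h).trans ?_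
  simpa using Nat.floor_le hx

lemma abs_mexp_le (y : ℝ) : |mexp y| ≤ Real.exp y := abs_Mfun_le (Real.exp_pos y).le

lemma mexp_of_neg {y : ℝ} (hy : y < 0) : mexp y = 0 := by
  unfold mexp Mfun
  rw [Nat.floor_eq_zero.mpr (Real.exp_lt_one_iff.mpr hy)]
  simp

lemma measurable_mexp : Measurable mexp := by
  have : mexp = (fun n : ℕ => ∑ k ∈ Finset.Icc 1 n, ((ArithmeticFunction.moebius k : ℤ) : ℝ)) ∘
      fun y => ⌊Real.exp y⌋₊ := rfl
  rw [this]
  exact (measurable_from_nat).comp (Nat.measurable_floor.comp Real.measurable_exp)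

lemma integral_mexp {s : ℂ} (hs : 1 < s.re) :
    ∫ u : ℝ, (mexp u : ℂ) * exp (-s * u) = (riemannZeta s)⁻¹ / s := by
  have hs0 : s ≠ 0 := by rintro rfl; simp at hs; linarith
  have h0 := LSeries_eq_mul_integral (fun n => ((ArithmeticFunction.moebius n : ℤ) : ℂ))
    (r := 1) zero_le_one hs
    (ArithmeticFunction.LSeriesSummable_moebius_iff.mpr hs) (by
      refine Asymptotics.IsBigO.of_bound 1 (Eventually.of_forall fun n => ?_)
      have h1 : ‖∑ k ∈ Finset.Icc 1 n, ((ArithmeticFunction.moebius k : ℤ) : ℂ)‖ = |Mfun n| := by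
        unfold Mfun
        rw [Nat.floor_natCast, ← Real.norm_eq_abs, ← norm_real]
        push_cast
        rfl
      rw [h1, Real.rpow_one, one_mul, Real.norm_eq_abs, Nat.abs_cast]
      exact abs_Mfun_le (Nat.cast_nonneg n))
  have h1 := ArithmeticFunction.LSeries_zeta_mul_Lseries_moebius hs
  rw [ArithmeticFunction.LSeries_zeta_eq_riemannZeta hs] at h1
  have h2 : LSeries (fun n => ((ArithmeticFunction.moebius n : ℤ) : ℂ)) s = (riemannZeta s)⁻¹ :=
    eq_inv_of_mul_eq_one_right h1
  rw [← h2, h0, mul_div_cancel_left₀ _ hs0]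
  have h3 := integral_comp_exp_Ioi (fun t : ℝ =>
    (∑ k ∈ Finset.Icc 1 ⌊t⌋₊, ((ArithmeticFunction.moebius k : ℤ) : ℂ)) * (t : ℂ) ^ (-(s + 1))) 0
  rw [Real.exp_zero] at h3
  rw [← h3, ← integral_indicator measurableSet_Ioi]
  refine integral_congr_ae ?_
  filter_upwards [compl_mem_ae_iff.mpr (measure_singleton (0 : ℝ))] with u hu
  rcases lt_or_gt_of_ne (show u ≠ 0 from hu) with h | h
  · rw [Set.indicator_of_notMem (by simpa using h.le), mexp_of_neg h]; simp
  · rw [Set.indicator_of_mem (show u ∈ Set.Ioi 0 from h)]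
    have e1 : (mexp u : ℂ) =
        ∑ k ∈ Finset.Icc 1 ⌊Real.exp u⌋₊, ((ArithmeticFunction.moebius k : ℤ) : ℂ) := by
      unfold mexp Mfun; push_cast; rfl
    have e2 : ((Real.exp u : ℝ) : ℂ) ^ (-(s + 1)) = exp (-s * u) * exp (-u) := by
      rw [cpow_def_of_ne_zero (by exact_mod_cast (Real.exp_pos u).ne'), ← ofReal_log
        (Real.exp_pos u).le, Real.log_exp, ← exp_add]
      congr 1; ring
    rw [e1, e2, real_smul, ofReal_exp]
    have e3 : exp (u : ℂ) * exp (-u : ℂ) = 1 := by rw [← exp_add]; simp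
    calc _ = (∑ k ∈ Finset.Icc 1 ⌊Real.exp u⌋₊, ((ArithmeticFunction.moebius k : ℤ) : ℂ)) *
          exp (-s * u) * (exp (u : ℂ) * exp (-u : ℂ)) := by rw [e3, mul_one]
      _ = _ := by ring

/-- The Laplace-type averages `s ∫ g(y) e^{-sy} φ(e^{-sy}) dy` used in Karamata's argument. -/
noncomputable def karamataMean (g φ : ℝ → ℝ) (s : ℝ) : ℝ :=
  s * ∫ y in Set.Ioi (0 : ℝ), g y * Real.exp (-s * y) * φ (Real.exp (-s * y))

section Karamata

variable {g : ℝ → ℝ} (hint : ∀ s ∈ Set.Ioo (0 : ℝ) 1,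
  IntegrableOn (fun y => g y * Real.exp (-s * y)) (Set.Ioi 0))

include hint

lemma integrableOn_karamata {φ : ℝ → ℝ} (hφ : Continuous φ) {s : ℝ} (hs : s ∈ Set.Ioo (0 : ℝ) 1) :
    IntegrableOn (fun y => g y * Real.exp (-s * y) * φ (Real.exp (-s * y))) (Set.Ioi 0) := by
  obtain ⟨K, hK⟩ := isCompact_Icc.exists_bound_of_continuousOn
    (s := Set.Icc (0 : ℝ) 1) hφ.continuousOn
  refine (hint s hs).mul_bdd (c := K) (by fun_prop) ?_
  refine (ae_restrict_iff' measurableSet_Ioi).mpr (Eventually.of_forall fun y hy => ?_)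
  refine hK _ ⟨(Real.exp_pos _).le, Real.exp_le_one_iff.mpr ?_⟩
  have : (0 : ℝ) < y := hy
  nlinarith [hs.1]

lemma tendsto_karamataMean_polynomial {L : ℝ} (hL : Tendsto
    (fun s => s * ∫ y in Set.Ioi (0 : ℝ), g y * Real.exp (-s * y)) (𝓝[>] 0) (𝓝 L))
    (p : Polynomial ℝ) :
    Tendsto (karamataMean g (fun x => p.eval x)) (𝓝[>] 0)
      (𝓝 (L * ∫ x in (0 : ℝ)..1, p.eval x)) := by
  have hev : ∀ᶠ s : ℝ in 𝓝[>] 0, s ∈ Set.Ioo (0 : ℝ) 1 := Ioo_mem_nhdsGT one_pos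
  induction p using Polynomial.induction_on' with
  | add p q hp hq =>
    have h1 : (∫ x in (0 : ℝ)..1, (p + q).eval x) =
        (∫ x in (0 : ℝ)..1, p.eval x) + ∫ x in (0 : ℝ)..1, q.eval x := by
      simp only [Polynomial.eval_add]
      exact intervalIntegral.integral_add (p.continuous.intervalIntegrable _ _)
        (q.continuous.intervalIntegrable _ _)
    rw [h1, mul_add]
    refine (hp.add hq).congr' ?_
    filter_upwards [hev] with s hs
    unfold karamataMean
    rw [← mul_add, ← integral_add (integrableOn_karamata hint p.continuous hs)
      (integrableOn_karamata hint q.continuous hs)]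
    simp only [Polynomial.eval_add, mul_add]
  | monomial k c =>
    have hk : (0 : ℝ) < (k : ℝ) + 1 := by positivity
    have h1 : Tendsto (fun s : ℝ => ((k : ℝ) + 1) * s) (𝓝[>] 0) (𝓝[>] 0) := by
      refine tendsto_nhdsWithin_iff.mpr ⟨?_, ?_⟩
      · have : Tendsto (fun s : ℝ => ((k : ℝ) + 1) * s) (𝓝 0) (𝓝 (((k : ℝ) + 1) * 0)) :=
          (continuous_const.mul continuous_id).tendsto 0
        rw [mul_zero] at this
        exact this.mono_left nhdsWithin_le_nhds
      · filter_upwards [self_mem_nhdsWithin] with s hs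
        exact mul_pos hk hs
    have h2 := (hL.comp h1).const_mul (c / (k + 1))
    have h3 : L * (∫ x in (0 : ℝ)..1, (Polynomial.monomial k c).eval x) = c / (k + 1) * L := by
      simp only [Polynomial.eval_monomial]
      rw [intervalIntegral.integral_const_mul, integral_pow]
      simp; ring
    rw [h3]
    refine h2.congr fun s => ?_
    unfold karamataMean
    simp only [Function.comp, Polynomial.eval_monomial]
    have h4 : ∀ y : ℝ, g y * Real.exp (-s * y) * (c * Real.exp (-s * y) ^ k) =
        c * (g y * Real.exp (-((k + 1) * s) * y)) := by
      intro y
      rw [← Real.exp_nat_mul]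
      have : Real.exp (-((k + 1) * s) * y) = Real.exp (-s * y) * Real.exp (k * (-s * y)) := by
        rw [← Real.exp_add]; congr 1; ring
      rw [this]; ring
    simp only [h4]
    rw [integral_const_mul]
    field_simp

variable (hg : ∀ y, 0 ≤ g y)
include hg

lemma karamataMean_mono {φ ψ : ℝ → ℝ} (hφ : Continuous φ) (hψ : Continuous ψ)
    (h : ∀ x ∈ Set.Icc (0 : ℝ) 1, φ x ≤ ψ x) {s : ℝ} (hs : s ∈ Set.Ioo (0 : ℝ) 1) :
    karamataMean g φ s ≤ karamataMean g ψ s := by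
  refine mul_le_mul_of_nonneg_left ?_ hs.1.le
  refine setIntegral_mono_on (integrableOn_karamata hint hφ hs) (integrableOn_karamata hint hψ hs)
    measurableSet_Ioi fun y hy => ?_
  refine mul_le_mul_of_nonneg_left (h _ ⟨(Real.exp_pos _).le, Real.exp_le_one_iff.mpr ?_⟩)
    (mul_nonneg (hg y) (Real.exp_pos _).le)
  have : (0 : ℝ) < y := hy
  nlinarith [hs.1]

lemma tendsto_karamataMean {L : ℝ} (hL : Tendsto
    (fun s => s * ∫ y in Set.Ioi (0 : ℝ), g y * Real.exp (-s * y)) (𝓝[>] 0) (𝓝 L))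
    {φ : ℝ → ℝ} (hφ : Continuous φ) :
    Tendsto (karamataMean g φ) (𝓝[>] 0) (𝓝 (L * ∫ x in (0 : ℝ)..1, φ x)) := by
  have hev : ∀ᶠ s : ℝ in 𝓝[>] 0, s ∈ Set.Ioo (0 : ℝ) 1 := Ioo_mem_nhdsGT one_pos
  have hL0 : 0 ≤ L := by
    refine ge_of_tendsto hL ?_
    filter_upwards [hev] with s hs
    exact mul_nonneg hs.1.le (integral_nonneg fun y => mul_nonneg (hg y) (Real.exp_pos _).le)
  rw [Metric.tendsto_nhds]
  intro ε hε
  set η : ℝ := ε / (4 * (L + 1)) with hη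
  have hη0 : 0 < η := by positivity
  have hηL : L * η ≤ ε / 4 := by
    rw [hη, ← mul_div_assoc, div_le_div_iff₀ (by positivity) (by norm_num)]
    nlinarith
  obtain ⟨p, hp⟩ := exists_polynomial_near_of_continuousOn 0 1 φ hφ.continuousOn η hη0
  have hup := tendsto_karamataMean_polynomial hint hL (p + Polynomial.C η)
  have hlo := tendsto_karamataMean_polynomial hint hL (p - Polynomial.C η)
  have hpi : IntervalIntegrable (fun x => p.eval x) volume 0 1 := p.continuous.intervalIntegrable _ _
  have e1 : (∫ x in (0 : ℝ)..1, (p + Polynomial.C η).eval x) =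
      (∫ x in (0 : ℝ)..1, p.eval x) + η := by
    simp only [Polynomial.eval_add, Polynomial.eval_C]
    rw [intervalIntegral.integral_add hpi intervalIntegrable_const]; simp
  have e2 : (∫ x in (0 : ℝ)..1, (p - Polynomial.C η).eval x) =
      (∫ x in (0 : ℝ)..1, p.eval x) - η := by
    simp only [Polynomial.eval_sub, Polynomial.eval_C]
    rw [intervalIntegral.integral_sub hpi intervalIntegrable_const]; simp
  have e3 : |(∫ x in (0 : ℝ)..1, p.eval x) - ∫ x in (0 : ℝ)..1, φ x| ≤ η := by
    rw [← intervalIntegral.integral_sub hpi (hφ.intervalIntegrable _ _)]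
    have := intervalIntegral.norm_integral_le_of_norm_le_const (a := (0 : ℝ)) (b := 1) (C := η)
      (f := fun x => p.eval x - φ x) (fun x hx => by
        rw [Set.uIoc_of_le zero_le_one] at hx
        exact (hp x ⟨hx.1.le, hx.2⟩).le)
    simpa using this
  rw [abs_le] at e3
  rw [e1] at hup
  rw [e2] at hlo
  have i1 := (Metric.tendsto_nhds.mp hup) (ε / 4) (by positivity)
  have i2 := (Metric.tendsto_nhds.mp hlo) (ε / 4) (by positivity)
  filter_upwards [hev, i1, i2] with s hs j1 j2
  have k1 : karamataMean g φ s ≤ karamataMean g (fun x => (p + Polynomial.C η).eval x) s := by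
    refine karamataMean_mono hint hg hφ (Polynomial.continuous _) (fun x hx => ?_) hs
    have := (abs_lt.mp (hp x hx)).1
    simp; linarith
  have k2 : karamataMean g (fun x => (p - Polynomial.C η).eval x) s ≤ karamataMean g φ s := by
    refine karamataMean_mono hint hg (Polynomial.continuous _) hφ (fun x hx => ?_) hs
    have := (abs_lt.mp (hp x hx)).2
    simp; linarith
  rw [Real.dist_eq, abs_lt] at j1 j2 ⊢
  set P := ∫ x in (0 : ℝ)..1, p.eval x
  set Q := ∫ x in (0 : ℝ)..1, φ x
  have l1 : L * (P - Q) ≤ L * η := mul_le_mul_of_nonneg_left e3.2 hL0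
  have l2 : L * (-η) ≤ L * (P - Q) := mul_le_mul_of_nonneg_left e3.1 hL0
  constructor <;> nlinarith

end Karamata

/-- A continuous cutoff: `1 / x` for `x ≥ b`, vanishing for `x ≤ b - δ`. -/
noncomputable def ramp (b δ x : ℝ) : ℝ :=
  max 0 (min 1 ((x - (b - δ)) / δ)) / max x (Real.exp (-1))

lemma continuous_ramp (b δ : ℝ) : Continuous (ramp b δ) := by
  unfold ramp
  refine Continuous.div (by fun_prop) (by fun_prop) fun x => ?_
  exact (lt_of_lt_of_le (Real.exp_pos _) (le_max_right _ _)).ne'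

lemma ramp_nonneg (b δ x : ℝ) : 0 ≤ ramp b δ x :=
  div_nonneg (le_max_left _ _) ((Real.exp_pos _).le.trans (le_max_right _ _))

lemma ramp_le (b δ x : ℝ) : ramp b δ x ≤ (max x (Real.exp (-1)))⁻¹ := by
  rw [ramp, div_eq_mul_inv]
  refine mul_le_of_le_one_left (inv_nonneg.mpr ((Real.exp_pos _).le.trans (le_max_right _ _))) ?_
  exact max_le zero_le_one (min_le_left _ _)

lemma ramp_of_le {b δ x : ℝ} (hδ : 0 < δ) (hx : x ≤ b - δ) : ramp b δ x = 0 := by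
  have : (x - (b - δ)) / δ ≤ 0 := div_nonpos_of_nonpos_of_nonneg (by linarith) hδ.le
  rw [ramp, max_eq_left ((min_le_right _ _).trans this), zero_div]

lemma ramp_of_ge {b δ x : ℝ} (hδ : 0 < δ) (hb : Real.exp (-1) ≤ b) (hx : b ≤ x) :
    ramp b δ x = x⁻¹ := by
  have : 1 ≤ (x - (b - δ)) / δ := by rw [le_div_iff₀ hδ]; linarith
  rw [ramp, min_eq_left this, max_eq_right zero_le_one, max_eq_left (hb.trans hx), one_div]

lemma integral_ramp_le {δ : ℝ} (hδ : 0 < δ) (hδ1 : δ < Real.exp (-1)) :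
    ∫ x in (0 : ℝ)..1, ramp (Real.exp (-1)) δ x ≤ 1 + Real.exp 1 * δ := by
  set a := Real.exp (-1) with ha
  have ha0 : 0 < a := Real.exp_pos _
  have hi : ∀ u v : ℝ, IntervalIntegrable (ramp a δ) volume u v :=
    fun u v => (continuous_ramp a δ).intervalIntegrable u v
  rw [← intervalIntegral.integral_add_adjacent_intervals (hi 0 (a - δ)) (hi (a - δ) 1),
    ← intervalIntegral.integral_add_adjacent_intervals (hi (a - δ) a) (hi a 1)]
  have h1 : ∫ x in (0 : ℝ)..(a - δ), ramp a δ x = 0 := by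
    rw [intervalIntegral.integral_congr (g := fun _ => (0 : ℝ))]
    · simp
    · intro x hx
      rw [Set.uIcc_of_le (by linarith)] at hx
      exact ramp_of_le hδ hx.2
  have h2 : ∫ x in (a - δ)..a, ramp a δ x ≤ Real.exp 1 * δ := by
    have := intervalIntegral.integral_mono_on (by linarith : a - δ ≤ a) (hi (a - δ) a)
      (intervalIntegrable_const (c := Real.exp 1)) (fun x _ => ?_)
    · simp at this; linarith
    · refine (ramp_le _ _ _).trans ?_
      rw [show Real.exp 1 = a⁻¹ by rw [ha, ← Real.exp_neg]; simp]
      exact inv_anti₀ ha0 (le_max_right _ _)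
  have h3 : ∫ x in a..1, ramp a δ x = 1 := by
    have ha1 : a ≤ 1 := Real.exp_le_one_iff.mpr (by norm_num)
    rw [intervalIntegral.integral_congr (g := fun x => x⁻¹), integral_inv_of_pos ha0 one_pos]
    · simp [ha]
    · intro x hx
      rw [Set.uIcc_of_le ha1] at hx
      exact ramp_of_ge hδ le_rfl hx.1
  linarith

lemma le_integral_ramp {δ : ℝ} (hδ : 0 < δ) (hδ1 : Real.exp (-1) + δ ≤ 1) :
    1 - Real.exp 1 * δ ≤ ∫ x in (0 : ℝ)..1, ramp (Real.exp (-1) + δ) δ x := by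
  set a := Real.exp (-1) with ha
  have ha0 : 0 < a := Real.exp_pos _
  have hi : ∀ u v : ℝ, IntervalIntegrable (ramp (a + δ) δ) volume u v :=
    fun u v => (continuous_ramp (a + δ) δ).intervalIntegrable u v
  rw [← intervalIntegral.integral_add_adjacent_intervals (hi 0 (a + δ)) (hi (a + δ) 1)]
  have h1 : 0 ≤ ∫ x in (0 : ℝ)..(a + δ), ramp (a + δ) δ x :=
    intervalIntegral.integral_nonneg (by linarith) fun x _ => ramp_nonneg _ _ _
  have h3 : ∫ x in (a + δ)..1, ramp (a + δ) δ x = -Real.log (a + δ) := by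
    rw [intervalIntegral.integral_congr (g := fun x => x⁻¹),
      integral_inv_of_pos (by positivity) one_pos]
    · rw [one_div, Real.log_inv]
    · intro x hx
      rw [Set.uIcc_of_le hδ1] at hx
      exact ramp_of_ge hδ (by linarith) hx.1
  have h4 : Real.log (a + δ) ≤ -1 + Real.exp 1 * δ := by
    have e1 : a + δ = a * (1 + Real.exp 1 * δ) := by
      rw [mul_add, ← mul_assoc, ha, ← Real.exp_add]; simp
    have e2 : 0 < 1 + Real.exp 1 * δ := by positivity
    rw [e1, Real.log_mul ha0.ne' e2.ne', ha, Real.log_exp]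
    have := Real.log_le_sub_one_of_pos e2
    linarith
  linarith

/-- Karamata's Tauberian theorem in the form passing from Laplace means to Cesàro means. -/
theorem tendsto_cesaro_of_laplace {g : ℝ → ℝ} (hg : ∀ y, 0 ≤ g y)
    (hint : ∀ s ∈ Set.Ioo (0 : ℝ) 1, IntegrableOn (fun y => g y * Real.exp (-s * y)) (Set.Ioi 0))
    {L : ℝ} (hL : Tendsto (fun s => s * ∫ y in Set.Ioi (0 : ℝ), g y * Real.exp (-s * y))
      (𝓝[>] 0) (𝓝 L)) :
    Tendsto (fun Y : ℝ => (1 / Y) * ∫ y in (0 : ℝ)..Y, g y) atTop (𝓝 L) := by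
  have hev : ∀ᶠ s : ℝ in 𝓝[>] 0, s ∈ Set.Ioo (0 : ℝ) 1 := Ioo_mem_nhdsGT one_pos
  have hL0 : 0 ≤ L := by
    refine ge_of_tendsto hL ?_
    filter_upwards [hev] with s hs
    exact mul_nonneg hs.1.le (integral_nonneg fun y => mul_nonneg (hg y) (Real.exp_pos _).le)
  have hinv : Tendsto (fun Y : ℝ => Y⁻¹) atTop (𝓝[>] 0) := tendsto_inv_atTop_nhdsGT_zero
  have hgi : ∀ Y : ℝ, 1 < Y → IntegrableOn g (Set.Ioc 0 Y) := by
    intro Y hY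
    have hY0 : 0 < Y := by linarith
    have h1 := (hint Y⁻¹ ⟨by positivity, inv_lt_one_of_one_lt₀ hY⟩).mono_set
      (show Set.Ioc 0 Y ⊆ Set.Ioi 0 from Set.Ioc_subset_Ioi_self)
    have h2 : IntegrableOn (fun y => g y * Real.exp (-Y⁻¹ * y) * Real.exp (Y⁻¹ * y))
        (Set.Ioc 0 Y) := by
      refine h1.mul_bdd (c := Real.exp 1) (by fun_prop) ?_
      refine (ae_restrict_iff' measurableSet_Ioc).mpr (Eventually.of_forall fun y hy => ?_)
      rw [Real.norm_eq_abs, abs_of_pos (Real.exp_pos _), Real.exp_le_exp, inv_mul_le_iff₀ hY0]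
      linarith [hy.2]
    refine h2.congr (Eventually.of_forall fun y => ?_)
    simp only [mul_assoc, ← Real.exp_add]
    simp
  have hform : ∀ Y : ℝ, 1 < Y → (1 / Y) * ∫ y in (0 : ℝ)..Y, g y =
      Y⁻¹ * ∫ y in Set.Ioi (0 : ℝ), (Set.Ioc 0 Y).indicator g y := by
    intro Y hY
    rw [intervalIntegral.integral_of_le (by linarith), setIntegral_indicator measurableSet_Ioc,
      one_div]
    congr 3
    exact (Set.inter_eq_right.mpr Set.Ioc_subset_Ioi_self).symm
  have hind : ∀ Y : ℝ, 1 < Y → IntegrableOn ((Set.Ioc 0 Y).indicator g) (Set.Ioi 0) := fun Y hY =>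
    ((hgi Y hY).integrable_indicator measurableSet_Ioc).integrableOn
  set a := Real.exp (-1) with ha
  have ha0 : 0 < a := Real.exp_pos _
  have ha1 : a < 1 := Real.exp_lt_one_iff.mpr (by norm_num)
  have hx : ∀ Y y : ℝ, 1 < Y → (y ≤ Y ↔ a ≤ Real.exp (-Y⁻¹ * y)) := by
    intro Y y hY
    rw [ha, Real.exp_le_exp, neg_mul, neg_le_neg_iff, inv_mul_le_iff₀ (by linarith), mul_one]
  have hup : ∀ δ : ℝ, 0 < δ → ∀ Y : ℝ, 1 < Y →
      (1 / Y) * ∫ y in (0 : ℝ)..Y, g y ≤ karamataMean g (ramp a δ) Y⁻¹ := by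
    intro δ hδ Y hY
    have hs : Y⁻¹ ∈ Set.Ioo (0 : ℝ) 1 := ⟨by positivity, inv_lt_one_of_one_lt₀ hY⟩
    rw [hform Y hY]
    refine mul_le_mul_of_nonneg_left ?_ hs.1.le
    refine setIntegral_mono_on (hind Y hY) (integrableOn_karamata hint (continuous_ramp a δ) hs)
      measurableSet_Ioi fun y hy => ?_
    by_cases hyY : y ≤ Y
    · rw [Set.indicator_of_mem (show y ∈ Set.Ioc 0 Y from ⟨hy, hyY⟩),
        ramp_of_ge hδ le_rfl ((hx Y y hY).mp hyY), mul_assoc, mul_inv_cancel₀ (Real.exp_pos _).ne',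
        mul_one]
    · rw [Set.indicator_of_notMem (fun h => hyY h.2)]
      exact mul_nonneg (mul_nonneg (hg y) (Real.exp_pos _).le) (ramp_nonneg _ _ _)
  have hlo : ∀ δ : ℝ, 0 < δ → ∀ Y : ℝ, 1 < Y →
      karamataMean g (ramp (a + δ) δ) Y⁻¹ ≤ (1 / Y) * ∫ y in (0 : ℝ)..Y, g y := by
    intro δ hδ Y hY
    have hs : Y⁻¹ ∈ Set.Ioo (0 : ℝ) 1 := ⟨by positivity, inv_lt_one_of_one_lt₀ hY⟩
    rw [hform Y hY]
    refine mul_le_mul_of_nonneg_left ?_ hs.1.le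
    refine setIntegral_mono_on (integrableOn_karamata hint (continuous_ramp (a + δ) δ) hs)
      (hind Y hY) measurableSet_Ioi fun y hy => ?_
    by_cases hyY : y ≤ Y
    · rw [Set.indicator_of_mem (show y ∈ Set.Ioc 0 Y from ⟨hy, hyY⟩), mul_assoc]
      refine mul_le_of_le_one_right (hg y) ?_
      have h1 := (ramp_le (a + δ) δ (Real.exp (-Y⁻¹ * y))).trans
        (inv_anti₀ (Real.exp_pos _) (le_max_left _ _))
      calc _ ≤ Real.exp (-Y⁻¹ * y) * (Real.exp (-Y⁻¹ * y))⁻¹ :=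
            mul_le_mul_of_nonneg_left h1 (Real.exp_pos _).le
        _ = 1 := mul_inv_cancel₀ (Real.exp_pos _).ne'
    · rw [Set.indicator_of_notMem (fun h => hyY h.2), ramp_of_le hδ, mul_zero]
      rw [hx Y y hY] at hyY
      linarith
  rw [Metric.tendsto_nhds]
  intro ε hε
  obtain ⟨δ, hδ, hδa, hδ1, hδε⟩ : ∃ δ : ℝ, 0 < δ ∧ δ < a ∧ a + δ ≤ 1 ∧
      L * (Real.exp 1 * δ) ≤ ε / 4 := by
    have h1 : 0 < ε / (4 * Real.exp 1 * (L + 1)) := by positivity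
    refine ⟨min (min (a / 2) (1 - a)) (ε / (4 * Real.exp 1 * (L + 1))), ?_, ?_, ?_, ?_⟩
    · exact lt_min (lt_min (by linarith) (by linarith)) h1
    · exact ((min_le_left _ _).trans (min_le_left _ _)).trans_lt (by linarith)
    · have := (min_le_left (min (a / 2) (1 - a)) (ε / (4 * Real.exp 1 * (L + 1)))).trans
        (min_le_right _ _)
      linarith
    · calc _ ≤ L * (Real.exp 1 * (ε / (4 * Real.exp 1 * (L + 1)))) := by
            gcongr; exact min_le_right _ _
        _ = ε / 4 * (L / (L + 1)) := by field_simp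
        _ ≤ ε / 4 * 1 := by
            gcongr
            rw [div_le_one (by linarith)]; linarith
        _ = ε / 4 := mul_one _
  have t1 := (Metric.tendsto_nhds.mp ((tendsto_karamataMean hint hg hL
    (continuous_ramp a δ)).comp hinv)) (ε / 4) (by positivity)
  have t2 := (Metric.tendsto_nhds.mp ((tendsto_karamataMean hint hg hL
    (continuous_ramp (a + δ) δ)).comp hinv)) (ε / 4) (by positivity)
  filter_upwards [t1, t2, eventually_gt_atTop 1] with Y j1 j2 hY
  have k1 := hup δ hδ Y hY
  have k2 := hlo δ hδ Y hY
  have l1 : L * (∫ x in (0 : ℝ)..1, ramp a δ x) ≤ L * (1 + Real.exp 1 * δ) :=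
    mul_le_mul_of_nonneg_left (integral_ramp_le hδ hδa) hL0
  have l2 : L * (1 - Real.exp 1 * δ) ≤ L * ∫ x in (0 : ℝ)..1, ramp (a + δ) δ x :=
    mul_le_mul_of_nonneg_left (le_integral_ramp hδ hδ1) hL0
  simp only [Function.comp] at j1 j2
  rw [Real.dist_eq, abs_lt] at j1 j2 ⊢
  constructor <;> linarith [j1.1, j1.2, j2.1, j2.2]

/-- The centred Gaussian density of variance `2`. -/
noncomputable def gss (z : ℝ) : ℝ := Real.exp (-(1 / 4) * z ^ 2) / (2 * √Real.pi)

/-- The summatory function of `μ` on a logarithmic scale, smoothed by a Gaussian at scale `ε`. -/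
noncomputable def mol (ε y : ℝ) : ℝ := ∫ z : ℝ, mexp (y - ε * z) * gss z

/-- The contour integrand representing `mol ε y`. -/
noncomputable def ker (ε y : ℝ) (w : ℂ) : ℂ := zi w / w * exp (ε ^ 2 * w ^ 2 + w * y)

lemma integrable_mexp_mul_exp {b : ℝ} (hb : 1 < b) :
    Integrable fun u => mexp u * Real.exp (-b * u) := by
  have h1 : Integrable (Set.indicator (Set.Ioi 0) fun u => Real.exp ((1 - b) * u)) :=
    (integrableOn_exp_mul_Ioi (by linarith) 0).integrable_indicator measurableSet_Ioi
  refine h1.mono' (measurable_mexp.mul (by fun_prop)).aestronglyMeasurable ?_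
  filter_upwards [compl_mem_ae_iff.mpr (measure_singleton (0 : ℝ))] with u hu
  rcases lt_or_gt_of_ne (show u ≠ 0 from hu) with h | h
  · rw [mexp_of_neg h]; simp [Set.indicator_of_notMem, h.le]
  · rw [Set.indicator_of_mem (show u ∈ Set.Ioi 0 from h), norm_mul, Real.norm_eq_abs,
      Real.norm_eq_abs, Real.abs_exp]
    calc _ ≤ Real.exp u * Real.exp (-b * u) := by gcongr; exact abs_mexp_le u
      _ = _ := by rw [← Real.exp_add]; congr 1; ring

lemma integral_gaussian_line {ε : ℝ} (hε : 0 < ε) (v : ℝ) :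
    ∫ t : ℝ, exp (ε ^ 2 * (pt (3 / 2) t) ^ 2 + pt (3 / 2) t * v) =
      ((√Real.pi / ε * Real.exp (-(v ^ 2 / (4 * ε ^ 2))) : ℝ) : ℂ) := by
  have hε2 : (0 : ℝ) < ε ^ 2 := by positivity
  have h := integral_cexp_quadratic (b := -(ε : ℂ) ^ 2) (by
    rw [neg_re, ← ofReal_pow, ofReal_re]; linarith) ((4 * ε ^ 2 + v) * I) (4 * ε ^ 2 + 2 * v)
  have e1 : ∀ t : ℝ, (ε : ℂ) ^ 2 * (pt (3 / 2) t) ^ 2 + pt (3 / 2) t * v =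
      -(ε : ℂ) ^ 2 * t ^ 2 + (4 * ε ^ 2 + v) * I * t + (4 * ε ^ 2 + 2 * v) := by
    intro t
    have : pt (3 / 2) t = 2 + t * I := by unfold pt; push_cast; norm_num
    rw [this]
    linear_combination (ε : ℂ) ^ 2 * t ^ 2 * I_sq
  simp only [e1]
  rw [h]
  have hεc : (ε : ℂ) ≠ 0 := by exact_mod_cast hε.ne'
  have e2 : (4 * ε ^ 2 + 2 * v : ℂ) - ((4 * ε ^ 2 + v) * I) ^ 2 / (4 * -(ε : ℂ) ^ 2) =
      ((-(v ^ 2 / (4 * ε ^ 2)) : ℝ) : ℂ) := by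
    rw [mul_pow, I_sq]; push_cast; field_simp; ring
  have e3 : ((Real.pi : ℂ) / - -(ε : ℂ) ^ 2) ^ (1 / 2 : ℂ) = ((√Real.pi / ε : ℝ) : ℂ) := by
    have : ((Real.pi : ℂ) / - -(ε : ℂ) ^ 2) = ((Real.pi / ε ^ 2 : ℝ) : ℂ) := by push_cast; ring
    rw [this, show (1 / 2 : ℂ) = ((1 / 2 : ℝ) : ℂ) by push_cast; rfl, ← ofReal_cpow (by positivity),
      ← Real.sqrt_eq_rpow, Real.sqrt_div Real.pi_pos.le, Real.sqrt_sq hε.le]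
  rw [e2, e3, ofReal_mul, ofReal_exp]

lemma norm_exp_pt (ε y σ t : ℝ) : ‖exp (ε ^ 2 * (pt σ t) ^ 2 + pt σ t * y)‖ =
    Real.exp (ε ^ 2 * ((1 / 2 + σ) ^ 2 - t ^ 2) + (1 / 2 + σ) * y) := by
  rw [norm_exp]
  congr 1
  have h1 : (ε : ℂ) ^ 2 = ((ε ^ 2 : ℝ) : ℂ) := by push_cast; rfl
  rw [h1, add_re, re_ofReal_mul, mul_comm (pt σ t), re_ofReal_mul, pow_two (pt σ t), mul_re,
    pt_re, pt_im]
  ring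

lemma integrable_exp_gauss {ε : ℝ} (hε : 0 < ε) (a : ℝ) :
    Integrable fun t : ℝ => Real.exp (ε ^ 2 * (a - t ^ 2)) := by
  refine ((integrable_exp_neg_mul_sq (b := ε ^ 2) (by positivity)).const_mul
    (Real.exp (ε ^ 2 * a))).congr (Eventually.of_forall fun t => ?_)
  simp only [← Real.exp_add]; congr 1; ring

lemma integral_ker_two {ε : ℝ} (hε : 0 < ε) (y : ℝ) :
    ∫ t : ℝ, ker ε y (pt (3 / 2) t) = 2 * Real.pi * (mol ε y : ℂ) := by
  have h1 : ∀ t : ℝ, ker ε y (pt (3 / 2) t) = ∫ u : ℝ, ((mexp u : ℂ) * exp (-(pt (3 / 2) t) * u)) *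
      exp (ε ^ 2 * (pt (3 / 2) t) ^ 2 + pt (3 / 2) t * y) := by
    intro t
    rw [integral_mul_const, integral_mexp (by simp; norm_num), ker, zi_eq (by simp; norm_num)
      (pt_ne_zero (by norm_num) t)]
    intro h; have := congrArg re h; simp at this; norm_num at this
  simp only [h1]
  have hpt : Continuous (pt (3 / 2)) := by unfold pt; fun_prop
  rw [integral_integral_swap]
  · have h2 : ∀ u t : ℝ, ((mexp u : ℂ) * exp (-(pt (3 / 2) t) * u)) *
        exp (ε ^ 2 * (pt (3 / 2) t) ^ 2 + pt (3 / 2) t * y) = (mexp u : ℂ) *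
        exp (ε ^ 2 * (pt (3 / 2) t) ^ 2 + pt (3 / 2) t * (y - u : ℝ)) := by
      intro u t
      rw [mul_assoc, ← exp_add]; congr 2; push_cast; ring
    simp only [h2, integral_const_mul, integral_gaussian_line hε, ← ofReal_mul]
    rw [integral_complex_ofReal]
    have h3 : ∫ u : ℝ, mexp u * (√Real.pi / ε * Real.exp (-((y - u) ^ 2 / (4 * ε ^ 2)))) =
        2 * Real.pi * mol ε y := by
      have h4 := Measure.integral_comp_mul_left (fun u : ℝ => mexp (y - u) * (√Real.pi / ε *
        Real.exp (-((y - (y - u)) ^ 2 / (4 * ε ^ 2))))) ε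
      rw [integral_sub_left_eq_self (fun u : ℝ => mexp u * (√Real.pi / ε *
        Real.exp (-((y - u) ^ 2 / (4 * ε ^ 2))))) volume y, smul_eq_mul,
        abs_of_pos (by positivity)] at h4
      rw [eq_comm, inv_mul_eq_iff_eq_mul₀ hε.ne'] at h4
      rw [h4, mol, ← integral_const_mul, ← integral_const_mul]
      refine integral_congr_ae (Eventually.of_forall fun z => ?_)
      simp only [gss]
      have e1 : -((y - (y - ε * z)) ^ 2 / (4 * ε ^ 2)) = -(1 / 4) * z ^ 2 := by
        field_simp; ring
      rw [e1]
      have e2 : √Real.pi ^ 2 = Real.pi := Real.sq_sqrt Real.pi_pos.le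
      have e3 : √Real.pi ≠ 0 := (Real.sqrt_pos.mpr Real.pi_pos).ne'
      field_simp
      rw [e2]
    rw [h3]; push_cast; rfl
  · have hint := (((integrable_exp_gauss hε ((1 / 2 + 3 / 2) ^ 2)).mul_const
      (Real.exp ((1 / 2 + 3 / 2) * y))).mul_prod
      (integrable_mexp_mul_exp (b := 2) (by norm_num)))
    refine hint.mono ?_ (Eventually.of_forall fun p => ?_)
    · refine AEStronglyMeasurable.mul (AEStronglyMeasurable.mul ?_ ?_) ?_
      · exact (measurable_ofReal.comp (measurable_mexp.comp measurable_snd)).aestronglyMeasurable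
      · exact Continuous.aestronglyMeasurable (by fun_prop)
      · exact Continuous.aestronglyMeasurable (by fun_prop)
    · simp only [Function.uncurry, norm_mul, norm_exp_pt, norm_real]
      rw [norm_exp, mul_comm (-pt (3 / 2) p.1), re_ofReal_mul, neg_re, pt_re]
      simp only [Real.norm_eq_abs, Real.abs_exp]
      have : Real.exp (ε ^ 2 * ((1 / 2 + 3 / 2) ^ 2 - p.1 ^ 2) + (1 / 2 + 3 / 2) * y) =
          Real.exp (ε ^ 2 * ((1 / 2 + 3 / 2) ^ 2 - p.1 ^ 2)) * Real.exp ((1 / 2 + 3 / 2) * y) :=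
        Real.exp_add _ _
      rw [this, show p.2 * -(1 / 2 + 3 / 2) = -2 * p.2 by ring]
      apply le_of_eq; ring

lemma norm_exp_ker (ε y : ℝ) (w : ℂ) : ‖exp (ε ^ 2 * w ^ 2 + w * y)‖ =
    Real.exp (ε ^ 2 * (w.re ^ 2 - w.im ^ 2) + w.re * y) := by
  have : w = pt (w.re - 1 / 2) w.im := by apply Complex.ext <;> simp
  conv_lhs => rw [this]
  rw [norm_exp_pt]; congr 1; ring

lemma continuous_pt (σ : ℝ) : Continuous (pt σ) := by unfold pt; fun_prop

lemma SimpleRH.continuous_ker (H : SimpleRH) {σ : ℝ} (hσ : 0 < σ) (ε y : ℝ) :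
    Continuous fun t => ker ε y (pt σ t) := by
  have := continuous_pt σ
  unfold ker
  exact (H.continuous_zi_pt hσ).mul (by fun_prop)

lemma norm_ker_pt (ε y σ t : ℝ) : ‖ker ε y (pt σ t)‖ = ‖zi (pt σ t) / pt σ t‖ *
    (Real.exp (ε ^ 2 * ((1 / 2 + σ) ^ 2 - t ^ 2)) * Real.exp ((1 / 2 + σ) * y)) := by
  rw [ker, norm_mul, norm_exp_pt, Real.exp_add]

lemma SimpleRH.integrable_ker (H : SimpleRH) (hw : ∑' γ : ordSet, ENNReal.ofReal (wt γ) ≠ ⊤)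
    {ε σ : ℝ} (hε : 0 < ε) (hσ : 0 < σ) (hσ2 : σ ≤ 1 / 2) (y : ℝ) :
    Integrable fun t => ker ε y (pt σ t) := by
  have h1 : Integrable fun t : ℝ => Real.exp ((1 / 2 + σ) * y) * (sqF σ t +
      Real.exp ((√2 * ε) ^ 2 * ((1 / 2 + σ) ^ 2 - t ^ 2))) :=
    ((H.integrable_sqF hw hσ hσ2).add (integrable_exp_gauss (by positivity) _)).const_mul _
  refine h1.mono' (H.continuous_ker hσ ε y).aestronglyMeasurable (Eventually.of_forall fun t => ?_)
  rw [norm_ker_pt, sqF]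
  set a := ‖zi (pt σ t) / pt σ t‖
  have e1 : Real.exp ((√2 * ε) ^ 2 * ((1 / 2 + σ) ^ 2 - t ^ 2)) =
      Real.exp (ε ^ 2 * ((1 / 2 + σ) ^ 2 - t ^ 2)) ^ 2 := by
    rw [← Real.exp_nat_mul, mul_pow, Real.sq_sqrt (by norm_num)]; congr 1; push_cast; ring
  rw [e1]
  set b := Real.exp (ε ^ 2 * ((1 / 2 + σ) ^ 2 - t ^ 2))
  have hE := Real.exp_pos ((1 / 2 + σ) * y)
  have : a * b ≤ a ^ 2 + b ^ 2 := by nlinarith [sq_nonneg (a - b), sq_nonneg (a + b)]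
  nlinarith

lemma SimpleRH.integrable_ker_two (H : SimpleRH) {ε : ℝ} (hε : 0 < ε) (y : ℝ) :
    Integrable fun t => ker ε y (pt (3 / 2) t) := by
  obtain ⟨C, hC0, hC⟩ := zi_bounded_two
  refine (((integrable_exp_gauss hε ((1 / 2 + 3 / 2) ^ 2)).mul_const
    (Real.exp ((1 / 2 + 3 / 2) * y))).const_mul C).mono'
    (H.continuous_ker (by norm_num) ε y).aestronglyMeasurable (Eventually.of_forall fun t => ?_)
  rw [norm_ker_pt]
  refine mul_le_mul_of_nonneg_right ?_ (by positivity)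
  rw [norm_div, div_le_iff₀ (norm_pos_iff.mpr (pt_ne_zero (by norm_num) t))]
  have h1 : 1 ≤ ‖pt (3 / 2) t‖ := by
    refine le_trans ?_ (re_le_norm _); simp; norm_num
  calc _ ≤ C := hC _ (by simp; norm_num)
    _ = C * 1 := (mul_one C).symm
    _ ≤ _ := by gcongr

lemma norm_ker_le {A T ε y x : ℝ} (hT : 1 ≤ T) (hx : 0 ≤ x) (hx2 : x ≤ 2) {w : ℂ} (hre : w.re = x)
    (him : |w.im| = T) (hz : ‖zi w‖ ≤ Real.exp (A * T)) :
    ‖ker ε y w‖ ≤ Real.exp (A * T + (ε ^ 2 * (4 - T ^ 2) + 2 * |y|)) := by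
  rw [ker, norm_mul, norm_exp_ker, Real.exp_add (A * T)]
  have h1 : 1 ≤ ‖w‖ := hT.trans (him ▸ abs_im_le_norm w)
  refine mul_le_mul ?_ (Real.exp_le_exp.mpr ?_) (Real.exp_pos _).le (Real.exp_pos _).le
  · rw [norm_div]
    exact (div_le_self (norm_nonneg _) h1).trans hz
  · rw [hre, ← sq_abs w.im, him]
    have h2 : x ^ 2 ≤ 4 := by nlinarith
    have h3 : x * y ≤ 2 * |y| := by
      calc x * y ≤ x * |y| := by gcongr; exact le_abs_self y
        _ ≤ _ := by gcongr
    have : ε ^ 2 * (x ^ 2 - T ^ 2) ≤ ε ^ 2 * (4 - T ^ 2) := by gcongr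
    linarith

lemma tendsto_exp_neg_sq {A ε B : ℝ} (hε : 0 < ε) :
    Tendsto (fun T : ℝ => Real.exp (A * T + (ε ^ 2 * (4 - T ^ 2) + B))) atTop (𝓝 0) := by
  refine Real.tendsto_exp_atBot.comp ?_
  have h1 : Tendsto (fun T : ℝ => T * (-(ε ^ 2) * T + A)) atTop atBot := by
    refine tendsto_id.atTop_mul_atBot₀ ?_
    exact tendsto_atBot_add_const_right _ _
      (tendsto_id.const_mul_atTop_of_neg (by nlinarith [sq_pos_of_pos hε]))
  refine (tendsto_atBot_add_const_right _ (ε ^ 2 * 4 + B) h1).congr fun T => ?_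
  ring

lemma SimpleRH.integral_ker (H : SimpleRH) (hw : ∑' γ : ordSet, ENNReal.ofReal (wt γ) ≠ ⊤)
    {ε σ : ℝ} (hε : 0 < ε) (hσ : 0 < σ) (hσ2 : σ ≤ 1 / 2) (y : ℝ) :
    ∫ t : ℝ, ker ε y (pt σ t) = 2 * Real.pi * (mol ε y : ℂ) := by
  rw [← integral_ker_two hε]
  obtain ⟨A, -, hA⟩ := H.exists_good_height
  choose T hT1 hT2 hT using fun n : ℕ => hA (n + 1) (by omega)
  have hT0 : ∀ n, 1 ≤ T n := fun n => by
    have := hT1 n; push_cast at this; have : (0 : ℝ) ≤ n := Nat.cast_nonneg n; linarith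
  have hTlim : Tendsto T atTop atTop := by
    refine tendsto_atTop_mono (fun n => ?_) tendsto_natCast_atTop_atTop
    have := hT1 n; push_cast at this; linarith
  set a : ℝ := 1 / 2 + σ with ha
  have ha2 : a ≤ 2 := by linarith
  have e0 : ∀ n, (∫ t in (-T n)..T n, ker ε y (pt σ t)) - (∫ t in (-T n)..T n, ker ε y (pt (3 / 2) t))
      = I * ((∫ x in a..2, ker ε y (x + T n * I)) - ∫ x in a..2, ker ε y (x - T n * I)) := by
    intro n
    have h0 := rectInt_eq_sum_residues (a := a) (b := 2) (c := -T n) (d := T n) ha2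
      (by linarith [hT0 n]) ∅ (fun _ => 0) (ker ε y) (by simp) (fun w h1 _ _ _ _ => by
        have hw0 : w ≠ 0 := by rintro rfl; simp at h1; linarith
        have h2 : DifferentiableAt ℂ zi w := differentiableAt_zi (by linarith)
          (H.xi_ne_zero (by linarith))
        unfold ker
        exact (h2.div differentiableAt_id hw0).mul (by fun_prop)) (by simp)
    have e1 : ∀ t : ℝ, (a : ℂ) + t * I = pt σ t := fun t => rfl
    have e2 : ∀ t : ℝ, ((2 : ℝ) : ℂ) + t * I = pt (3 / 2) t := fun t => by
      unfold pt; norm_num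
    have e3 : ∀ x : ℝ, (x : ℂ) + ((-T n : ℝ) : ℂ) * I = x - T n * I := fun x => by push_cast; ring
    simp only [rectInt, e1, e2, e3, Finset.sum_empty, mul_zero] at h0
    linear_combination (I) * h0 + ((∫ t in (-T n)..T n, ker ε y (pt σ t)) -
      (∫ t in (-T n)..T n, ker ε y (pt (3 / 2) t))) * I_sq
  have hlim0 : Tendsto (fun n => I * ((∫ x in a..2, ker ε y (x + T n * I)) -
      ∫ x in a..2, ker ε y (x - T n * I))) atTop (𝓝 0) := by
    have h1 := ((tendsto_exp_neg_sq (A := A) (B := 2 * |y|) hε).comp hTlim).mul_const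
      (|2 - a| + |2 - a|)
    rw [zero_mul] at h1
    refine squeeze_zero_norm (fun n => ?_) h1
    rw [norm_mul, norm_I, one_mul]
    refine (norm_sub_le _ _).trans ?_
    simp only [Function.comp]
    rw [mul_add]
    have hb : ∀ x ∈ Set.uIoc a 2, 0 ≤ x ∧ x ≤ 2 := fun x hx => by
      rw [Set.uIoc_of_le ha2] at hx; exact ⟨by linarith [hx.1], hx.2⟩
    refine add_le_add ?_ ?_ <;>
    refine intervalIntegral.norm_integral_le_of_norm_le_const fun x hx => ?_
    · exact norm_ker_le (hT0 n) (hb x hx).1 (hb x hx).2 (by simp) (by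
        simp; linarith [hT0 n]) (hT n x (by linarith [(hb x hx).1]) (hb x hx).2).2.2.1
    · exact norm_ker_le (hT0 n) (hb x hx).1 (hb x hx).2 (by simp) (by
        simp; linarith [hT0 n]) (hT n x (by linarith [(hb x hx).1]) (hb x hx).2).2.2.2
  have hneg : Tendsto (fun n => -T n) atTop atBot := tendsto_neg_atTop_atBot.comp hTlim
  have l1 := intervalIntegral_tendsto_integral (H.integrable_ker hw hε hσ hσ2 y) hneg hTlim
  have l2 := intervalIntegral_tendsto_integral (H.integrable_ker_two hε y) hneg hTlim
  have := tendsto_nhds_unique ((l1.sub l2).congr e0) hlim0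
  exact sub_eq_zero.mp this

lemma measurable_mol (ε : ℝ) : StronglyMeasurable (mol ε) := by
  have : Measurable (Function.uncurry fun y z : ℝ => mexp (y - ε * z) * gss z) := by
    refine Measurable.mul (measurable_mexp.comp (by fun_prop)) ?_
    unfold gss; fun_prop
  exact this.stronglyMeasurable.integral_prod_right

lemma ker_eq (ε y σ t : ℝ) : ker ε y (pt σ t) =
    ker ε 0 (pt σ t) * exp (y * t * I) * (Real.exp ((1 / 2 + σ) * y) : ℂ) := by
  have h : exp (ε ^ 2 * (pt σ t) ^ 2 + pt σ t * y) = exp (ε ^ 2 * (pt σ t) ^ 2 + pt σ t * (0 : ℝ)) *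
      (exp (y * t * I) * ((Real.exp ((1 / 2 + σ) * y) : ℝ) : ℂ)) := by
    rw [ofReal_exp, ← exp_add, ← exp_add]
    congr 1
    unfold pt; push_cast; ring
  rw [ker, ker, h]; ring

lemma SimpleRH.abs_mol_le (H : SimpleRH) (hw : ∑' γ : ordSet, ENNReal.ofReal (wt γ) ≠ ⊤)
    {ε σ : ℝ} (hε : 0 < ε) (hσ : 0 < σ) (hσ2 : σ ≤ 1 / 2) :
    ∃ C, 0 ≤ C ∧ ∀ y, |mol ε y| ≤ C * Real.exp ((1 / 2 + σ) * y) := by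
  have hpi := Real.pi_pos
  refine ⟨(2 * Real.pi)⁻¹ * ∫ t, ‖ker ε 0 (pt σ t)‖, by positivity, fun y => ?_⟩
  have h1 := congrArg norm (H.integral_ker hw hε hσ hσ2 y)
  have h2 : ‖(2 * Real.pi * (mol ε y : ℂ))‖ = 2 * Real.pi * |mol ε y| := by
    simp [abs_of_pos hpi]
  rw [h2] at h1
  have h3 := norm_integral_le_integral_norm (fun t => ker ε y (pt σ t)) (μ := volume)
  have h4 : ∀ t, ‖ker ε y (pt σ t)‖ = ‖ker ε 0 (pt σ t)‖ * Real.exp ((1 / 2 + σ) * y) := by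
    intro t
    rw [norm_ker_pt, norm_ker_pt, mul_zero, Real.exp_zero]; ring
  simp only [h4] at h3
  rw [integral_mul_const, h1] at h3
  rw [mul_assoc, ← div_eq_inv_mul, le_div_iff₀ (by positivity)]
  linarith

/-- Plancherel for the smoothed summatory function. -/
theorem SimpleRH.integral_mol_sq (H : SimpleRH) (hw : ∑' γ : ordSet, ENNReal.ofReal (wt γ) ≠ ⊤)
    {ε σ : ℝ} (hε : 0 < ε) (hσ : 0 < σ) (hσ2 : σ < 1 / 2) :
    (Integrable fun y => mol ε y ^ 2 * Real.exp (-(1 + 2 * σ) * y)) ∧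
    2 * Real.pi * ∫ y, mol ε y ^ 2 * Real.exp (-(1 + 2 * σ) * y) =
      ∫ t, sqF σ t * Real.exp (2 * ε ^ 2 * ((1 / 2 + σ) ^ 2 - t ^ 2)) := by
  have hpi := Real.pi_pos
  set E : ℝ → ℝ := fun y => mol ε y * Real.exp (-(1 / 2 + σ) * y) with hE
  obtain ⟨C₁, hC₁, hb₁⟩ := H.abs_mol_le hw hε (half_pos hσ) (by linarith)
  obtain ⟨C₂, hC₂, hb₂⟩ := H.abs_mol_le hw hε (σ := 1 / 2) (by norm_num) le_rfl
  have hE₁ : ∀ y, ‖E y‖ ≤ C₁ * Real.exp (-(σ / 2) * y) := by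
    intro y
    rw [hE, norm_mul, Real.norm_eq_abs, Real.norm_eq_abs, Real.abs_exp]
    calc _ ≤ C₁ * Real.exp ((1 / 2 + σ / 2) * y) * Real.exp (-(1 / 2 + σ) * y) := by
          gcongr; exact hb₁ y
      _ = _ := by rw [mul_assoc, ← Real.exp_add]; congr 2; ring
  have hE₂ : ∀ y, ‖E y‖ ≤ C₂ * Real.exp ((1 / 2 - σ) * y) := by
    intro y
    rw [hE, norm_mul, Real.norm_eq_abs, Real.norm_eq_abs, Real.abs_exp]
    calc _ ≤ C₂ * Real.exp ((1 / 2 + 1 / 2) * y) * Real.exp (-(1 / 2 + σ) * y) := by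
          gcongr; exact hb₂ y
      _ = _ := by rw [mul_assoc, ← Real.exp_add]; congr 2; ring
  have hEm : AEStronglyMeasurable E volume :=
    (measurable_mol ε).aestronglyMeasurable.mul (by fun_prop)
  have hEi : Integrable E := by
    rw [← integrableOn_univ, ← Set.Iic_union_Ioi (a := (0 : ℝ))]
    refine IntegrableOn.union ?_ ?_
    · exact ((integrableOn_exp_mul_Iic (by linarith) 0).const_mul C₂).mono' hEm.restrict
        (Eventually.of_forall hE₂)
    · exact ((integrableOn_exp_mul_Ioi (by linarith) 0).const_mul C₁).mono' hEm.restrict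
        (Eventually.of_forall hE₁)
  have hEb : ∀ y, ‖E y‖ ≤ C₁ + C₂ := by
    intro y
    rcases le_total 0 y with hy | hy
    · have : Real.exp (-(σ / 2) * y) ≤ 1 := Real.exp_le_one_iff.mpr (by nlinarith)
      nlinarith [hE₁ y]
    · have : Real.exp ((1 / 2 - σ) * y) ≤ 1 := Real.exp_le_one_iff.mpr (by nlinarith)
      nlinarith [hE₂ y]
  have hsq : ∀ y, mol ε y ^ 2 * Real.exp (-(1 + 2 * σ) * y) = E y ^ 2 := by
    intro y
    rw [hE, mul_pow, ← Real.exp_nat_mul]; congr 2; push_cast; ring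
  have hEE : ∀ y : ℝ, ∫ t : ℝ, ker ε 0 (pt σ t) * exp (y * t * I) = 2 * Real.pi * (E y : ℂ) := by
    intro y
    have h1 := H.integral_ker hw hε hσ hσ2.le y
    simp only [ker_eq ε y σ] at h1
    rw [integral_mul_const] at h1
    have h2 : ((Real.exp ((1 / 2 + σ) * y) : ℝ) : ℂ) * (Real.exp (-(1 / 2 + σ) * y) : ℝ) = 1 := by
      rw [← ofReal_mul, ← Real.exp_add,
      show (1 / 2 + σ) * y + -(1 / 2 + σ) * y = 0 by ring, Real.exp_zero, ofReal_one]
    have h3 := congrArg (· * ((Real.exp (-(1 / 2 + σ) * y) : ℝ) : ℂ)) h1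
    simp only [mul_assoc _ (Complex.ofReal (Real.exp ((1 / 2 + σ) * y))), h2, mul_one] at h3
    rw [h3, hE]; push_cast; ring
  simp only [hsq]
  refine ⟨?_, ?_⟩
  · simp only [pow_two]
    exact hEi.mul_bdd hEm (Eventually.of_forall hEb)
  · have hP := integral_norm_sq_transform (H.continuous_ker hσ ε 0)
      (H.integrable_ker hw hε hσ hσ2.le 0) (by
        simp only [hEE]
        exact hEi.ofReal.const_mul _)
    simp only [hEE] at hP
    have h1 : ∀ y, ‖2 * Real.pi * (E y : ℂ)‖ ^ 2 = (2 * Real.pi) ^ 2 * E y ^ 2 := by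
      intro y; simp [abs_of_pos hpi, mul_pow]
    have h2 : ∀ t, ‖ker ε 0 (pt σ t)‖ ^ 2 =
        sqF σ t * Real.exp (2 * ε ^ 2 * ((1 / 2 + σ) ^ 2 - t ^ 2)) := by
      intro t
      rw [norm_ker_pt, mul_zero, Real.exp_zero, mul_one, mul_pow, sqF, ← Real.exp_nat_mul]
      congr 2; push_cast; ring
    simp only [h1, h2] at hP
    rw [integral_const_mul, pow_two, mul_assoc] at hP
    exact mul_left_cancel₀ (by positivity) hP

lemma gss_nonneg (z : ℝ) : 0 ≤ gss z := by unfold gss; positivity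

lemma continuous_gss : Continuous gss := by unfold gss; fun_prop

lemma integrable_gss : Integrable gss :=
  (integrable_exp_neg_mul_sq (b := 1 / 4) (by norm_num)).div_const _

lemma integral_gss : ∫ z, gss z = 1 := by
  unfold gss
  rw [integral_div, integral_gaussian, Real.sqrt_div' _ (by norm_num),
    show (1 / 4 : ℝ) = (1 / 2) ^ 2 by norm_num, Real.sqrt_sq (by norm_num)]
  have : √Real.pi ≠ 0 := (Real.sqrt_pos.mpr Real.pi_pos).ne'
  field_simp

lemma exp_mul_gss (c z : ℝ) : Real.exp (c * z) * gss z = Real.exp (c ^ 2) * gss (z - 2 * c) := by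
  unfold gss
  rw [← mul_div_assoc, ← mul_div_assoc, ← Real.exp_add, ← Real.exp_add]
  congr 2; ring

lemma integrable_exp_mul_gss (c : ℝ) : Integrable fun z => Real.exp (c * z) * gss z := by
  simp only [exp_mul_gss]
  exact (integrable_gss.comp_sub_right (2 * c)).const_mul _

lemma integral_exp_mul_gss (c : ℝ) : ∫ z, Real.exp (c * z) * gss z = Real.exp (c ^ 2) := by
  simp only [exp_mul_gss]
  rw [integral_const_mul, integral_sub_right_eq_self gss (2 * c), integral_gss, mul_one]

lemma measurable_mexp_sub (ε y : ℝ) : Measurable fun z => mexp (y - ε * z) :=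
  measurable_mexp.comp (by fun_prop)

lemma integrable_mexp_mul_gss (ε y : ℝ) : Integrable fun z => mexp (y - ε * z) * gss z := by
  refine ((integrable_exp_mul_gss (-ε)).const_mul (Real.exp y)).mono'
    ((measurable_mexp_sub ε y).mul continuous_gss.measurable).aestronglyMeasurable
    (Eventually.of_forall fun z => ?_)
  rw [norm_mul, Real.norm_eq_abs, Real.norm_of_nonneg (gss_nonneg z), ← mul_assoc, ← Real.exp_add]
  refine mul_le_mul_of_nonneg_right ((abs_mexp_le _).trans (le_of_eq ?_)) (gss_nonneg z)
  congr 1; ring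

lemma integrable_mexp_sq_mul_gss (ε y : ℝ) : Integrable fun z => mexp (y - ε * z) ^ 2 * gss z := by
  refine ((integrable_exp_mul_gss (-(2 * ε))).const_mul (Real.exp (2 * y))).mono'
    (((measurable_mexp_sub ε y).pow_const 2).mul continuous_gss.measurable).aestronglyMeasurable
    (Eventually.of_forall fun z => ?_)
  rw [norm_mul, norm_pow, Real.norm_eq_abs, Real.norm_of_nonneg (gss_nonneg z), ← mul_assoc,
    ← Real.exp_add]
  refine mul_le_mul_of_nonneg_right ((pow_le_pow_left₀ (abs_nonneg _) (abs_mexp_le _) 2).trans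
    (le_of_eq ?_)) (gss_nonneg z)
  rw [← Real.exp_nat_mul]; congr 1; push_cast; ring

lemma mol_sq_le (ε y : ℝ) : mol ε y ^ 2 ≤ ∫ z, mexp (y - ε * z) ^ 2 * gss z := by
  have h1 : 0 ≤ ∫ z, (mexp (y - ε * z) - mol ε y) ^ 2 * gss z :=
    integral_nonneg fun z => mul_nonneg (sq_nonneg _) (gss_nonneg z)
  have h2 : (∫ z, (mexp (y - ε * z) - mol ε y) ^ 2 * gss z) =
      (∫ z, mexp (y - ε * z) ^ 2 * gss z) - mol ε y ^ 2 := by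
    have : ∀ z, (mexp (y - ε * z) - mol ε y) ^ 2 * gss z = mexp (y - ε * z) ^ 2 * gss z -
        2 * mol ε y * (mexp (y - ε * z) * gss z) + mol ε y ^ 2 * gss z := fun z => by ring
    simp only [this]
    have hi : Integrable fun z => mexp (y - ε * z) ^ 2 * gss z -
        2 * mol ε y * (mexp (y - ε * z) * gss z) :=
      (integrable_mexp_sq_mul_gss ε y).sub ((integrable_mexp_mul_gss ε y).const_mul _)
    rw [integral_add hi (integrable_gss.const_mul _),
      integral_sub (integrable_mexp_sq_mul_gss ε y) ((integrable_mexp_mul_gss ε y).const_mul _),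
      integral_const_mul, integral_const_mul, integral_gss]
    change _ - 2 * mol ε y * mol ε y + _ = _
    ring
  linarith

lemma ae_continuousAt_mexp : ∀ᵐ y : ℝ, ContinuousAt mexp y := by
  have hm : Monotone fun y : ℝ => ⌊Real.exp y⌋₊ := fun a b h => Nat.floor_mono
    (Real.exp_le_exp.mpr h)
  have hc := hm.countable_not_continuousAt.ae_notMem volume
  filter_upwards [hc] with y hy
  simp only [not_not] at hy
  have : mexp = (fun n : ℕ => ∑ k ∈ Finset.Icc 1 n, ((ArithmeticFunction.moebius k : ℤ) : ℝ)) ∘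
      fun y => ⌊Real.exp y⌋₊ := rfl
  rw [this]
  exact (continuous_of_discreteTopology.continuousAt).comp hy

lemma tendsto_mol {e : ℕ → ℝ} (he : ∀ n, e n ∈ Set.Ioc (0 : ℝ) 1) (he0 : Tendsto e atTop (𝓝 0))
    {y : ℝ} (hy : ContinuousAt mexp y) : Tendsto (fun n => mol (e n) y) atTop (𝓝 (mexp y)) := by
  have h0 : mexp y = ∫ z, mexp y * gss z := by rw [integral_const_mul, integral_gss, mul_one]
  rw [h0]
  refine tendsto_integral_of_dominated_convergence
    (fun z => Real.exp y * (Real.exp (1 * z) * gss z + Real.exp (-1 * z) * gss z))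
    (fun n => (integrable_mexp_mul_gss (e n) y).aestronglyMeasurable)
    (((integrable_exp_mul_gss 1).add (integrable_exp_mul_gss (-1))).const_mul _) (fun n => ?_) ?_
  · refine Eventually.of_forall fun z => ?_
    rw [norm_mul, Real.norm_eq_abs, Real.norm_of_nonneg (gss_nonneg z), ← add_mul, ← mul_assoc]
    refine mul_le_mul_of_nonneg_right ((abs_mexp_le _).trans ?_) (gss_nonneg z)
    rw [sub_eq_add_neg, Real.exp_add]
    refine mul_le_mul_of_nonneg_left ?_ (Real.exp_pos _).le
    obtain ⟨h1, h2⟩ := he n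
    have p1 := Real.exp_pos (1 * z)
    have p2 := Real.exp_pos (-1 * z)
    rcases le_total 0 z with hz | hz
    · have : Real.exp (-(e n * z)) ≤ Real.exp (1 * z) := Real.exp_le_exp.mpr (by nlinarith)
      linarith
    · have : Real.exp (-(e n * z)) ≤ Real.exp (-1 * z) := Real.exp_le_exp.mpr (by nlinarith)
      linarith
  · refine Eventually.of_forall fun z => ?_
    refine Tendsto.mul_const _ (hy.tendsto.comp ?_)
    have := (tendsto_const_nhds (x := y)).sub (he0.mul_const z)
    simpa using this

lemma lintegral_mol_le (ε c : ℝ) :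
    ∫⁻ y, ENNReal.ofReal (mol ε y ^ 2 * Real.exp (-c * y)) ≤
      ENNReal.ofReal (Real.exp ((c * ε) ^ 2)) *
        ∫⁻ y, ENNReal.ofReal (mexp y ^ 2 * Real.exp (-c * y)) := by
  have hm : Measurable fun u => ENNReal.ofReal (mexp u ^ 2 * Real.exp (-c * u)) :=
    ((measurable_mexp.pow_const 2).mul (by fun_prop)).ennreal_ofReal
  have h1 : ∀ y, ENNReal.ofReal (mol ε y ^ 2 * Real.exp (-c * y)) ≤
      ∫⁻ z, ENNReal.ofReal (Real.exp (-(c * ε) * z) * gss z) *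
        ENNReal.ofReal (mexp (y - ε * z) ^ 2 * Real.exp (-c * (y - ε * z))) := by
    intro y
    have e1 : ∀ z, ENNReal.ofReal (Real.exp (-(c * ε) * z) * gss z) *
        ENNReal.ofReal (mexp (y - ε * z) ^ 2 * Real.exp (-c * (y - ε * z))) =
        ENNReal.ofReal (mexp (y - ε * z) ^ 2 * gss z * Real.exp (-c * y)) := by
      intro z
      rw [← ENNReal.ofReal_mul (mul_nonneg (Real.exp_pos _).le (gss_nonneg z))]
      have : Real.exp (-c * y) = Real.exp (-(c * ε) * z) * Real.exp (-c * (y - ε * z)) := by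
        rw [← Real.exp_add]; congr 1; ring
      rw [this]; congr 1; ring
    simp only [e1]
    rw [← ofReal_integral_eq_lintegral_ofReal ((integrable_mexp_sq_mul_gss ε y).mul_const _)
      (Eventually.of_forall fun z => mul_nonneg (mul_nonneg (sq_nonneg _) (gss_nonneg z))
        (Real.exp_pos _).le), integral_mul_const]
    exact ENNReal.ofReal_le_ofReal (mul_le_mul_of_nonneg_right (mol_sq_le ε y) (Real.exp_pos _).le)
  refine (lintegral_mono h1).trans ?_
  have hmz : Measurable fun z => ENNReal.ofReal (Real.exp (-(c * ε) * z) * gss z) :=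
    (Measurable.mul (by fun_prop) continuous_gss.measurable).ennreal_ofReal
  rw [lintegral_lintegral_swap]
  · have h2 : ∀ z, ∫⁻ y, ENNReal.ofReal (Real.exp (-(c * ε) * z) * gss z) *
        ENNReal.ofReal (mexp (y - ε * z) ^ 2 * Real.exp (-c * (y - ε * z))) =
        ENNReal.ofReal (Real.exp (-(c * ε) * z) * gss z) *
          ∫⁻ y, ENNReal.ofReal (mexp y ^ 2 * Real.exp (-c * y)) := by
      intro z
      rw [lintegral_const_mul' _ _ ENNReal.ofReal_ne_top, lintegral_sub_right_eq_self
        (fun u => ENNReal.ofReal (mexp u ^ 2 * Real.exp (-c * u))) (ε * z)]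
    simp only [h2]
    rw [lintegral_mul_const _ hmz, ← ofReal_integral_eq_lintegral_ofReal (integrable_exp_mul_gss _)
      (Eventually.of_forall fun z => mul_nonneg (Real.exp_pos _).le (gss_nonneg z)),
      integral_exp_mul_gss, neg_sq]
  · refine Measurable.aemeasurable ?_
    exact (hmz.comp measurable_snd).mul (hm.comp (by fun_prop))

/-- Plancherel for the summatory function of `μ`. -/
theorem SimpleRH.integral_mexp_sq (H : SimpleRH) (hw : ∑' γ : ordSet, ENNReal.ofReal (wt γ) ≠ ⊤)
    {σ : ℝ} (hσ : 0 < σ) (hσ2 : σ < 1 / 2) :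
    (Integrable fun y => mexp y ^ 2 * Real.exp (-(1 + 2 * σ) * y)) ∧
    2 * Real.pi * ∫ y, mexp y ^ 2 * Real.exp (-(1 + 2 * σ) * y) = ∫ t, sqF σ t := by
  have hpi := Real.pi_pos
  set c := 1 + 2 * σ with hc
  set e : ℕ → ℝ := fun n => 1 / ((n : ℝ) + 1) with he
  have he1 : ∀ n, e n ∈ Set.Ioc (0 : ℝ) 1 := fun n => by
    refine ⟨by simp only [he]; positivity, ?_⟩
    simp only [he]
    rw [div_le_one (by positivity)]
    linarith [(Nat.cast_nonneg n : (0 : ℝ) ≤ n)]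
  have he0 : Tendsto e atTop (𝓝 0) := tendsto_one_div_add_atTop_nhds_zero_nat
  have hP := fun n => H.integral_mol_sq hw (he1 n).1 hσ hσ2
  have hnn : ∀ n, 0 ≤ᵐ[volume] fun y => mol (e n) y ^ 2 * Real.exp (-c * y) := fun n =>
    Eventually.of_forall fun y => mul_nonneg (sq_nonneg _) (Real.exp_pos _).le
  have hnn' : 0 ≤ᵐ[volume] fun y => mexp y ^ 2 * Real.exp (-c * y) :=
    Eventually.of_forall fun y => mul_nonneg (sq_nonneg _) (Real.exp_pos _).le
  have hi := H.integrable_sqF hw hσ hσ2.le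
  set J : ℕ → ℝ := fun n => ∫ y, mol (e n) y ^ 2 * Real.exp (-c * y) with hJ
  set L : ℝ := (2 * Real.pi)⁻¹ * ∫ t, sqF σ t with hL
  have hlim : Tendsto J atTop (𝓝 L) := by
    have h1 : Tendsto (fun n => ∫ t, sqF σ t * Real.exp (2 * e n ^ 2 * ((1 / 2 + σ) ^ 2 - t ^ 2)))
        atTop (𝓝 (∫ t, sqF σ t)) := by
      refine tendsto_integral_of_dominated_convergence (fun t => sqF σ t * Real.exp 2)
        (fun n => (H.continuous_sqF hσ).aestronglyMeasurable.mul (by fun_prop)) (hi.mul_const _)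
        (fun n => Eventually.of_forall fun t => ?_) (Eventually.of_forall fun t => ?_)
      · rw [Real.norm_of_nonneg (mul_nonneg (sqF_nonneg _ _) (Real.exp_pos _).le)]
        refine mul_le_mul_of_nonneg_left (Real.exp_le_exp.mpr ?_) (sqF_nonneg _ _)
        obtain ⟨a1, a2⟩ := he1 n
        have b1 : e n ^ 2 ≤ 1 := by nlinarith
        have b2 : (1 / 2 + σ) ^ 2 ≤ 1 := by nlinarith
        have b3 : e n ^ 2 * (1 / 2 + σ) ^ 2 ≤ 1 := mul_le_one₀ b1 (sq_nonneg _) b2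
        nlinarith [mul_nonneg (sq_nonneg (e n)) (sq_nonneg t)]
      · have h2 : Tendsto (fun n => 2 * e n ^ 2 * ((1 / 2 + σ) ^ 2 - t ^ 2)) atTop (𝓝 0) := by
          have := ((he0.pow 2).const_mul 2).mul_const ((1 / 2 + σ) ^ 2 - t ^ 2)
          simpa using this
        have h3 := ((Real.continuous_exp.tendsto 0).comp h2).const_mul (sqF σ t)
        rw [Real.exp_zero, mul_one] at h3
        exact h3
    refine (h1.const_mul (2 * Real.pi)⁻¹).congr fun n => ?_
    rw [← (hP n).2, ← mul_assoc, inv_mul_cancel₀ (by positivity), one_mul]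
  have hJe : ∀ n, ∫⁻ y, ENNReal.ofReal (mol (e n) y ^ 2 * Real.exp (-c * y)) =
      ENNReal.ofReal (J n) := fun n =>
    (ofReal_integral_eq_lintegral_ofReal (hP n).1 (hnn n)).symm
  have hmeas : Measurable fun y => mexp y ^ 2 * Real.exp (-c * y) :=
    (measurable_mexp.pow_const 2).mul (by fun_prop)
  have hfatou : ∫⁻ y, ENNReal.ofReal (mexp y ^ 2 * Real.exp (-c * y)) ≤ ENNReal.ofReal L := by
    have h1 := lintegral_liminf_le (u := atTop) (μ := volume) (f := fun (n : ℕ) (y : ℝ) =>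
      ENNReal.ofReal (mol (e n) y ^ 2 * Real.exp (-c * y))) (fun n =>
        (((measurable_mol (e n)).measurable.pow_const 2).mul (by fun_prop)).ennreal_ofReal)
    simp only [hJe] at h1
    have h0 : Tendsto (fun n => ENNReal.ofReal (J n)) atTop (𝓝 (ENNReal.ofReal L)) :=
      (ENNReal.continuous_ofReal.tendsto L).comp hlim
    rw [h0.liminf_eq] at h1
    refine le_trans (le_of_eq (lintegral_congr_ae ?_)) h1
    filter_upwards [ae_continuousAt_mexp] with y hy
    have h2 := ((tendsto_mol he1 he0 hy).pow 2).mul_const (Real.exp (-c * y))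
    exact ((ENNReal.continuous_ofReal.tendsto _).comp h2).liminf_eq.symm
  have hint : Integrable fun y => mexp y ^ 2 * Real.exp (-c * y) := by
    refine ⟨hmeas.aestronglyMeasurable, ?_⟩
    rw [hasFiniteIntegral_iff_ofReal hnn']
    exact hfatou.trans_lt ENNReal.ofReal_lt_top
  refine ⟨hint, ?_⟩
  set S : ℝ := ∫ y, mexp y ^ 2 * Real.exp (-c * y) with hS
  have hS0 : 0 ≤ S := integral_nonneg fun y => mul_nonneg (sq_nonneg _) (Real.exp_pos _).le
  have hL0 : 0 ≤ L := mul_nonneg (by positivity) (integral_nonneg fun t => sqF_nonneg σ t)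
  rw [← ofReal_integral_eq_lintegral_ofReal hint hnn', ENNReal.ofReal_le_ofReal_iff hL0] at hfatou
  have hlow : L ≤ S := by
    have h1 : ∀ n, J n ≤ Real.exp ((c * e n) ^ 2) * S := by
      intro n
      have := lintegral_mol_le (e n) c
      rw [hJe, ← ofReal_integral_eq_lintegral_ofReal hint hnn', ← ENNReal.ofReal_mul
        (Real.exp_pos _).le, ENNReal.ofReal_le_ofReal_iff (by positivity)] at this
      exact this
    have h2 : Tendsto (fun n => Real.exp ((c * e n) ^ 2) * S) atTop (𝓝 S) := by
      have h3 : Tendsto (fun n => (c * e n) ^ 2) atTop (𝓝 0) := by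
        simpa using (he0.const_mul c).pow 2
      have h4 := ((Real.continuous_exp.tendsto 0).comp h3).mul_const S
      rw [Real.exp_zero, one_mul] at h4
      exact h4
    exact le_of_tendsto_of_tendsto' hlim h2 h1
  rw [show S = L from le_antisymm hfatou hlow, hL, ← mul_assoc, mul_inv_cancel₀ (by positivity), one_mul]

lemma coef_neg (γ : ℝ) : coef (-γ) = coef γ := by
  unfold coef
  rw [div_pow, div_pow, resAbs_neg, norm_crit_sq, norm_crit_sq, neg_sq]

lemma tsum_coef_eq (H : SimpleRH) (hw : ∑' γ : ordSet, ENNReal.ofReal (wt γ) ≠ ⊤) :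
    ∑' γ : ordSet, coef γ =
      ∑' γ : {γ : ℝ // 0 < γ ∧ riemannZeta (1 / 2 + γ * Complex.I) = 0},
        2 / ‖((1 / 2 : ℂ) + (γ : ℝ) * Complex.I) *
          deriv riemannZeta (1 / 2 + (γ : ℝ) * Complex.I)‖ ^ 2 := by
  have h1 := congrArg ENNReal.toReal (tsum_indicator_neg_symm H (fun γ => ENNReal.ofReal (coef γ))
    (fun x => by simp only [coef_neg]))
  rw [← ENNReal.ofReal_tsum_of_nonneg (fun γ => coef_nonneg _) (summable_coef hw),
    ENNReal.toReal_ofReal (tsum_nonneg fun γ => coef_nonneg _), ENNReal.toReal_mul,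
    ENNReal.tsum_toReal_eq (fun _ => ENNReal.ofReal_ne_top)] at h1
  rw [h1, ENNReal.toReal_ofNat, ← tsum_mul_left]
  refine tsum_congr fun γ => ?_
  rw [ENNReal.toReal_ofReal (coef_nonneg _), coef, resAbs, norm_mul, mul_pow, div_pow, inv_pow]
  change 2 * ((‖deriv riemannZeta (crit γ)‖ ^ 2)⁻¹ / ‖crit γ‖ ^ 2) =
    2 / (‖crit γ‖ ^ 2 * ‖deriv riemannZeta (crit γ)‖ ^ 2)
  rw [div_eq_mul_inv, div_eq_mul_inv, mul_inv]; ring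

lemma sq_mexp_div (y : ℝ) : (Mfun (Real.exp y) / Real.exp (y / 2)) ^ 2 =
    mexp y ^ 2 * Real.exp (-y) := by
  rw [div_pow, ← Real.exp_nat_mul, Real.exp_neg, div_eq_mul_inv, mexp]
  congr 3; push_cast; ring

theorem SimpleRH.tendsto_mean_square (H : SimpleRH)
    (hw : ∑' γ : ordSet, ENNReal.ofReal (wt γ) ≠ ⊤) :
    Tendsto (fun Y : ℝ => (1 / Y) * ∫ y in (0 : ℝ)..Y,
        (Mfun (Real.exp y) / Real.exp (y / 2)) ^ 2) atTop (𝓝 (∑' γ : ordSet, coef γ)) := by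
  have hpi := Real.pi_pos
  have hexp : ∀ s y : ℝ, (Mfun (Real.exp y) / Real.exp (y / 2)) ^ 2 * Real.exp (-s * y) =
      mexp y ^ 2 * Real.exp (-(1 + 2 * (s / 2)) * y) := by
    intro s y
    rw [sq_mexp_div, mul_assoc, ← Real.exp_add]; congr 2; ring
  refine tendsto_cesaro_of_laplace (fun y => sq_nonneg _) (fun s hs => ?_) ?_
  · simp only [hexp]
    exact (H.integral_mexp_sq hw (half_pos hs.1) (by linarith [hs.2])).1.integrableOn
  · have hev : ∀ᶠ s : ℝ in 𝓝[>] 0, s ∈ Set.Ioo (0 : ℝ) 1 := Ioo_mem_nhdsGT one_pos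
    have h1 : Tendsto (fun s : ℝ => s / 2) (𝓝[>] 0) (𝓝[>] 0) := by
      refine tendsto_nhdsWithin_iff.mpr ⟨?_, ?_⟩
      · have : Tendsto (fun s : ℝ => s / 2) (𝓝 0) (𝓝 (0 / 2)) :=
          (continuous_id.div_const 2).tendsto 0
        rw [zero_div] at this
        exact this.mono_left nhdsWithin_le_nhds
      · filter_upwards [self_mem_nhdsWithin] with s hs
        exact half_pos (Set.mem_Ioi.mp hs)
    have h2 := ((H.tendsto_integral_sqF hw).comp h1).const_mul Real.pi⁻¹
    rw [← mul_assoc, inv_mul_cancel₀ hpi.ne', one_mul] at h2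
    refine h2.congr' ?_
    filter_upwards [hev] with s hs
    have h3 := (H.integral_mexp_sq hw (half_pos hs.1) (by linarith [hs.2])).2
    simp only [Function.comp, hexp]
    rw [← h3]
    have h4 : ∫ y in Set.Ioi (0 : ℝ), mexp y ^ 2 * Real.exp (-(1 + 2 * (s / 2)) * y) =
        ∫ y, mexp y ^ 2 * Real.exp (-(1 + 2 * (s / 2)) * y) := by
      rw [← integral_Ici_eq_integral_Ioi]
      refine setIntegral_eq_integral_of_forall_compl_eq_zero fun y hy => ?_
      rw [mexp_of_neg (not_le.mp hy)]; simp
    rw [h4]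
    field_simp

end MobiusMean

theorem statement13
    (hRH : ∀ ρ : ℂ, riemannZeta ρ = 0 → 0 < ρ.re → ρ.re < 1 → ρ.re = 1 / 2)
    (hsimple : ∀ ρ : ℂ, riemannZeta ρ = 0 → 0 < ρ.re → ρ.re < 1 →
      deriv riemannZeta ρ ≠ 0)
    (θ C : ℝ) (hθ1 : 1 ≤ θ) (hθ2 : θ < 3 - Real.sqrt 3)
    (hJ : ∀ T : ℝ, 1 ≤ T →
      (∑' γ : {γ : ℝ // 0 < γ ∧ γ ≤ T ∧ riemannZeta (1 / 2 + γ * Complex.I) = 0},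
        1 / ‖deriv riemannZeta (1 / 2 + (γ : ℝ) * Complex.I)‖ ^ 2) ≤ C * T ^ θ) :
    Tendsto (fun Y : ℝ => (1 / Y) * ∫ y in (0:ℝ)..Y,
        (Mfun (Real.exp y) / Real.exp (y / 2)) ^ 2) atTop
      (𝓝 (∑' γ : {γ : ℝ // 0 < γ ∧ riemannZeta (1 / 2 + γ * Complex.I) = 0},
        2 / ‖((1 / 2 : ℂ) + (γ : ℝ) * Complex.I) *
          deriv riemannZeta (1 / 2 + (γ : ℝ) * Complex.I)‖ ^ 2)) := by
  have H : MobiusMean.SimpleRH := ⟨hRH, hsimple⟩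
  have hθ : θ < 3 / 2 := by
    have : (3 / 2 : ℝ) < √3 := Real.lt_sqrt_of_sq_lt (by norm_num)
    linarith
  have hw := MobiusMean.tsum_wt_ne_top H hθ hJ
  rw [← MobiusMean.tsum_coef_eq H hw]
  exact H.tendsto_mean_square hw
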